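/- There exists a constant D0 > 0 such that for every number field K with d_K ≥ D0, the Dedekind zeta function ζ_K(s) has no zeros in the region Re s ≥ 1 − 1/(12.55·log d_K + 9.69·n_K·log|Im s| + 3.03·n_K + 58.63), |Im s| ≥ 1. -/

import Mathlib

open Complex NumberField Filter

/-- `Z : ℂ → ℂ` is (a realization of) the Dedekind zeta function of the number field `K`:
it is analytic away from `s = 1`, it has a pole at `s = 1`, and on the half-plane
`Re s > 1` it is given by the usual Dirichlet series over the nonzero ideals of the
ring of integers of `K`. -/
def IsDedekindZeta (K : Type) [Field K] [NumberField K] (Z : ℂ → ℂ) : Prop :=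
  (∀ s : ℂ, s ≠ 1 → AnalyticAt ℂ Z s) ∧
  Tendsto (fun s : ℂ => ‖Z s‖) (nhdsWithin 1 {(1 : ℂ)}ᶜ) atTop ∧
  ∀ s : ℂ, 1 < s.re →
    Z s = ∑' I : {I : Ideal (𝓞 K) // I ≠ 0}, (Ideal.absNorm I.val : ℂ) ^ (-s)

noncomputable section

open Real Filter MeasureTheory Set

theorem summable_pi_prod {ι κ : Type*} [Fintype ι] (g : κ → ℝ) (hg : ∀ k, 0 ≤ g k)
    (h : Summable g) : Summable fun k : ι → κ => ∏ i, g (k i) := by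
  classical
  refine summable_of_sum_le (c := (∑' k, g k) ^ Fintype.card ι)
    (fun k => Finset.prod_nonneg fun i _ => hg _) fun s => ?_
  have hs : s ⊆ Fintype.piFinset fun i : ι => s.image (fun k => k i) := fun k hk => by
    rw [Fintype.mem_piFinset]
    exact fun i => Finset.mem_image_of_mem _ hk
  calc _ ≤ ∑ k ∈ Fintype.piFinset fun i : ι => s.image (fun k => k i), ∏ i, g (k i) :=
        Finset.sum_le_sum_of_subset_of_nonneg hs fun k _ _ => Finset.prod_nonneg fun i _ => hg _
    _ = ∏ i : ι, ∑ k ∈ s.image (fun k => k i), g k := (Finset.prod_univ_sum _ _).symm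
    _ ≤ ∏ i : ι, ∑' k, g k := Finset.prod_le_prod
        (fun i _ => Finset.sum_nonneg fun k _ => hg k) (fun i _ => h.sum_le_tsum _ fun k _ => hg k)
    _ = _ := by simp

theorem summable_exp_neg_mul_sum_sq {ι : Type*} [Fintype ι] {c : ℝ} (hc : 0 < c) :
    Summable fun k : ι → ℤ => rexp (-c * ∑ i, (k i : ℝ) ^ 2) := by
  have h1 : Summable fun k : ℤ => rexp (-c * (k : ℝ) ^ 2) := by
    have := summable_pow_mul_jacobiTheta₂_term_bound 0 (T := c / π) (by positivity) 0
    refine this.congr fun k => ?_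
    simp
    field_simp
  refine (summable_pi_prod _ (fun k => (exp_pos _).le) h1).congr fun k => ?_
  rw [← Real.exp_sum, Finset.mul_sum]

theorem exists_pos_mul_sum_sq_le {ι : Type*} [Fintype ι] [DecidableEq ι] (M : Matrix ι ι ℝ)
    (hM : M.det ≠ 0) : ∃ c > 0, ∀ x : ι → ℝ, c * ∑ i, x i ^ 2 ≤ ∑ i, (M.mulVec x i) ^ 2 := by
  set C : ℝ := ∑ i, ∑ j, (M⁻¹ i j) ^ 2
  have hC : 0 ≤ C := by positivity
  refine ⟨(C + 1)⁻¹, by positivity, fun x => ?_⟩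
  have hx : x = M⁻¹.mulVec (M.mulVec x) := by
    rw [Matrix.mulVec_mulVec, Matrix.nonsing_inv_mul _ (isUnit_iff_ne_zero.2 hM), Matrix.one_mulVec]
  have key : ∑ i, x i ^ 2 ≤ C * ∑ i, (M.mulVec x i) ^ 2 := by
    conv_lhs => rw [hx]
    rw [Finset.sum_mul]
    refine Finset.sum_le_sum fun i _ => ?_
    exact Finset.sum_mul_sq_le_sq_mul_sq _ _ _
  rw [inv_mul_le_iff₀ (by positivity)]
  have : 0 ≤ ∑ i, (M.mulVec x i) ^ 2 := by positivity
  nlinarith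

end

noncomputable section

open Real Filter MeasureTheory Set

theorem poisson_summation_pi {ι : Type*} [Fintype ι] (f : (ι → ℝ) → ℂ) (hf : Continuous f)
    (hfi : Integrable f)
    (hloc : ∀ R : ℝ, ∃ u : (ι → ℤ) → ℝ, Summable u ∧
      ∀ x : ι → ℝ, ‖x‖ < R → ∀ k : ι → ℤ, ‖f (fun i => x i + k i)‖ ≤ u k)
    (hs : Summable fun n : ι → ℤ => ∫ x, Complex.exp (-(2 * π * Complex.I * (∑ i, (n i : ℝ) * x i : ℝ))) * f x) :
    HasSum (fun n : ι → ℤ => ∫ x, Complex.exp (-(2 * π * Complex.I * (∑ i, (n i : ℝ) * x i : ℝ))) * f x)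
      (∑' k : ι → ℤ, f (fun i => (k i : ℝ))) := by
  set G : (ι → ℝ) → ℂ := fun x => ∑' k : ι → ℤ, f (fun i => x i + k i) with hG
  have hGc : Continuous G := by
    rw [continuous_iff_continuousAt]
    intro x
    obtain ⟨u, hu, hb⟩ := hloc (‖x‖ + 1)
    have : ContinuousOn G (Metric.ball 0 (‖x‖ + 1)) :=
      continuousOn_tsum (fun k => (hf.comp (by fun_prop)).continuousOn) hu
        fun k y hy => hb y (by simpa using hy) k
    exact this.continuousAt (Metric.isOpen_ball.mem_nhds (by simp))
  have hGper : ∀ (x : ι → ℝ) (m : ι → ℤ), G (fun i => x i + m i) = G x := by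
    intro x m
    simp only [hG]
    rw [← (Equiv.addLeft m).tsum_eq (fun k : ι → ℤ => f (fun i => x i + k i))]
    refine tsum_congr fun k => ?_
    congr 1
    ext i
    simp
    ring
  let p : C(ι → ℝ, UnitAddTorus ι) := ⟨Pi.map (fun _ x => (x : UnitAddCircle)), by
    refine (IsOpenQuotientMap.piMap fun _ => ?_).continuous
    exact QuotientAddGroup.isOpenQuotientMap_mk⟩
  have hp : Topology.IsQuotientMap p := by
    refine (IsOpenQuotientMap.piMap fun _ => ?_).isQuotientMap
    exact QuotientAddGroup.isOpenQuotientMap_mk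
  have hfac : Function.FactorsThrough (⟨G, hGc⟩ : C(ι → ℝ, ℂ)) p := by
    intro x y hxy
    have : ∀ i, ∃ m : ℤ, y i = x i + m := fun i => by
      have := congrFun hxy i
      simp only [p, ContinuousMap.coe_mk, Pi.map_apply] at this
      rw [QuotientAddGroup.eq] at this
      obtain ⟨m, hm⟩ := AddSubgroup.mem_zmultiples_iff.1 this
      exact ⟨m, by simp at hm; linarith⟩
    choose m hm using this
    have hy : y = fun i => x i + m i := funext hm
    rw [hy]
    exact (hGper x m).symm
  let g : C(UnitAddTorus ι, ℂ) := hp.lift ⟨G, hGc⟩ hfac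
  have hg : ∀ x : ι → ℝ, g (fun i => (x i : UnitAddCircle)) = G x := fun x => by
    have := congrArg (fun h => h x) (hp.lift_comp ⟨G, hGc⟩ hfac)
    exact this
  have hcoeff : ∀ n, UnitAddTorus.mFourierCoeff g n =
      ∫ x, Complex.exp (-(2 * π * Complex.I * (∑ i, (n i : ℝ) * x i : ℝ))) * f x := by
    intro n
    set F : (ι → ℝ) → ℂ := fun x => Complex.exp (-(2 * π * Complex.I * (∑ i, (n i : ℝ) * x i : ℝ))) * f x with hF
    have hFi : Integrable F := by
      refine hfi.bdd_mul (c := 1) (Continuous.aestronglyMeasurable (by fun_prop)) ?_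
      refine Eventually.of_forall fun x => ?_
      rw [Complex.norm_exp]
      simp
    let B : (ι → ℤ) → Set (ι → ℝ) := fun k => {x | ∀ i, x i ∈ Ioc (k i : ℝ) (k i + 1)}
    have hBm : ∀ k, MeasurableSet (B k) := fun k => by
      have : B k = Set.pi univ fun i => Ioc (k i : ℝ) (k i + 1) := by ext; simp [B]
      rw [this]
      exact MeasurableSet.univ_pi fun i => measurableSet_Ioc
    have hBd : Pairwise (Function.onFun Disjoint B) := by
      intro k l hkl
      rw [Function.onFun, Set.disjoint_left]
      intro x hk hl
      refine hkl (funext fun i => ?_)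
      have h1 := hk i
      have h2 := hl i
      rw [mem_Ioc] at h1 h2
      have e1 : k i < l i + 1 := by exact_mod_cast h1.1.trans_le h2.2
      have e2 : l i < k i + 1 := by exact_mod_cast h2.1.trans_le h1.2
      omega
    have hBU : ⋃ k, B k = univ := by
      rw [Set.eq_univ_iff_forall]
      intro x
      rw [Set.mem_iUnion]
      refine ⟨fun i => ⌈x i⌉ - 1, fun i => ?_⟩
      rw [mem_Ioc]
      push_cast
      exact ⟨by linarith [Int.ceil_lt_add_one (x i)], by linarith [Int.le_ceil (x i)]⟩
    have htr : ∀ {E : Type} [NormedAddCommGroup E] [NormedSpace ℝ E] (H : (ι → ℝ) → E) (k : ι → ℤ),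
        ∫ x in B k, H x = ∫ x in B 0, H (fun i => x i + k i) := by
      intro E _ _ H k
      have := (measurePreserving_add_right (volume : Measure (ι → ℝ))
        (fun i => (k i : ℝ))).setIntegral_preimage_emb (measurableEmbedding_addRight _) H (B k)
      rw [← this]
      have e : (fun x : ι → ℝ => x + fun i => (k i : ℝ)) ⁻¹' B k = B 0 := by
        ext x
        simp only [B, mem_preimage, mem_ofPred_eq, Pi.add_apply, mem_Ioc, Pi.zero_apply,
          Int.cast_zero]
        refine forall_congr' fun i => ?_
        constructor <;> rintro ⟨h1, h2⟩ <;> constructor <;> linarith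
      rw [e]
      rfl
    have h1 : HasSum (fun k : ι → ℤ => ∫ x in B 0, F (fun i => x i + k i)) (∫ x, F x) := by
      have := hasSum_integral_iUnion hBm hBd (f := F) (μ := volume) hFi.integrableOn
      rw [hBU, setIntegral_univ] at this
      rwa [funext fun k => htr F k] at this
    have h2 : Summable (fun k : ι → ℤ => ∫ x in B 0, ‖F (fun i => x i + k i)‖) := by
      have := hasSum_integral_iUnion hBm hBd (f := fun x => ‖F x‖) (μ := volume)
        hFi.norm.integrableOn
      rw [hBU, setIntegral_univ] at this
      rw [funext fun k => htr (fun x => ‖F x‖) k] at this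
      exact this.summable
    have h3 := hasSum_integral_of_summable_integral_norm
      (μ := volume.restrict (B 0)) (F := fun (k : ι → ℤ) x => F (fun i => x i + k i))
      (fun k => (hFi.comp_add_right (fun i => (k i : ℝ))).integrableOn) h2
    change _ = ∫ x, F x
    rw [h1.unique h3, UnitAddTorus.mFourierCoeff_eq_integral g n 0]
    have hB0 : {x : ι → ℝ | ∀ i, x i ∈ Ioc ((0 : ι → ℝ) i) ((0 : ι → ℝ) i + 1)} = B 0 := by
      ext x
      simp [B]
    rw [hB0]
    refine setIntegral_congr_fun (hBm 0) fun x _ => ?_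
    simp only [smul_eq_mul, hg, hG, hF]
    rw [← tsum_mul_left]
    refine tsum_congr fun k => ?_
    congr 1
    have e1 : (∑ i, (n i : ℝ) * (x i + k i) : ℝ) =
        (∑ i, (n i : ℝ) * x i : ℝ) + ((∑ i, n i * k i : ℤ) : ℝ) := by
      push_cast
      rw [← Finset.sum_add_distrib]
      exact Finset.sum_congr rfl fun i _ => by ring
    have e2 : -(2 * π * Complex.I * (∑ i, (n i : ℝ) * (x i + k i) : ℝ)) =
        -(2 * π * Complex.I * (∑ i, (n i : ℝ) * x i : ℝ)) +
          ((-∑ i, n i * k i : ℤ) : ℂ) * (2 * π * Complex.I) := by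
      rw [e1]
      push_cast
      ring
    rw [e2, Complex.exp_add, Complex.exp_int_mul_two_pi_mul_I, mul_one]
    simp only [UnitAddTorus.mFourier, ContinuousMap.coe_mk, fourier_coe_apply, Pi.neg_apply]
    rw [← Complex.exp_sum]
    congr 1
    push_cast
    rw [Finset.mul_sum, ← Finset.sum_neg_distrib]
    exact Finset.sum_congr rfl fun i _ => by ring
  have := UnitAddTorus.hasSum_mFourier_series_apply_of_summable (f := g)
    (by convert hs using 1; exact funext hcoeff) 0
  convert this using 1
  · ext n
    rw [hcoeff]
    simp [UnitAddTorus.mFourier]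
  · have := hg 0
    simp only [Pi.zero_apply, hG, zero_add] at this
    rw [← this]
    rfl

end

noncomputable section

open Real Filter MeasureTheory Set Matrix

theorem summable_exp_neg_mulVec {ι : Type*} [Fintype ι] [DecidableEq ι] (M : Matrix ι ι ℝ)
    (hM : M.det ≠ 0) :
    Summable fun k : ι → ℤ => rexp (-π * ∑ i, (M.mulVec (fun j => (k j : ℝ)) i) ^ 2) := by
  obtain ⟨c, hc, h⟩ := exists_pos_mul_sum_sq_le M hM
  refine Summable.of_nonneg_of_le (fun _ => (exp_pos _).le) (fun k => ?_)
    (summable_exp_neg_mul_sum_sq (ι := ι) (c := π * c) (by positivity))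
  have := h (fun j => (k j : ℝ))
  rw [exp_le_exp]
  nlinarith [pi_pos]

theorem integral_comp_mulVec {ι : Type*} [Fintype ι] [DecidableEq ι] (M : Matrix ι ι ℝ)
    (hM : M.det ≠ 0) (H : (ι → ℝ) → ℂ) (hH : Continuous H) :
    ∫ x, H (M.mulVec x) = (|M.det|⁻¹ : ℝ) * ∫ x, H x := by
  have h1 := Real.map_matrix_volume_pi_eq_smul_volume_pi hM
  have h2 : ∫ x, H x ∂(Measure.map (toLin' M) volume) = ∫ x, H (M.mulVec x) := by
    rw [integral_map (by fun_prop) hH.aestronglyMeasurable]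
    simp [toLin'_apply]
  rw [← h2, h1, integral_smul_measure, ENNReal.toReal_ofReal (abs_nonneg _), abs_inv]
  simp

theorem hasSum_gaussian_mulVec {ι : Type*} [Fintype ι] [DecidableEq ι] (M : Matrix ι ι ℝ)
    (hM : M.det ≠ 0) :
    HasSum (fun k : ι → ℤ =>
        |M.det|⁻¹ * rexp (-π * ∑ i, ((M⁻¹)ᵀ.mulVec (fun j => (k j : ℝ)) i) ^ 2))
      (∑' k : ι → ℤ, rexp (-π * ∑ i, (M.mulVec (fun j => (k j : ℝ)) i) ^ 2)) := by
  set f : (ι → ℝ) → ℂ := fun x => (rexp (-π * ∑ i, (M.mulVec x i) ^ 2) : ℝ) with hf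
  have hMc : Continuous fun x : ι → ℝ => M.mulVec x := Continuous.matrix_mulVec continuous_const continuous_id
  have hfc : Continuous f := by
    have : ∀ i, Continuous fun x : ι → ℝ => M.mulVec x i := fun i => (continuous_apply i).comp hMc
    fun_prop
  have hdet : M * M⁻¹ = 1 := mul_nonsing_inv _ (isUnit_iff_ne_zero.2 hM)
  have hft : ∀ n : ι → ℤ,
      ∫ x, Complex.exp (-(2 * π * Complex.I * (∑ i, (n i : ℝ) * x i : ℝ))) * f x =
        (|M.det|⁻¹ * rexp (-π * ∑ i, ((M⁻¹)ᵀ.mulVec (fun j => (n j : ℝ)) i) ^ 2) : ℝ) := by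
    intro n
    set w := (M⁻¹)ᵀ.mulVec (fun j => (n j : ℝ)) with hw
    have hdot : ∀ x : ι → ℝ, ∑ i, (n i : ℝ) * x i = ∑ i, w i * (M.mulVec x) i := by
      intro x
      change (fun j => (n j : ℝ)) ⬝ᵥ x = w ⬝ᵥ (M.mulVec x)
      rw [hw, mulVec_transpose, ← dotProduct_mulVec, mulVec_mulVec, nonsing_inv_mul _ (isUnit_iff_ne_zero.2 hM), one_mulVec]
    have := integral_comp_mulVec M hM (fun y => Complex.exp (-(π : ℂ) * ∑ i, (y i : ℂ) ^ 2 +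
      ∑ i, (-2 * π * Complex.I * w i) * y i)) (by fun_prop)
    rw [GaussianFourier.integral_cexp_neg_mul_sum_add (by simpa using pi_pos)] at this
    have hpi : (π : ℂ) ≠ 0 := by exact_mod_cast pi_ne_zero
    rw [div_self hpi, Complex.one_cpow, one_mul] at this
    push_cast at this ⊢
    convert this using 2
    · ext x
      simp only [hf]
      push_cast
      rw [← Complex.exp_add]
      congr 1
      have := hdot x
      rw [add_comm]
      congr 1
      have h3 : (∑ i, (n i : ℂ) * x i) = ∑ i, (w i : ℂ) * (M.mulVec x i : ℝ) := by
        exact_mod_cast hdot x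
      rw [h3, Finset.mul_sum, ← Finset.sum_neg_distrib]
      exact Finset.sum_congr rfl fun i _ => by ring
    · congr 1
      rw [Finset.mul_sum, Finset.sum_div]
      refine Finset.sum_congr rfl fun i _ => ?_
      field_simp
      ring_nf
      simp
      try ring
  obtain ⟨c, hc, hcb⟩ := exists_pos_mul_sum_sq_le M hM
  have hfb : ∀ x, ‖f x‖ ≤ rexp (-(π * c) * ∑ i, x i ^ 2) := by
    intro x
    rw [hf, Complex.norm_real, norm_of_nonneg (exp_pos _).le, exp_le_exp]
    nlinarith [pi_pos, hcb x]
  have hfi : Integrable f := by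
    have h1 := GaussianFourier.integrable_cexp_neg_mul_sum_add (ι := ι) (b := (π * c : ℝ))
      (by rw [Complex.ofReal_re]; positivity) 0
    refine h1.norm.mono' hfc.aestronglyMeasurable (Eventually.of_forall fun x => (hfb x).trans ?_)
    rw [Complex.norm_exp]
    simp [← Complex.ofReal_pow, ← Complex.ofReal_sum, -Complex.ofReal_mul]
  have hdet' : ((M⁻¹)ᵀ).det ≠ 0 := by
    rw [det_transpose, det_nonsing_inv]
    simpa using hM
  have hsum : Summable fun k : ι → ℤ =>
        |M.det|⁻¹ * rexp (-π * ∑ i, ((M⁻¹)ᵀ.mulVec (fun j => (k j : ℝ)) i) ^ 2) :=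
    (summable_exp_neg_mulVec _ hdet').mul_left _
  have key := poisson_summation_pi f hfc hfi (fun R => ?_) ?_
  · simp only [hft] at key
    simp only [hf] at key
    rw [← Complex.ofReal_tsum] at key
    exact_mod_cast key
  · refine ⟨fun k => rexp (π * c * (Fintype.card ι * R ^ 2)) *
      rexp (-(π * c / 2) * ∑ i, (k i : ℝ) ^ 2),
      (summable_exp_neg_mul_sum_sq (by positivity)).mul_left _, fun x hx k => (hfb _).trans ?_⟩
    simp only
    rw [← Real.exp_add, exp_le_exp]
    have h1 : ∑ i, (k i : ℝ) ^ 2 / 2 ≤ ∑ i, ((x i + k i) ^ 2 + R ^ 2) := by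
      refine Finset.sum_le_sum fun i _ => ?_
      have h2 : ‖x i‖ ≤ ‖x‖ := norm_le_pi_norm x i
      have h3 : x i ^ 2 ≤ R ^ 2 := sq_le_sq' (by linarith [neg_abs_le (x i), Real.norm_eq_abs (x i)]) (by linarith [le_abs_self (x i), Real.norm_eq_abs (x i)])
      nlinarith [sq_nonneg (2 * x i + k i)]
    rw [Finset.sum_add_distrib, ← Finset.sum_div] at h1
    simp at h1
    have : 0 < π * c := by positivity
    nlinarith
  · simp only [hft]
    exact_mod_cast hsum

theorem Matrix.PosDef.exists_eq_transpose_mul {ι : Type*} [Fintype ι] [DecidableEq ι]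
    {P : Matrix ι ι ℝ} (hP : P.PosDef) : ∃ M : Matrix ι ι ℝ, P = Mᵀ * M := by
  open scoped MatrixOrder in
  obtain ⟨M, hM⟩ := CStarAlgebra.nonneg_iff_eq_star_mul_self.1 hP.posSemidef.nonneg
  exact ⟨M, by rw [hM, star_eq_conjTranspose, conjTranspose_eq_transpose_of_trivial]⟩

theorem tsum_exp_neg_pi_posDef {ι : Type*} [Fintype ι] [DecidableEq ι] {P : Matrix ι ι ℝ}
    (hP : P.PosDef) :
    (Summable fun k : ι → ℤ =>
      rexp (-π * ((fun i => (k i : ℝ)) ⬝ᵥ P.mulVec (fun i => (k i : ℝ))))) ∧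
    ∑' k : ι → ℤ, rexp (-π * ((fun i => (k i : ℝ)) ⬝ᵥ P.mulVec (fun i => (k i : ℝ)))) =
      (√P.det)⁻¹ * ∑' k : ι → ℤ,
        rexp (-π * ((fun i => (k i : ℝ)) ⬝ᵥ P⁻¹.mulVec (fun i => (k i : ℝ)))) := by
  obtain ⟨M, rfl⟩ := hP.exists_eq_transpose_mul
  have hd := hP.det_pos
  rw [det_mul, det_transpose] at hd
  have hM : M.det ≠ 0 := fun h => by simp [h] at hd
  have e : ∀ (N : Matrix ι ι ℝ) (x : ι → ℝ), x ⬝ᵥ (Nᵀ * N).mulVec x = ∑ i, (N.mulVec x i) ^ 2 := by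
    intro N x
    rw [← mulVec_mulVec, dotProduct_mulVec, vecMul_transpose]
    simp [dotProduct, sq]
  have h1 : (Mᵀ * M)⁻¹ = ((M⁻¹)ᵀ)ᵀ * (M⁻¹)ᵀ := by
    rw [transpose_transpose, Matrix.mul_inv_rev, transpose_nonsing_inv]
  rw [h1]
  simp only [e]
  refine ⟨summable_exp_neg_mulVec M hM, ?_⟩
  rw [det_mul, det_transpose, Real.sqrt_mul_self_eq_abs, ← (hasSum_gaussian_mulVec M hM).tsum_eq,
    tsum_mul_left]

end

noncomputable section

open Real Filter MeasureTheory Set Matrix NumberField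

variable {K : Type} [Field K] [NumberField K]

def placeForm (y : InfinitePlace K → ℝ) (x : K) : ℝ :=
  ∑ φ : K →+* ℂ, ‖φ x‖ ^ 2 * rexp (2 * y (InfinitePlace.mk φ))

def logNorm (y : InfinitePlace K → ℝ) : ℝ := ∑ v : InfinitePlace K, v.mult * y v

theorem sum_embeddings_mk (y : InfinitePlace K → ℝ) :
    ∑ φ : K →+* ℂ, y (InfinitePlace.mk φ) = logNorm y := by
  classical
  rw [logNorm, ← Finset.sum_fiberwise_of_maps_to (s := Finset.univ) (t := Finset.univ)
    (g := fun φ : K →+* ℂ => InfinitePlace.mk φ) (fun _ _ => Finset.mem_univ _)]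
  refine Finset.sum_congr rfl fun v _ => ?_
  rw [Finset.sum_congr rfl (g := fun _ => y v) fun φ hφ => by rw [(Finset.mem_filter.1 hφ).2]]
  rw [Finset.sum_const, InfinitePlace.card_filter_mk_eq, nsmul_eq_mul]

theorem nonempty_equiv_embeddings {ι : Type*} [Fintype ι] (b : Module.Basis ι ℚ K) : Nonempty (ι ≃ (K →+* ℂ)) :=
  ⟨Fintype.equivOfCardEq (by rw [Embeddings.card, Module.finrank_eq_card_basis b])⟩

variable {ι : Type*} [Fintype ι]

def placeMatrix (b : ι → K) (y : InfinitePlace K → ℝ) : Matrix ι ι ℝ :=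
  Matrix.of fun i j => ∑ φ : K →+* ℂ,
    (φ (b i) * (starRingEnd ℂ) (φ (b j))).re * rexp (2 * y (InfinitePlace.mk φ))

theorem placeForm_sum (b : ι → K) (y : InfinitePlace K → ℝ) (k : ι → ℝ) :
    k ⬝ᵥ (placeMatrix b y).mulVec k = ∑ φ : K →+* ℂ, ‖∑ i, (k i : ℂ) * φ (b i)‖ ^ 2 *
      rexp (2 * y (InfinitePlace.mk φ)) := by
  have h : ∀ φ : K →+* ℂ, ‖∑ i, (k i : ℂ) * φ (b i)‖ ^ 2 = ∑ i, ∑ j, k i * k j *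
      (φ (b i) * (starRingEnd ℂ) (φ (b j))).re := by
    intro φ
    have : ((‖∑ i, (k i : ℂ) * φ (b i)‖ ^ 2 : ℝ) : ℂ) = ∑ i, ∑ j, k i * k j *
      (φ (b i) * (starRingEnd ℂ) (φ (b j))) := by
      push_cast
      rw [← Complex.mul_conj', map_sum, Finset.sum_mul_sum]
      refine Finset.sum_congr rfl fun i _ => Finset.sum_congr rfl fun j _ => ?_
      simp
      ring
    have h2 := congrArg Complex.re this
    rw [Complex.ofReal_re] at h2
    rw [h2]
    simp only [Complex.re_sum, ← Complex.ofReal_mul, Complex.re_ofReal_mul]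
  simp_rw [h]
  simp only [dotProduct, mulVec, placeMatrix, of_apply, Finset.mul_sum, Finset.sum_mul]
  symm
  rw [Finset.sum_comm]
  refine Finset.sum_congr rfl fun i _ => ?_
  rw [Finset.sum_comm]
  refine Finset.sum_congr rfl fun j _ => Finset.sum_congr rfl fun φ _ => ?_
  ring

variable [DecidableEq ι]

theorem placeMatrix_map (b : ι → K) (y : InfinitePlace K → ℝ) (e : ι ≃ (K →+* ℂ)) :
    (placeMatrix b y).map ((↑) : ℝ → ℂ) = (Matrix.of fun i j => e j (b i)) *
      diagonal (fun j => (rexp (2 * y (InfinitePlace.mk (e j))) : ℂ)) *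
      (Matrix.of fun i j => e j (b i))ᴴ := by
  ext i j
  have h0 : ∑ φ : K →+* ℂ,
    (φ (b i) * (starRingEnd ℂ) (φ (b j))).im * rexp (2 * y (InfinitePlace.mk φ)) = 0 := by
    have := Equiv.sum_comp (ComplexEmbedding.involutive_conjugate K).toPerm (fun φ : K →+* ℂ =>
      (φ (b i) * (starRingEnd ℂ) (φ (b j))).im * rexp (2 * y (InfinitePlace.mk φ)))
    simp only [Function.Involutive.coe_toPerm, InfinitePlace.mk_conjugate_eq,
      ComplexEmbedding.conjugate_coe_eq] at this
    have h2 : ∀ φ : K →+* ℂ, ((starRingEnd ℂ) (φ (b i)) * (starRingEnd ℂ) ((starRingEnd ℂ)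
        (φ (b j)))).im = - (φ (b i) * (starRingEnd ℂ) (φ (b j))).im := by
      intro φ
      rw [← map_mul, Complex.conj_im]
    simp only [h2, neg_mul, Finset.sum_neg_distrib] at this
    linarith
  have h1 : (∑ φ : K →+* ℂ, φ (b i) * rexp (2 * y (InfinitePlace.mk φ)) *
      (starRingEnd ℂ) (φ (b j)) : ℂ) = (placeMatrix b y i j : ℝ) := by
    apply Complex.ext
    · rw [Complex.ofReal_re, placeMatrix, of_apply, Complex.re_sum]
      refine Finset.sum_congr rfl fun φ _ => ?_
      rw [mul_right_comm, Complex.re_mul_ofReal]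
    · rw [Complex.ofReal_im, Complex.im_sum, ← h0]
      refine Finset.sum_congr rfl fun φ _ => ?_
      rw [mul_right_comm, Complex.im_mul_ofReal]
  rw [map_apply, ← h1, ← e.sum_comp, mul_apply]
  refine Finset.sum_congr rfl fun k _ => ?_
  simp

theorem embeddings_mul_transpose (b : Module.Basis ι ℚ K) (e : ι ≃ (K →+* ℂ)) :
    (Matrix.of fun i j => e j (b i) : Matrix ι ι ℂ) *
      (Matrix.of fun i j => e j (b.traceDual i))ᵀ = 1 := by
  ext i j
  have := b.trace_mul_traceDual i j
  have h2 := congrArg (algebraMap ℚ ℂ) this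
  rw [trace_eq_sum_embeddings ℂ] at h2
  rw [mul_apply, one_apply]
  simp only [of_apply, transpose_apply, ← map_mul]
  rw [e.sum_comp (fun φ : K →+* ℂ => φ (b i * b.traceDual j)),
    ← (RingHom.equivRatAlgHom K ℂ).symm.sum_comp]
  refine Eq.trans (Finset.sum_congr rfl fun σ _ => rfl) (h2.trans ?_)
  split_ifs <;> simp

theorem placeMatrix_posDef (b : Module.Basis ι ℚ K) (y : InfinitePlace K → ℝ) :
    (placeMatrix b y).PosDef := by
  obtain ⟨e⟩ := nonempty_equiv_embeddings b
  refine Matrix.PosDef.of_dotProduct_mulVec_pos ?_ fun k hk => ?_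
  · ext i j
    simp only [conjTranspose_apply, placeMatrix, of_apply, star_trivial]
    refine Finset.sum_congr rfl fun φ _ => ?_
    congr 1
    rw [← Complex.conj_re, map_mul, Complex.conj_conj, mul_comm]
  · rw [star_trivial, placeForm_sum]
    by_contra! hcon
    refine hk ?_
    have h0 : ∀ φ : K →+* ℂ, ∑ i, (k i : ℂ) * φ (b i) = 0 := by
      have h1 := le_antisymm hcon (by positivity)
      rw [Finset.sum_eq_zero_iff_of_nonneg (fun _ _ => by positivity)] at h1
      intro φ
      have := h1 φ (Finset.mem_univ _)
      rw [mul_eq_zero, or_iff_left (exp_pos _).ne'] at this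
      simpa using this
    have h2 : (fun i => (k i : ℂ)) ᵥ* (Matrix.of fun i j => e j (b i) : Matrix ι ι ℂ) = 0 := by
      ext j
      simpa [vecMul, dotProduct] using h0 (e j)
    have h3 := congrArg (fun v => v ᵥ* (Matrix.of fun i j => e j (b.traceDual i))ᵀ) h2
    simp only [vecMul_vecMul, embeddings_mul_transpose, vecMul_one, zero_vecMul] at h3
    ext i
    simpa using congrFun h3 i

theorem placeMatrix_inv (b : Module.Basis ι ℚ K) (y : InfinitePlace K → ℝ) :
    (placeMatrix b y)⁻¹ = placeMatrix b.traceDual (-y) := by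
  obtain ⟨e⟩ := nonempty_equiv_embeddings b
  refine inv_eq_right_inv ?_
  have hinj : Function.Injective (fun M : Matrix ι ι ℝ => M.map ((↑) : ℝ → ℂ)) :=
    Matrix.map_injective Complex.ofReal_injective
  refine hinj ?_
  have hmul : ∀ M N : Matrix ι ι ℝ, (M * N).map ((↑) : ℝ → ℂ) = M.map (↑) * N.map (↑) :=
    fun M N => Matrix.map_mul (f := Complex.ofRealHom)
  have hreal : (placeMatrix b.traceDual (-y)).map ((↑) : ℝ → ℂ) =
      ((placeMatrix b.traceDual (-y)).map ((↑) : ℝ → ℂ))ᴴᵀ := by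
    ext i j
    simp
  simp only
  rw [hmul, hreal, placeMatrix_map b y e, placeMatrix_map b.traceDual (-y) e]
  set E : Matrix ι ι ℂ := Matrix.of fun i j => e j (b i)
  set F : Matrix ι ι ℂ := Matrix.of fun i j => e j (b.traceDual i)
  have hEF : E * Fᵀ = 1 := embeddings_mul_transpose b e
  have h1 : Eᴴ * Fᴴᵀ = 1 := by
    have h2 : Fᵀ * E = 1 := mul_eq_one_comm.1 hEF
    have h3 := congrArg conjTranspose h2
    rw [conjTranspose_mul, conjTranspose_one] at h3
    exact h3
  rw [conjTranspose_mul, conjTranspose_mul, conjTranspose_conjTranspose, transpose_mul,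
    transpose_mul, diagonal_conjTranspose, diagonal_transpose]
  rw [show E * diagonal (fun j => (rexp (2 * y (InfinitePlace.mk (e j))) : ℂ)) * Eᴴ *
    (Fᴴᵀ * diagonal (star fun j => (rexp (2 * (-y) (InfinitePlace.mk (e j))) : ℂ)) * Fᵀ) =
    E * diagonal (fun j => (rexp (2 * y (InfinitePlace.mk (e j))) : ℂ)) * (Eᴴ * Fᴴᵀ) *
    diagonal (star fun j => (rexp (2 * (-y) (InfinitePlace.mk (e j))) : ℂ)) * Fᵀ by
      simp only [Matrix.mul_assoc], h1, mul_one, Matrix.mul_assoc E, diagonal_mul_diagonal]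
  have : (fun i => (rexp (2 * y (InfinitePlace.mk (e i))) : ℂ) *
      (star fun j => (rexp (2 * (-y) (InfinitePlace.mk (e j))) : ℂ)) i) = fun _ => 1 := by
    ext i
    simp only [Pi.star_apply, RCLike.star_def, Complex.conj_ofReal, ← Complex.ofReal_mul,
      ← Real.exp_add]
    simp
  rw [this, diagonal_one, mul_one, hEF]
  ext i j
  simp [one_apply]
  split_ifs <;> simp

theorem placeMatrix_det (b : Module.Basis ι ℚ K) (y : InfinitePlace K → ℝ) :
    √(placeMatrix b y).det = √|(Algebra.discr ℚ b : ℝ)| * rexp (logNorm y) := by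
  obtain ⟨e⟩ := nonempty_equiv_embeddings b
  set E : Matrix ι ι ℂ := Matrix.of fun i j => e j (b i) with hE
  have h1 : ((placeMatrix b y).det : ℂ) = (‖E.det‖ ^ 2 * rexp (2 * logNorm y) : ℝ) := by
    have : ((placeMatrix b y).det : ℂ) = ((placeMatrix b y).map ((↑) : ℝ → ℂ)).det :=
      Complex.ofRealHom.map_det _
    rw [this, placeMatrix_map b y e, det_mul, det_mul, det_conjTranspose, det_diagonal,
      ← Complex.ofReal_prod, ← Real.exp_sum, ← Finset.mul_sum,
      e.sum_comp (fun φ => y (InfinitePlace.mk φ)), sum_embeddings_mk, mul_right_comm]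
    push_cast
    rw [← Complex.mul_conj', RCLike.star_def]
  have h2 : |(Algebra.discr ℚ b : ℝ)| = ‖E.det‖ ^ 2 := by
    have h3 := Algebra.discr_eq_det_embeddingsMatrixReindex_pow_two ℚ ℂ b
      (e.trans (RingHom.equivRatAlgHom K ℂ))
    have h4 : Algebra.embeddingsMatrixReindex ℚ ℂ b (e.trans (RingHom.equivRatAlgHom K ℂ)) = E := by
      ext i j
      simp [Algebra.embeddingsMatrixReindex, hE]
    rw [h4] at h3
    have := congrArg norm h3
    rw [norm_pow] at this
    rw [← this]
    simp
  have h5 : (placeMatrix b y).det = ‖E.det‖ ^ 2 * rexp (2 * logNorm y) := by exact_mod_cast h1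
  rw [h5, h2, Real.sqrt_mul (by positivity), two_mul, Real.exp_add,
    Real.sqrt_mul_self (exp_pos _).le]

end

noncomputable section

open Real Filter MeasureTheory Set Matrix NumberField
open scoped nonZeroDivisors

variable {K : Type} [Field K] [NumberField K]

def idealTheta (I : FractionalIdeal (𝓞 K)⁰ K) (y : InfinitePlace K → ℝ) : ℝ :=
  ∑' α : {α : K // α ∈ I}, rexp (-π * placeForm y (α : K))

theorem exists_equiv_of_span {ι : Type*} [Fintype ι] (b : Module.Basis ι ℚ K)
    (I : FractionalIdeal (𝓞 K)⁰ K)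
    (hb : ∀ x, x ∈ Submodule.span ℤ (Set.range b) ↔ x ∈ I) :
    ∃ e : (ι → ℤ) ≃ {α : K // α ∈ I}, ∀ k, (e k : K) = ∑ i, (k i : K) * b i := by
  classical
  refine ⟨(b.restrictScalars ℤ).equivFun.symm.toEquiv.trans
    (Equiv.subtypeEquivRight fun x => hb x), fun k => ?_⟩
  simp [Module.Basis.equivFun_symm_apply, Module.Basis.restrictScalars_apply]

theorem placeForm_sum_basis {ι : Type*} [Fintype ι] (b : ι → K) (y : InfinitePlace K → ℝ)
    (k : ι → ℤ) : placeForm y (∑ i, (k i : K) * b i) =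
      (fun i => (k i : ℝ)) ⬝ᵥ (placeMatrix b y).mulVec (fun i => (k i : ℝ)) := by
  rw [placeForm_sum, placeForm]
  simp

theorem idealTheta_eq_of_span {ι : Type*} [Fintype ι] [DecidableEq ι] (b : Module.Basis ι ℚ K)
    (I J : FractionalIdeal (𝓞 K)⁰ K)
    (hb : ∀ x, x ∈ Submodule.span ℤ (Set.range b) ↔ x ∈ I)
    (hb' : ∀ x, x ∈ Submodule.span ℤ (Set.range b.traceDual) ↔ x ∈ J)
    (y : InfinitePlace K → ℝ) :
    (Summable fun α : {α : K // α ∈ I} => rexp (-π * placeForm y (α : K))) ∧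
    idealTheta I y = (√|(Algebra.discr ℚ b : ℝ)|)⁻¹ * rexp (-logNorm y) * idealTheta J (-y) := by
  obtain ⟨e, he⟩ := exists_equiv_of_span b I hb
  obtain ⟨e', he'⟩ := exists_equiv_of_span b.traceDual J hb'
  obtain ⟨h1, h2⟩ := tsum_exp_neg_pi_posDef (placeMatrix_posDef b y)
  constructor
  · rw [← e.summable_iff]
    refine h1.congr fun k => ?_
    simp only [Function.comp_apply, he, placeForm_sum_basis]
  · rw [idealTheta, idealTheta, ← e.tsum_eq, ← e'.tsum_eq]
    simp only [he, he', placeForm_sum_basis]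
    rw [h2, placeMatrix_det, placeMatrix_inv, mul_inv, Real.exp_neg]

theorem idealTheta_functional (I : (FractionalIdeal (𝓞 K)⁰ K)ˣ) (y : InfinitePlace K → ℝ) :
    (Summable fun α : {α : K // α ∈ I.1} => rexp (-π * placeForm y (α : K))) ∧
    idealTheta I.1 y = ((FractionalIdeal.absNorm I.1 : ℝ) * √|(discr K : ℝ)|)⁻¹ *
      rexp (-logNorm y) * idealTheta (FractionalIdeal.dual ℤ ℚ I.1) (-y) := by
  classical
  have hI : (I : FractionalIdeal (𝓞 K)⁰ K) ≠ 0 := I.ne_zero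
  have hspan : ∀ x, x ∈ Submodule.span ℤ (Set.range (basisOfFractionalIdeal K I)) ↔ x ∈ I.1 :=
    fun x => mem_span_basisOfFractionalIdeal K
  have hdual := Submodule.traceDual_span_of_basis (A := ℤ) (K := ℚ) (B := 𝓞 K)
    (I.1 : Submodule (𝓞 K) K) (basisOfFractionalIdeal K I)
    (by ext x; rw [hspan]; rfl)
  have hmain := idealTheta_eq_of_span (basisOfFractionalIdeal K I) I.1
    (FractionalIdeal.dual ℤ ℚ I.1) hspan
    (fun x => by rw [← hdual]; rw [← FractionalIdeal.mem_coe, FractionalIdeal.coe_dual ℤ ℚ hI]; rfl) y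
  have hdisc : √|(Algebra.discr ℚ (basisOfFractionalIdeal K I) : ℝ)| =
      (FractionalIdeal.absNorm I.1 : ℝ) * √|(discr K : ℝ)| := by
    have e : (Module.Free.ChooseBasisIndex ℤ (𝓞 K)) ≃ (Module.Free.ChooseBasisIndex ℤ I) :=
      Fintype.equivOfCardEq (by
        rw [← Module.finrank_eq_card_chooseBasisIndex, ← Module.finrank_eq_card_chooseBasisIndex,
          fractionalIdeal_rank])
    have h1 := det_basisOfFractionalIdeal_eq_absNorm K I e
    have h2 := Algebra.discr_of_matrix_vecMul (integralBasis K)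
      ((integralBasis K).toMatrix ((basisOfFractionalIdeal K I).reindex e.symm))
    rw [Module.Basis.toMatrix_map_vecMul, ← Module.Basis.det_apply] at h2
    rw [Module.Basis.coe_reindex, Algebra.discr_reindex, ← coe_discr] at h2
    have h3 : (Algebra.discr ℚ (basisOfFractionalIdeal K I) : ℝ) =
      ((FractionalIdeal.absNorm I.1 : ℚ) : ℝ) ^ 2 * (discr K : ℝ) := by
      rw [h2, ← h1]
      push_cast
      rw [sq_abs]
      simp
    rw [h3, abs_mul, abs_of_nonneg (by positivity), Real.sqrt_mul (by positivity), Real.sqrt_sq]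
    exact_mod_cast FractionalIdeal.absNorm_nonneg _
  rwa [hdisc] at hmain

end

noncomputable section

open Real Filter MeasureTheory Set Matrix NumberField

variable {K : Type} [Field K] [NumberField K]

def logVec (x : K) : InfinitePlace K → ℝ := fun v => Real.log (v x)

omit [NumberField K] in
theorem logVec_mul {x z : K} (hx : x ≠ 0) (hz : z ≠ 0) : logVec (x * z) = logVec x + logVec z := by
  ext v
  simp [logVec, Real.log_mul, hx, hz]

omit [NumberField K] in
theorem logVec_inv (x : K) : logVec x⁻¹ = -logVec x := by
  ext v
  simp [logVec]

theorem logNorm_add (y z : InfinitePlace K → ℝ) : logNorm (y + z) = logNorm y + logNorm z := by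
  simp [logNorm, mul_add, Finset.sum_add_distrib]

theorem logNorm_smul (c : ℝ) (y : InfinitePlace K → ℝ) : logNorm (c • y) = c * logNorm y := by
  simp [logNorm, Finset.mul_sum, mul_left_comm]

theorem logNorm_neg (y : InfinitePlace K → ℝ) : logNorm (-y) = -logNorm y := by
  simp [logNorm]

theorem logNorm_one : logNorm (1 : InfinitePlace K → ℝ) = Module.finrank ℚ K := by
  simp only [logNorm, Pi.one_apply, mul_one]
  exact_mod_cast InfinitePlace.sum_mult_eq (K := K)

theorem continuous_logNorm : Continuous (logNorm (K := K)) := by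
  unfold logNorm
  fun_prop

theorem logNorm_logVec {x : K} (hx : x ≠ 0) :
    logNorm (logVec x) = Real.log |(Algebra.norm ℚ x : ℝ)| := by
  have h := InfinitePlace.prod_eq_abs_norm x
  have h2 := congrArg Real.log (congrArg ((↑) : ℝ → ℝ) h)
  simp only [logNorm, logVec]
  rw [← Rat.cast_abs] 
  rw [← h, Real.log_prod (fun v _ => by simp [hx])]
  simp

theorem logNorm_logVec_unit (u : (𝓞 K)ˣ) : logNorm (logVec ((u : 𝓞 K) : K)) = 0 := by
  simpa [logNorm, logVec] using Units.sum_mult_mul_log u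

theorem placeForm_add_logVec (y : InfinitePlace K → ℝ) {x : K} (hx : x ≠ 0) (z : K) :
    placeForm (y + logVec x) z = placeForm y (x * z) := by
  unfold placeForm
  refine Finset.sum_congr rfl fun φ _ => ?_
  have h : rexp (logVec x (InfinitePlace.mk φ)) = ‖φ x‖ := by
    rw [logVec, Real.exp_log (by simp [hx])]
    simp
  rw [Pi.add_apply, mul_add, Real.exp_add, two_mul (logVec x _), Real.exp_add, h, map_mul, norm_mul]
  ring

open Units.dirichletUnitTheorem in
def toLogSpace : (InfinitePlace K → ℝ) →ₗ[ℝ] logSpace K where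
  toFun y w := w.1.mult * (y w.1 - logNorm y / Module.finrank ℚ K)
  map_add' y z := by
    ext w
    simp only [logNorm_add, Pi.add_apply]
    ring
  map_smul' c y := by
    ext w
    simp only [logNorm_smul, Pi.smul_apply, smul_eq_mul, RingHom.id_apply]
    ring

theorem toLogSpace_logVec (u : (𝓞 K)ˣ) :
    toLogSpace (logVec ((u : 𝓞 K) : K)) = Units.logEmbedding K (Additive.ofMul u) := by
  ext w
  simp [toLogSpace, logNorm_logVec_unit, logVec]

theorem toLogSpace_one : toLogSpace (1 : InfinitePlace K → ℝ) = 0 := by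
  ext w
  have : (Module.finrank ℚ K : ℝ) ≠ 0 := by exact_mod_cast Module.finrank_pos.ne'
  simp [toLogSpace, logNorm_one, this]

theorem eq_zero_of_toLogSpace {y : InfinitePlace K → ℝ} (h : toLogSpace y = 0) (h2 : logNorm y = 0) :
    y = 0 := by
  classical
  have hw : ∀ w : InfinitePlace K, w ≠ Units.dirichletUnitTheorem.w₀ → y w = 0 := by
    intro w hw
    have := congrFun h ⟨w, hw⟩
    simpa [toLogSpace, h2] using this
  ext w
  by_cases hw0 : w = Units.dirichletUnitTheorem.w₀
  · rw [logNorm, Finset.sum_eq_single w] at h2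
    · simpa using h2
    · intro b _ hb
      rw [hw b (by rwa [← hw0]), mul_zero]
    · simp
  · exact hw w hw0

open scoped Classical in
def unitCell (K : Type) [Field K] [NumberField K] : Set (Units.dirichletUnitTheorem.logSpace K) :=
  ZSpan.fundamentalDomain ((Units.basisUnitLattice K).ofZLatticeBasis ℝ (Units.unitLattice K))

theorem hasSum_unitCell (z : Units.dirichletUnitTheorem.logSpace K) :
    HasSum (fun u : (𝓞 K)ˣ => (unitCell K).indicator (1 : Units.dirichletUnitTheorem.logSpace K → ℝ)
      (z + Units.logEmbedding K (Additive.ofMul u))) (Units.torsionOrder K) := by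
  classical
  obtain ⟨⟨v, hv⟩, h₂, h₃⟩ := ZSpan.exist_unique_vadd_mem_fundamentalDomain
    ((Units.basisUnitLattice K).ofZLatticeBasis ℝ (Units.unitLattice K)) z
  have hv' : v ∈ Units.unitLattice K := by
    rwa [← Module.Basis.ofZLatticeBasis_span ℝ (Units.unitLattice K)]
  obtain ⟨u0, -, hu0⟩ := hv'
  have key : ∀ t : (𝓞 K)ˣ, (z + Units.logEmbedding K (Additive.ofMul (u0.toMul * t)) ∈ unitCell K ↔
      t ∈ Units.torsion K) := by
    intro t
    have h0 : Units.logEmbedding K (Additive.ofMul (u0.toMul * t)) =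
        v + Units.logEmbedding K (Additive.ofMul t) := by
      rw [ofMul_mul, map_add]
      congr 1
    rw [h0, ← Units.dirichletUnitTheorem.logEmbedding_eq_zero_iff]
    constructor
    · intro h
      have hm : v + Units.logEmbedding K (Additive.ofMul t) ∈ Submodule.span ℤ (Set.range
          ((Units.basisUnitLattice K).ofZLatticeBasis ℝ (Units.unitLattice K))) := by
        refine add_mem hv ?_
        rw [Module.Basis.ofZLatticeBasis_span ℝ (Units.unitLattice K)]
        exact ⟨Additive.ofMul t, trivial, rfl⟩
      have := h₃ ⟨_, hm⟩ (by
        change (_ + _ : Units.dirichletUnitTheorem.logSpace K) ∈ _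
        rw [add_comm]; exact h)
      have := congrArg Subtype.val this
      simpa using this
    · intro h
      rw [h, add_zero, add_comm]
      exact h₂
  rw [← (Equiv.mulLeft u0.toMul).hasSum_iff]
  have : ((fun u : (𝓞 K)ˣ => (unitCell K).indicator (1 : Units.dirichletUnitTheorem.logSpace K → ℝ)
      (z + Units.logEmbedding K (Additive.ofMul u))) ∘ (Equiv.mulLeft u0.toMul)) =
      (Units.torsion K : Set (𝓞 K)ˣ).indicator 1 := by
    ext t
    simp only [Function.comp_apply, Equiv.coe_mulLeft, indicator_apply, key t, SetLike.mem_coe,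
      Pi.one_apply]
  rw [this, ← hasSum_subtype_iff_indicator]
  have : Finite ↥(Units.torsion K : Set (𝓞 K)ˣ) := inferInstanceAs (Finite (Units.torsion K))
  have := Fintype.ofFinite ↥(Units.torsion K : Set (𝓞 K)ˣ)
  have h := hasSum_fintype ((1 : (𝓞 K)ˣ → ℝ) ∘ ((↑) : ↥(Units.torsion K : Set (𝓞 K)ˣ) → (𝓞 K)ˣ))
  have hc : (∑ b, ((1 : (𝓞 K)ˣ → ℝ) ∘ ((↑) : ↥(Units.torsion K : Set (𝓞 K)ˣ) → (𝓞 K)ˣ)) b) =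
      Units.torsionOrder K := by
    simp only [Function.comp_apply, Pi.one_apply, Finset.sum_const, nsmul_eq_mul, mul_one,
      Finset.card_univ, Units.torsionOrder]
    rw [← Nat.card_eq_fintype_card]
    rfl
  rwa [hc] at h

theorem measurableSet_unitCell : MeasurableSet (unitCell K) := by
  classical
  exact ZSpan.fundamentalDomain_measurableSet _

theorem volume_toLogSpace_lt_top :
    volume {y : InfinitePlace K → ℝ | toLogSpace y ∈ unitCell K ∧ |logNorm y| ≤ 1} < ⊤ := by
  classical
  let f : (InfinitePlace K → ℝ) →ₗ[ℝ] (Units.dirichletUnitTheorem.logSpace K × ℝ) :=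
    toLogSpace.prod
      { toFun := logNorm
        map_add' := logNorm_add
        map_smul' := logNorm_smul }
  have hf : LinearMap.ker f = ⊥ := by
    rw [LinearMap.ker_eq_bot']
    intro y hy
    exact eq_zero_of_toLogSpace (congrArg Prod.fst hy) (congrArg Prod.snd hy)
  have hemb := LinearMap.isClosedEmbedding_of_injective hf
  have hb : Bornology.IsBounded (unitCell K) := ZSpan.fundamentalDomain_isBounded _
  have hc : IsCompact (closure (unitCell K) ×ˢ Metric.closedBall (0 : ℝ) 1) :=
    hb.isCompact_closure.prod (isCompact_closedBall _ _)
  have := (hemb.isCompact_preimage hc).measure_lt_top (μ := volume)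
  refine lt_of_le_of_lt (measure_mono ?_) this
  rintro y ⟨h1, h2⟩
  exact ⟨subset_closure h1, by simpa [f] using h2⟩

def unitWeight (y : InfinitePlace K → ℝ) : ℝ :=
  ((unitCell K).indicator 1 (toLogSpace y) + (unitCell K).indicator 1 (toLogSpace (-y))) /
    (2 * Units.torsionOrder K)

theorem unitWeight_nonneg (y : InfinitePlace K → ℝ) : 0 ≤ unitWeight y := by
  unfold unitWeight
  have h : ∀ z, (0 : ℝ) ≤ (unitCell K).indicator (1 : Units.dirichletUnitTheorem.logSpace K → ℝ) z := fun z =>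
    indicator_nonneg (fun _ _ => zero_le_one) _
  have := h (toLogSpace y)
  have := h (toLogSpace (-y))
  positivity

theorem unitWeight_neg (y : InfinitePlace K → ℝ) : unitWeight (-y) = unitWeight y := by
  unfold unitWeight
  rw [neg_neg, add_comm]

theorem unitWeight_add_smul_one (y : InfinitePlace K → ℝ) (h : ℝ) :
    unitWeight (y + h • 1) = unitWeight y := by
  unfold unitWeight
  simp [toLogSpace_one]

theorem hasSum_unitWeight (y : InfinitePlace K → ℝ) :
    HasSum (fun u : (𝓞 K)ˣ => unitWeight (y + logVec ((u : 𝓞 K) : K))) 1 := by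
  have h1 := hasSum_unitCell (toLogSpace y)
  have h2 := hasSum_unitCell (toLogSpace (-y))
  rw [← (Equiv.inv (𝓞 K)ˣ).hasSum_iff] at h2
  have := (h1.add h2).div_const (2 * Units.torsionOrder K : ℝ)
  have ht : (Units.torsionOrder K : ℝ) ≠ 0 := by exact_mod_cast Units.torsionOrder_ne_zero K
  convert! this using 1
  · refine funext fun u => ?_
    simp only [unitWeight, neg_add, map_add, map_neg, toLogSpace_logVec, Function.comp_apply,
      Equiv.inv_apply, ofMul_inv]
  · field_simp
    norm_num

theorem unitWeight_le_one (y : InfinitePlace K → ℝ) : unitWeight y ≤ 1 := by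
  have := le_hasSum (hasSum_unitWeight y) 1 fun u _ => unitWeight_nonneg _
  have h0 : logVec (((1 : (𝓞 K)ˣ) : 𝓞 K) : K) = 0 := by ext v; simp [logVec]
  rwa [h0, add_zero] at this

theorem measurable_unitWeight : Measurable (unitWeight (K := K)) := by
  have h1 : Measurable (toLogSpace (K := K)) :=
    (LinearMap.continuous_of_finiteDimensional toLogSpace).measurable
  have h2 : Measurable ((unitCell K).indicator (1 : Units.dirichletUnitTheorem.logSpace K → ℝ)) :=
    measurable_one.indicator measurableSet_unitCell
  exact ((h2.comp h1).add (h2.comp (h1.comp measurable_neg))).div_const _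

theorem volume_unitWeight_lt_top :
    volume {y : InfinitePlace K → ℝ | unitWeight y ≠ 0 ∧ |logNorm y| ≤ 1} < ⊤ := by
  have h1 := volume_toLogSpace_lt_top (K := K)
  set S := {y : InfinitePlace K → ℝ | toLogSpace y ∈ unitCell K ∧ |logNorm y| ≤ 1}
  have h2 : volume (-S) < ⊤ := by rwa [Measure.measure_neg]
  refine lt_of_le_of_lt (measure_mono ?_) (measure_union_lt_top h1 h2)
  rintro y ⟨hy, hn⟩
  by_cases h : toLogSpace y ∈ unitCell K
  · exact Or.inl ⟨h, hn⟩
  · by_cases h' : toLogSpace (-y) ∈ unitCell K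
    · exact Or.inr ⟨h', by rwa [logNorm_neg, abs_neg]⟩
    · exact absurd (by simp [unitWeight, h, h', -map_neg]) hy

end

noncomputable section

open Real Filter MeasureTheory Set Matrix NumberField

variable {K : Type} [Field K] [NumberField K]

theorem range_const_mul_exp {c : ℝ} (hc : 0 < c) :
    (fun y : ℝ => c * rexp (2 * y)) '' univ = Ioi 0 := by
  ext x
  simp only [image_univ, mem_range, mem_Ioi]
  constructor
  · rintro ⟨y, rfl⟩
    positivity
  · intro hx
    refine ⟨Real.log (x / c) / 2, ?_⟩
    rw [mul_div_cancel₀ _ two_ne_zero, Real.exp_log (by positivity), mul_div_cancel₀ _ hc.ne']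

theorem integral_exp_exp {c : ℝ} (hc : 0 < c) {s : ℂ} (hs : 0 < s.re) :
    Integrable (fun y : ℝ => (rexp (-c * rexp (2 * y)) : ℂ) * Complex.exp (2 * s * y)) ∧
    ∫ y : ℝ, (rexp (-c * rexp (2 * y)) : ℂ) * Complex.exp (2 * s * y) =
      1 / 2 * (c : ℂ) ^ (-s) * Complex.Gamma s := by
  have hd : ∀ y ∈ (univ : Set ℝ), HasDerivWithinAt (fun y : ℝ => c * rexp (2 * y))
      (2 * (c * rexp (2 * y))) univ y := by
    intro y _
    have := (((hasDerivAt_id y).const_mul 2).exp.const_mul c).hasDerivWithinAt (s := univ)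
    convert! this using 1
    simp only [id]
    ring
  have hinj : InjOn (fun y : ℝ => c * rexp (2 * y)) univ := by
    intro x _ y _ h
    simpa [hc.ne'] using h
  let g : ℝ → ℂ := fun x => (1 / 2 * (c : ℂ) ^ (-s)) * (((-x).exp : ℝ) * (x : ℂ) ^ (s - 1))
  have hg : ∀ y : ℝ, |2 * (c * rexp (2 * y))| • g (c * rexp (2 * y)) =
      (rexp (-c * rexp (2 * y)) : ℂ) * Complex.exp (2 * s * y) := by
    intro y
    have hpos : (0 : ℝ) < c * rexp (2 * y) := by positivity
    have hne : ((c * rexp (2 * y) : ℝ) : ℂ) ≠ 0 := by exact_mod_cast hpos.ne'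
    have hc' : (c : ℂ) ≠ 0 := by exact_mod_cast hc.ne'
    rw [abs_of_pos (by positivity)]
    simp only [g, Complex.real_smul]
    rw [Complex.cpow_sub _ _ hne, Complex.cpow_one, Complex.ofReal_mul c,
      Complex.mul_cpow_ofReal_nonneg hc.le (Real.exp_pos _).le, Complex.cpow_neg]
    have he : ((rexp (2 * y) : ℝ) : ℂ) ^ s = Complex.exp (2 * s * y) := by
      rw [Complex.ofReal_exp, Complex.cpow_def_of_ne_zero (Complex.exp_ne_zero _),
        ← Complex.ofReal_exp, ← Complex.ofReal_log (Real.exp_pos _).le, Real.log_exp]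
      push_cast
      ring_nf
    rw [he]
    have h1 : (c : ℂ) ^ s ≠ 0 := by simp [Complex.cpow_eq_zero_iff, hc']
    have h2 : ((rexp (2 * y) : ℝ) : ℂ) ≠ 0 := by exact_mod_cast (Real.exp_pos _).ne'
    push_cast at h2 ⊢
    field_simp
  have hgi := (Complex.GammaIntegral_convergent hs).const_mul (1 / 2 * (c : ℂ) ^ (-s))
  have key1 := integrableOn_image_iff_integrableOn_abs_deriv_smul MeasurableSet.univ hd hinj g
  have key2 := integral_image_eq_integral_abs_deriv_smul MeasurableSet.univ hd hinj g
  simp_rw [range_const_mul_exp hc, hg] at key1 key2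
  rw [integrableOn_univ] at key1
  rw [setIntegral_univ] at key2
  refine ⟨key1.1 hgi, ?_⟩
  rw [← key2]
  simp only [g]
  rw [integral_const_mul, Complex.Gamma_eq_integral hs, Complex.GammaIntegral]

def gammaProd (K : Type) [Field K] [NumberField K] (s : ℂ) : ℂ :=
  ∏ v : InfinitePlace K, (1 / 2 * ((π * v.mult : ℝ) : ℂ) ^ (-(v.mult * s / 2)) *
    Complex.Gamma (v.mult * s / 2))

theorem placeForm_one (y : InfinitePlace K → ℝ) :
    placeForm y 1 = ∑ v : InfinitePlace K, v.mult * rexp (2 * y v) := by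
  simp only [placeForm, map_one, norm_one, one_pow, one_mul]
  exact sum_embeddings_mk fun v => rexp (2 * y v)

theorem integral_placeForm_one {s : ℂ} (hs : 0 < s.re) :
    Integrable (fun y : InfinitePlace K → ℝ => (rexp (-π * placeForm y 1) : ℂ) *
      Complex.exp (s * logNorm y)) ∧
    ∫ y : InfinitePlace K → ℝ, (rexp (-π * placeForm y 1) : ℂ) * Complex.exp (s * logNorm y) =
      gammaProd K s := by
  have h : ∀ y : InfinitePlace K → ℝ, (rexp (-π * placeForm y 1) : ℂ) * Complex.exp (s * logNorm y) =
      ∏ v : InfinitePlace K, ((rexp (-(π * v.mult) * rexp (2 * y v)) : ℂ) *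
        Complex.exp (2 * (v.mult * s / 2) * y v)) := by
    intro y
    rw [placeForm_one, Finset.prod_mul_distrib, ← Complex.ofReal_prod, ← Real.exp_sum,
      ← Complex.exp_sum, Finset.mul_sum, logNorm]
    congr 2
    · congr 2
      exact funext fun v => by ring
    · push_cast
      rw [Finset.mul_sum]
      exact Finset.sum_congr rfl fun v _ => by ring
  have hm : ∀ v : InfinitePlace K, 0 < ((v.mult : ℂ) * s / 2).re := by
    intro v
    have : ((v.mult : ℂ) * s / 2).re = v.mult * s.re / 2 := by
      rw [show (v.mult : ℂ) * s / 2 = ((v.mult / 2 : ℝ) : ℂ) * s by push_cast; ring,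
        Complex.re_ofReal_mul]
      ring
    rw [this]
    have := InfinitePlace.mult_pos (w := v)
    positivity
  have hc : ∀ v : InfinitePlace K, 0 < π * v.mult := fun v => by
    have := InfinitePlace.mult_pos (w := v)
    positivity
  simp_rw [h]
  constructor
  · exact Integrable.fintype_prod (E := ℝ) (ι := InfinitePlace K) (μ := fun _ => volume)
      (f := fun v (t : ℝ) => ((rexp (-(π * v.mult) * rexp (2 * t)) : ℂ) *
        Complex.exp (2 * (v.mult * s / 2) * t))) fun v => (integral_exp_exp (hc v) (hm v)).1
  · rw [integral_fintype_prod_volume_eq_prod (E := fun _ : InfinitePlace K => ℝ)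
      (f := fun v (t : ℝ) => ((rexp (-(π * v.mult) * rexp (2 * t)) : ℂ) *
        Complex.exp (2 * (v.mult * s / 2) * t)))]
    exact Finset.prod_congr rfl fun v _ => (integral_exp_exp (hc v) (hm v)).2

end

noncomputable section

open Real Filter MeasureTheory Set NumberField Asymptotics

variable (K : Type) [Field K] [NumberField K]

theorem sum_card_absNorm_isBigO :
    (fun n : ℕ => ∑ k ∈ Finset.Icc 1 n, (Nat.card {I : Ideal (𝓞 K) // Ideal.absNorm I = k} : ℝ))
      =O[atTop] fun n => (n : ℝ) ^ (1 : ℝ) := by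
  have h := (Ideal.tendsto_norm_le_div_atTop₀ K).comp tendsto_natCast_atTop_atTop
  have h2 := h.isBigO_one ℝ
  have h3 := h2.mul (isBigO_refl (fun n : ℕ => (n : ℝ) ^ (1 : ℝ)) atTop)
  refine h3.congr' ?_ (by simp)
  filter_upwards [eventually_gt_atTop 0] with n hn
  have hn' : (n : ℝ) ≠ 0 := by exact_mod_cast hn.ne'
  simp only [Function.comp_apply, Nat.cast_le, ← Nat.cast_sum, Real.rpow_one]
  rw [div_mul_cancel₀ _ hn']
  congr
  rw [← add_left_inj 1, ← Ideal.card_norm_le_eq_card_norm_le_add_one,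
    show Finset.Icc 1 n = Finset.Ioc 0 n from Finset.Icc_succ_left_eq_Ioc _ _,
    show 1 = Nat.card {I : Ideal (𝓞 K) // Ideal.absNorm I = 0} by simp [Ideal.absNorm_eq_zero_iff],
    Finset.sum_Ioc_add_eq_sum_Icc (n.zero_le),
    ← Finset.card_preimage_eq_sum_card_image_eq (fun k _ ↦ Ideal.finite_setOfPred_absNorm_eq k)]
  simp [Set.coe_eq_subtype]

theorem summable_absNorm_rpow {σ : ℝ} (hσ : 1 < σ) :
    Summable fun I : {I : Ideal (𝓞 K) // I ≠ 0} => (Ideal.absNorm I.1 : ℝ) ^ (-σ) := by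
  have h1 : LSeriesSummable (fun n => ((Nat.card {I : Ideal (𝓞 K) // Ideal.absNorm I = n} : ℝ) : ℂ))
      (σ : ℂ) :=
    LSeriesSummable_of_sum_norm_bigO_and_nonneg (sum_card_absNorm_isBigO K)
      (fun _ => Nat.cast_nonneg _) zero_le_one (by simpa using hσ)
  have h2 := h1.norm
  let f : {I : Ideal (𝓞 K) // I ≠ 0} → ℕ := fun I => Ideal.absNorm I.1
  rw [← (Equiv.sigmaFiberEquiv f).summable_iff]
  have hfin : ∀ n, Finite {I // f I = n} := by
    intro n
    have := Ideal.finite_setOfPred_absNorm_eq (S := 𝓞 K) n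
    have : Finite {I : Ideal (𝓞 K) // Ideal.absNorm I = n} := this
    exact Finite.of_injective (fun I => (⟨I.1.1, I.2⟩ : {I : Ideal (𝓞 K) // Ideal.absNorm I = n}))
      fun I J h => Subtype.ext (Subtype.ext (Subtype.mk.inj h))
  refine (summable_sigma_of_nonneg fun x => ?_).2 ⟨fun n => ?_, ?_⟩
  · simp only [Function.comp_apply]; positivity
  · have := Fintype.ofFinite {I // f I = n}
    exact (hasSum_fintype _).summable
  · refine h2.of_nonneg_of_le (fun n => tsum_nonneg fun _ => by
      simp only [Function.comp_apply]; positivity) fun n => ?_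
    have := Fintype.ofFinite {I // f I = n}
    rw [tsum_fintype]
    have hval : ∀ I : {I // f I = n}, ((fun I : {I : Ideal (𝓞 K) // I ≠ 0} =>
        (Ideal.absNorm I.1 : ℝ) ^ (-σ)) ∘ (Equiv.sigmaFiberEquiv f)) ⟨n, I⟩ = (n : ℝ) ^ (-σ) := by
      intro I
      have : Ideal.absNorm I.1.1 = n := I.2
      simp [Equiv.sigmaFiberEquiv, this]
    simp_rw [hval]
    rw [Finset.sum_const, Finset.card_univ, nsmul_eq_mul]
    rcases Nat.eq_zero_or_pos n with rfl | hn
    · have : IsEmpty {I // f I = 0} := ⟨fun I => I.1.2 (Ideal.absNorm_eq_zero_iff.1 I.2)⟩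
      simp
    · rw [LSeries.term_of_ne_zero hn.ne', norm_div, Complex.norm_natCast_cpow_of_pos hn]
      simp only [Complex.ofReal_natCast, Complex.norm_natCast, Complex.ofReal_re]
      rw [Real.rpow_neg (Nat.cast_nonneg _), ← div_eq_mul_inv]
      gcongr
      have := Ideal.finite_setOfPred_absNorm_eq (S := 𝓞 K) n
      have : Finite {I : Ideal (𝓞 K) // Ideal.absNorm I = n} := this
      rw [← Nat.card_eq_fintype_card]
      exact Nat.card_le_card_of_injective (fun I => (⟨I.1.1, I.2⟩ : {I : Ideal (𝓞 K) //
        Ideal.absNorm I = n})) fun I J h => Subtype.ext (Subtype.ext (Subtype.mk.inj h))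

end

noncomputable section

open Real Filter MeasureTheory Set Matrix NumberField
open scoped nonZeroDivisors
open FractionalIdeal (spanSingleton)

variable {K : Type} [Field K] [NumberField K]

def IsPrincipalMul (J : FractionalIdeal (𝓞 K)⁰ K) (B : Ideal (𝓞 K)) : Prop :=
  ∃ x : K, spanSingleton (𝓞 K)⁰ x = (B : FractionalIdeal (𝓞 K)⁰ K) * J

theorem spanSingleton_eq_iff_exists_unit {x y : K} (h : spanSingleton (𝓞 K)⁰ x = spanSingleton (𝓞 K)⁰ y) :
    ∃ u : (𝓞 K)ˣ, x * ((u : 𝓞 K) : K) = y := by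
  rw [FractionalIdeal.spanSingleton_eq_spanSingleton] at h
  obtain ⟨u, hu⟩ := h
  exact ⟨u, by rw [← hu, Units.smul_def, Algebra.smul_def, mul_comm]⟩

theorem spanSingleton_mul_unit (x : K) (u : (𝓞 K)ˣ) :
    spanSingleton (𝓞 K)⁰ (x * ((u : 𝓞 K) : K)) = spanSingleton (𝓞 K)⁰ x := by
  symm
  rw [FractionalIdeal.spanSingleton_eq_spanSingleton]
  exact ⟨u, by rw [Units.smul_def, Algebra.smul_def, mul_comm]⟩

theorem exists_equiv_nonzero_elements (J : (FractionalIdeal (𝓞 K)⁰ K)ˣ) :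
    ∃ a : {B : {B : Ideal (𝓞 K) // B ≠ 0} // IsPrincipalMul J.1 B.1} → K,
      (∀ B, a B ≠ 0 ∧ (|(Algebra.norm ℚ (a B) : ℚ)| : ℝ) =
        Ideal.absNorm B.1.1 * FractionalIdeal.absNorm J.1) ∧
      ∃ e : {B : {B : Ideal (𝓞 K) // B ≠ 0} // IsPrincipalMul J.1 B.1} × (𝓞 K)ˣ ≃
        {x : K // x ∈ J.1 ∧ x ≠ 0}, ∀ B u, (e (B, u) : K) = a B * ((u : 𝓞 K) : K) := by
  choose a ha using fun B : {B : {B : Ideal (𝓞 K) // B ≠ 0} // IsPrincipalMul J.1 B.1} => B.2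
  have ha0 : ∀ B, a B ≠ 0 := by
    intro B hB
    have := ha B
    rw [hB, FractionalIdeal.spanSingleton_zero, eq_comm, mul_eq_zero] at this
    exact this.elim (fun h => B.1.2 (FractionalIdeal.coeIdeal_eq_zero.1 h)) J.ne_zero
  have hu0 : ∀ u : (𝓞 K)ˣ, ((u : 𝓞 K) : K) ≠ 0 := fun u => by simp
  refine ⟨a, fun B => ⟨ha0 B, ?_⟩, ?_⟩
  · have h := congrArg FractionalIdeal.absNorm (ha B)
    rw [FractionalIdeal.absNorm_span_singleton, map_mul, FractionalIdeal.coeIdeal_absNorm] at h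
    rw [← Rat.cast_abs, h]
    push_cast
    rfl
  · have hmem : ∀ p : {B : {B : Ideal (𝓞 K) // B ≠ 0} // IsPrincipalMul J.1 B.1} × (𝓞 K)ˣ,
        a p.1 * ((p.2 : 𝓞 K) : K) ∈ J.1 ∧ a p.1 * ((p.2 : 𝓞 K) : K) ≠ 0 := by
      intro p
      refine ⟨?_, mul_ne_zero (ha0 _) (hu0 _)⟩
      rw [← FractionalIdeal.spanSingleton_le_iff_mem, spanSingleton_mul_unit, ha]
      calc _ ≤ (1 : FractionalIdeal (𝓞 K)⁰ K) * J.1 :=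
            mul_le_mul_left FractionalIdeal.coeIdeal_le_one _
        _ = _ := one_mul _
    refine ⟨Equiv.ofBijective (fun p => ⟨_, hmem p⟩) ⟨?_, ?_⟩, fun B u => rfl⟩
    · rintro ⟨B, u⟩ ⟨B', u'⟩ h
      have h1 : a B * ((u : 𝓞 K) : K) = a B' * ((u' : 𝓞 K) : K) := Subtype.mk.inj h
      have h2 := congrArg (spanSingleton (𝓞 K)⁰) h1
      rw [spanSingleton_mul_unit, spanSingleton_mul_unit, ha, ha] at h2
      have h3 := mul_right_cancel₀ J.ne_zero h2
      have hB : B = B' := Subtype.ext (Subtype.ext (FractionalIdeal.coeIdeal_injective h3))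
      subst hB
      have h4 := mul_left_cancel₀ (ha0 B) h1
      have : u = u' := Units.ext (RingOfIntegers.ext h4)
      rw [this]
    · rintro ⟨x, hx, hx0⟩
      have h1 : spanSingleton (𝓞 K)⁰ x * (J⁻¹).1 ≤ 1 := by
        calc _ ≤ J.1 * (J⁻¹).1 := mul_le_mul_left (FractionalIdeal.spanSingleton_le_iff_mem.2 hx) _
          _ = 1 := J.mul_inv
      obtain ⟨B, hB⟩ := FractionalIdeal.le_one_iff_exists_coeIdeal.1 h1
      have h2 : spanSingleton (𝓞 K)⁰ x = (B : FractionalIdeal (𝓞 K)⁰ K) * J.1 := by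
        rw [hB, mul_assoc, Units.inv_mul, mul_one]
      have hB0 : B ≠ 0 := by
        rintro rfl
        rw [Submodule.zero_eq_bot, FractionalIdeal.coeIdeal_bot, zero_mul,
          FractionalIdeal.spanSingleton_eq_zero_iff] at h2
        exact hx0 h2
      obtain ⟨u, hu⟩ := spanSingleton_eq_iff_exists_unit ((ha ⟨⟨B, hB0⟩, x, h2⟩).trans h2.symm)
      exact ⟨(⟨⟨B, hB0⟩, x, h2⟩, u), Subtype.ext hu⟩

theorem existsUnique_isPrincipalMul {ι : Type*} {I : ι → (FractionalIdeal (𝓞 K)⁰ K)ˣ}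
    (hI : Function.Bijective fun c => (I c : (FractionalIdeal (𝓞 K)⁰ K)ˣ ⧸ (toPrincipalIdeal (𝓞 K) K).range))
    {B : Ideal (𝓞 K)} (hB : B ≠ 0) : ∃! c, IsPrincipalMul (I c).1 B := by
  have key : ∀ c, IsPrincipalMul (I c).1 B ↔ ((Units.mk0 (B : FractionalIdeal (𝓞 K)⁰ K)
      (FractionalIdeal.coeIdeal_ne_zero.2 hB))⁻¹ : (FractionalIdeal (𝓞 K)⁰ K)ˣ) =
      (I c : (FractionalIdeal (𝓞 K)⁰ K)ˣ ⧸ (toPrincipalIdeal (𝓞 K) K).range) := by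
    intro c
    rw [QuotientGroup.eq, inv_inv, mem_principal_ideals_iff]
    rfl
  simp_rw [key]
  obtain ⟨c, hc⟩ := hI.2 ((Units.mk0 (B : FractionalIdeal (𝓞 K)⁰ K)
      (FractionalIdeal.coeIdeal_ne_zero.2 hB))⁻¹ : (FractionalIdeal (𝓞 K)⁰ K)ˣ)
  exact ⟨c, hc.symm, fun c' hc' => hI.1 (hc'.symm.trans hc.symm)⟩

end

noncomputable section

open Real Filter MeasureTheory Set Matrix NumberField
open scoped nonZeroDivisors

variable {K : Type} [Field K] [NumberField K]

instance countable_numberField : Countable K :=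
  (Module.finBasis ℚ K).equivFun.injective.countable

instance countable_units : Countable (𝓞 K)ˣ :=
  Function.Injective.countable (f := fun u : (𝓞 K)ˣ => ((u : 𝓞 K) : K))
    fun _ _ h => Units.ext (RingOfIntegers.ext h)

theorem hasSum_integral_unitWeight {E : Type*} [NormedAddCommGroup E] [NormedSpace ℝ E]
    [CompleteSpace E]
    {g : (InfinitePlace K → ℝ) → E} (hg : Integrable g) (z : InfinitePlace K → ℝ) :
    HasSum (fun u : (𝓞 K)ˣ => ∫ y, unitWeight (y + z + logVec ((u : 𝓞 K) : K)) • g y) (∫ y, g y) := by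
  refine hasSum_integral_of_dominated_convergence
    (fun u y => unitWeight (y + z + logVec ((u : 𝓞 K) : K)) * ‖g y‖) ?_ ?_ ?_ ?_ ?_
  · intro u
    exact ((measurable_unitWeight.comp ((measurable_id.add_const _).add_const _))).aestronglyMeasurable.smul
      hg.aestronglyMeasurable
  · intro u
    refine Eventually.of_forall fun y => ?_
    rw [norm_smul, Real.norm_of_nonneg (unitWeight_nonneg _)]
  · exact Eventually.of_forall fun y => ((hasSum_unitWeight (y + z)).mul_right _).summable
  · have : ∀ y, ∑' u : (𝓞 K)ˣ, unitWeight (y + z + logVec ((u : 𝓞 K) : K)) * ‖g y‖ = ‖g y‖ :=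
      fun y => by rw [((hasSum_unitWeight (y + z)).mul_right _).tsum_eq, one_mul]
    simp_rw [this]
    exact hg.norm
  · refine Eventually.of_forall fun y => ?_
    simpa using (hasSum_unitWeight (y + z)).smul_const (g y)

theorem unitWeight_term_eq {x : K} (hx : x ≠ 0) (u : (𝓞 K)ˣ) (s : ℂ) (y : InfinitePlace K → ℝ) :
    (unitWeight (y + (-logVec (x * ((u : 𝓞 K) : K)))) *
        rexp (-π * placeForm (y + (-logVec (x * ((u : 𝓞 K) : K)))) (x * ((u : 𝓞 K) : K))) : ℂ) *
      Complex.exp (s * logNorm (y + (-logVec (x * ((u : 𝓞 K) : K))))) =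
    ((|(Algebra.norm ℚ x : ℚ)| : ℝ) : ℂ) ^ (-s) *
      (unitWeight (y + -logVec x + logVec (((u⁻¹ : (𝓞 K)ˣ) : 𝓞 K) : K)) •
        ((rexp (-π * placeForm y 1) : ℂ) * Complex.exp (s * logNorm y))) := by
  have hu : ((u : 𝓞 K) : K) ≠ 0 := by simp
  have hxu := mul_ne_zero hx hu
  have h1 : y + (-logVec (x * ((u : 𝓞 K) : K))) =
      y + -logVec x + logVec (((u⁻¹ : (𝓞 K)ˣ) : 𝓞 K) : K) := by
    have : (((u⁻¹ : (𝓞 K)ˣ) : 𝓞 K) : K) = (((u : 𝓞 K) : K))⁻¹ := by simp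
    rw [this, logVec_inv, logVec_mul hx hu]
    abel
  have h2 : placeForm (y + (-logVec (x * ((u : 𝓞 K) : K)))) (x * ((u : 𝓞 K) : K)) = placeForm y 1 := by
    have := placeForm_add_logVec (y + (-logVec (x * ((u : 𝓞 K) : K)))) hxu 1
    rw [mul_one] at this
    rw [← this]
    congr 1
    abel
  have h3 : Complex.exp (s * logNorm (y + (-logVec (x * ((u : 𝓞 K) : K))))) =
      ((|(Algebra.norm ℚ x : ℚ)| : ℝ) : ℂ) ^ (-s) * Complex.exp (s * logNorm y) := by
    have hn : (0 : ℝ) < ((|(Algebra.norm ℚ x : ℚ)| : ℚ) : ℝ) := by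
      rw [Rat.cast_abs]
      simpa using hx
    rw [logNorm_add, logNorm_neg, logVec_mul hx hu, logNorm_add, logNorm_logVec_unit, add_zero,
      logNorm_logVec hx, ← Rat.cast_abs, Complex.cpow_def_of_ne_zero (by exact_mod_cast hn.ne' :
        (((|(Algebra.norm ℚ x : ℚ)| : ℚ) : ℝ) : ℂ) ≠ 0),
      ← Complex.ofReal_log hn.le, ← Complex.exp_add]
    congr 1
    push_cast
    ring
  rw [h2, h3, h1, Complex.real_smul]
  ring

theorem hasSum_integral_orbit {x : K} (hx : x ≠ 0) {s : ℂ} (hs : 0 < s.re) :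
    (∀ u : (𝓞 K)ˣ, Integrable fun y => (unitWeight y * rexp (-π * placeForm y (x * ((u : 𝓞 K) : K))) : ℂ) *
        Complex.exp (s * logNorm y)) ∧
    HasSum (fun u : (𝓞 K)ˣ => ∫ y,
      (unitWeight y * rexp (-π * placeForm y (x * ((u : 𝓞 K) : K))) : ℂ) *
        Complex.exp (s * logNorm y)) (((|(Algebra.norm ℚ x : ℚ)| : ℝ) : ℂ) ^ (-s) * gammaProd K s) := by
  obtain ⟨hg, hG⟩ := integral_placeForm_one (K := K) hs
  constructor
  · intro u
    suffices h : Integrable fun y => (unitWeight (y + (-logVec (x * ((u : 𝓞 K) : K)))) *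
        rexp (-π * placeForm (y + (-logVec (x * ((u : 𝓞 K) : K)))) (x * ((u : 𝓞 K) : K))) : ℂ) *
        Complex.exp (s * logNorm (y + (-logVec (x * ((u : 𝓞 K) : K))))) by
      have h2 := h.comp_add_right (logVec (x * ((u : 𝓞 K) : K)))
      simpa only [add_neg_cancel_right] using h2
    simp_rw [unitWeight_term_eq hx u s]
    refine Integrable.const_mul ?_ _
    refine Integrable.bdd_smul (𝕜 := ℝ) (φ := fun y => unitWeight (y + -logVec x +
      logVec (((u⁻¹ : (𝓞 K)ˣ) : 𝓞 K) : K))) hg 1 ?_ ?_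
    · exact ((measurable_unitWeight.comp ((measurable_id.add_const _).add_const _))).aestronglyMeasurable
    · exact Eventually.of_forall fun y => by
        rw [Real.norm_of_nonneg (unitWeight_nonneg _)]
        exact unitWeight_le_one _
  · have h := hasSum_integral_unitWeight hg (-logVec x)
    rw [← (Equiv.inv (𝓞 K)ˣ).hasSum_iff] at h
    have h2 := h.mul_left (((|(Algebra.norm ℚ x : ℚ)| : ℝ) : ℂ) ^ (-s))
    rw [hG] at h2
    convert! h2 using 1
    refine funext fun u => ?_
    rw [← integral_add_right_eq_self _ (-logVec (x * ((u : 𝓞 K) : K)))]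
    simp_rw [unitWeight_term_eq hx u s]
    rw [integral_const_mul]
    rfl

end

noncomputable section

open Real Filter MeasureTheory Set Matrix NumberField
open scoped nonZeroDivisors

variable {K : Type} [Field K] [NumberField K]

theorem integrable_tsum_of_summable_integral_norm {α ι E : Type*} [MeasurableSpace α]
    {μ : Measure α} [Countable ι] [NormedAddCommGroup E] [NormedSpace ℝ E] [CompleteSpace E]
    {F : ι → α → E} (hF : ∀ i, Integrable (F i) μ) (hs : Summable fun i => ∫ a, ‖F i a‖ ∂μ)
    (hm : AEStronglyMeasurable (fun a => ∑' i, F i a) μ) :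
    Integrable (fun a => ∑' i, F i a) μ := by
  refine ⟨hm, ?_⟩
  have h1 : ∑' i, ∫⁻ a, ‖F i a‖ₑ ∂μ < ⊤ := by
    have : ∀ i, ∫⁻ a, ‖F i a‖ₑ ∂μ = ENNReal.ofReal (∫ a, ‖F i a‖ ∂μ) := fun i => by
      rw [ofReal_integral_norm_eq_lintegral_enorm (hF i)]
    simp_rw [this]
    exact hs.tsum_ofReal_lt_top
  rw [← lintegral_tsum fun i => (hF i).1.enorm] at h1
  exact lt_of_le_of_lt (lintegral_mono fun a => enorm_tsum_le_tsum_enorm) h1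

def nzTheta (I : FractionalIdeal (𝓞 K)⁰ K) (y : InfinitePlace K → ℝ) : ℝ :=
  ∑' α : {α : K // α ∈ I ∧ α ≠ 0}, rexp (-π * placeForm y (α : K))

theorem idealTheta_eq_one_add (J : (FractionalIdeal (𝓞 K)⁰ K)ˣ) (y : InfinitePlace K → ℝ) :
    idealTheta J.1 y = 1 + nzTheta J.1 y := by
  have h := (idealTheta_functional J y).1
  classical
  rw [idealTheta, h.tsum_eq_add_tsum_ite ⟨0, FractionalIdeal.zero_mem _⟩]
  congr 1
  · simp [placeForm]
  · have hinj : Function.Injective (fun α : {α : K // α ∈ J.1 ∧ α ≠ 0} =>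
        (⟨α.1, α.2.1⟩ : {α : K // α ∈ J.1})) := fun _ _ h =>
      Subtype.ext (congrArg (fun z : {α : K // α ∈ J.1} => (z : K)) h)
    rw [nzTheta, ← hinj.tsum_eq]
    · refine tsum_congr fun α => ?_
      rw [if_neg]
      intro h
      exact α.2.2 (congrArg (fun z : {α : K // α ∈ J.1} => (z : K)) h)
    · intro α hα
      refine ⟨⟨α.1, α.2, fun h => hα ?_⟩, rfl⟩
      have : α = ⟨0, FractionalIdeal.zero_mem _⟩ := Subtype.ext h
      simp [this]

theorem measurable_placeForm (x : K) : Measurable fun y => placeForm y x := by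
  unfold placeForm
  fun_prop

theorem measurable_nzTheta (J : (FractionalIdeal (𝓞 K)⁰ K)ˣ) : Measurable (nzTheta J.1) := by
  have h : ∀ y, nzTheta J.1 y = (∑' α : {α : K // α ∈ J.1 ∧ α ≠ 0},
      ENNReal.ofReal (rexp (-π * placeForm y (α : K)))).toReal := by
    intro y
    rw [ENNReal.tsum_toReal_eq (fun _ => ENNReal.ofReal_ne_top)]
    simp [nzTheta, (Real.exp_pos _).le]
  rw [funext h]
  refine (Measurable.tsum fun α => ?_).ennreal_toReal
  have := measurable_placeForm (K := K) α.1
  fun_prop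

theorem integral_nzTheta (J : (FractionalIdeal (𝓞 K)⁰ K)ˣ) {s : ℂ} (hs : 1 < s.re) :
    Integrable (fun y => (unitWeight y * nzTheta J.1 y : ℂ) * Complex.exp (s * logNorm y)) ∧
    ((FractionalIdeal.absNorm J.1 : ℝ) : ℂ) ^ s * ∫ y, (unitWeight y * nzTheta J.1 y : ℂ) *
        Complex.exp (s * logNorm y) =
      gammaProd K s * ∑' B : {B : {B : Ideal (𝓞 K) // B ≠ 0} // IsPrincipalMul J.1 B.1},
        (Ideal.absNorm B.1.1 : ℂ) ^ (-s) := by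
  obtain ⟨a, ha, e, he⟩ := exists_equiv_nonzero_elements J
  have hJ : (0 : ℝ) < FractionalIdeal.absNorm J.1 := by
    have h0 := FractionalIdeal.absNorm_nonneg J.1
    have h1 : FractionalIdeal.absNorm J.1 ≠ 0 := by
      rw [Ne, FractionalIdeal.absNorm_eq_zero_iff]
      exact J.ne_zero
    exact_mod_cast lt_of_le_of_ne h0 h1.symm
  have hB : ∀ B : {B : Ideal (𝓞 K) // B ≠ 0}, (0 : ℝ) < Ideal.absNorm B.1 := by
    intro B
    have : Ideal.absNorm B.1 ≠ 0 := by
      rw [Ne, Ideal.absNorm_eq_zero_iff]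
      exact B.2
    exact_mod_cast Nat.pos_of_ne_zero this
  have horb := fun B => hasSum_integral_orbit (ha B).1 (s := s) (by linarith)
  have hσ : ((s.re : ℝ) : ℂ).re = s.re := rfl
  have horb' := fun B => (hasSum_integral_orbit (ha B).1 (s := (s.re : ℂ)) (by rw [hσ]; linarith)).2
  set F : {x : K // x ∈ J.1 ∧ x ≠ 0} → (InfinitePlace K → ℝ) → ℂ := fun x y =>
    (unitWeight y * rexp (-π * placeForm y (x : K)) : ℂ) * Complex.exp (s * logNorm y) with hF
  have hFint : ∀ x, Integrable (F x) := by
    intro x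
    obtain ⟨⟨B, u⟩, rfl⟩ := e.surjective x
    simp only [hF, he]
    exact (horb B).1 u
  have hFnorm : ∀ x, ((∫ y, ‖F x y‖ : ℝ) : ℂ) = ∫ y, (unitWeight y * rexp (-π * placeForm y (x : K)) : ℂ) *
      Complex.exp ((s.re : ℂ) * logNorm y) := by
    intro x
    rw [← integral_complex_ofReal]
    congr 1
    ext y
    simp only [hF, norm_mul, Complex.norm_exp, Complex.norm_real,
      Real.norm_of_nonneg (unitWeight_nonneg y), Real.norm_of_nonneg (Real.exp_pos _).le]
    push_cast
    simp
  have hsum : Summable fun x => ∫ y, ‖F x y‖ := by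
    rw [← e.summable_iff]
    have h1 : ∀ B, HasSum (fun u => ∫ y, ‖F (e (B, u)) y‖)
        ((|(Algebra.norm ℚ (a B) : ℚ)| : ℝ) ^ (-s.re) * (gammaProd K (s.re : ℂ)).re) := by
      intro B
      have h := horb' B
      simp_rw [← he, ← hFnorm] at h
      have hre := Complex.hasSum_re h
      simp only [Complex.ofReal_re] at hre
      convert! hre using 1
      rw [← Complex.ofReal_neg, ← Complex.ofReal_cpow (abs_nonneg _), Complex.re_ofReal_mul]
    refine (summable_prod_of_nonneg fun _ => integral_nonneg fun _ => norm_nonneg _).2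
      ⟨fun B => (h1 B).summable, ?_⟩
    simp only [(h1 _).tsum_eq]
    refine Summable.mul_right _ ?_
    have h2 : ∀ B, (|(Algebra.norm ℚ (a B) : ℚ)| : ℝ) ^ (-s.re) =
        (Ideal.absNorm B.1.1 : ℝ) ^ (-s.re) * (FractionalIdeal.absNorm J.1 : ℝ) ^ (-s.re) := by
      intro B
      rw [(ha B).2, Real.mul_rpow (hB _).le hJ.le]
    simp_rw [h2]
    exact ((summable_absNorm_rpow K hs).comp_injective Subtype.val_injective).mul_right _
  have hpt : ∀ y, (unitWeight y * nzTheta J.1 y : ℂ) * Complex.exp (s * logNorm y) = ∑' x, F x y := by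
    intro y
    simp only [hF, tsum_mul_right, tsum_mul_left, nzTheta]
    push_cast
    rfl
  simp_rw [hpt]
  refine ⟨integrable_tsum_of_summable_integral_norm hFint hsum ?_, ?_⟩
  · simp_rw [← hpt]
    have h1 := measurable_unitWeight (K := K)
    have h2 := measurable_nzTheta J
    have h3 := (continuous_logNorm (K := K)).measurable
    fun_prop
  · have h := hasSum_integral_of_summable_integral_norm hFint hsum
    rw [← e.hasSum_iff] at h
    have h' := h.prod_fiberwise (g := fun B => ((|(Algebra.norm ℚ (a B) : ℚ)| : ℝ) : ℂ) ^ (-s) * gammaProd K s) (by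
      intro B
      have := (horb B).2
      simpa only [Function.comp_def, hF, he] using this)
    rw [← h'.tsum_eq, tsum_mul_right, mul_left_comm, ← mul_assoc, mul_comm (gammaProd K s), ← tsum_mul_right]
    congr 1
    refine tsum_congr fun B => ?_
    rw [(ha B).2, Complex.ofReal_mul, Complex.mul_cpow_ofReal_nonneg (hB _).le hJ.le, mul_assoc,
      ← Complex.cpow_add _ _ (by exact_mod_cast hJ.ne'), neg_add_cancel, Complex.cpow_zero, mul_one]
    norm_cast

end

noncomputable section

open Real Filter MeasureTheory Set Matrix NumberField
open scoped nonZeroDivisors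

variable {K : Type} [Field K] [NumberField K]

theorem summable_absNorm_cpow {s : ℂ} (hs : 1 < s.re) :
    Summable fun I : {I : Ideal (𝓞 K) // I ≠ 0} => (Ideal.absNorm I.1 : ℂ) ^ (-s) := by
  refine Summable.of_norm ((summable_absNorm_rpow K hs).congr fun I => ?_)
  have : Ideal.absNorm I.1 ≠ 0 := by
    rw [Ne, Ideal.absNorm_eq_zero_iff]
    exact I.2
  rw [Complex.norm_natCast_cpow_of_pos (Nat.pos_of_ne_zero this), Complex.neg_re]

theorem sum_classes {ι : Type*} [Fintype ι] {I : ι → (FractionalIdeal (𝓞 K)⁰ K)ˣ}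
    (hI : Function.Bijective fun c => (I c : (FractionalIdeal (𝓞 K)⁰ K)ˣ ⧸ (toPrincipalIdeal (𝓞 K) K).range))
    {f : {B : Ideal (𝓞 K) // B ≠ 0} → ℂ} (hf : Summable f) :
    ∑ c, ∑' B : {B : {B : Ideal (𝓞 K) // B ≠ 0} // IsPrincipalMul (I c).1 B.1}, f B.1 = ∑' B, f B := by
  let e : (Σ c, {B : {B : Ideal (𝓞 K) // B ≠ 0} // IsPrincipalMul (I c).1 B.1}) ≃
      {B : Ideal (𝓞 K) // B ≠ 0} := Equiv.ofBijective (fun p => p.2.1) (by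
    constructor
    · rintro ⟨c, B⟩ ⟨c', B'⟩ h
      simp only at h
      have hc : c = c' := (existsUnique_isPrincipalMul hI B.1.2).unique B.2 (h ▸ B'.2)
      subst hc
      congr
      exact Subtype.ext h
    · intro B
      obtain ⟨c, hc, -⟩ := existsUnique_isPrincipalMul hI B.2
      exact ⟨⟨c, B, hc⟩, rfl⟩)
  have h := Summable.tsum_sigma ((e.summable_iff).2 hf)
  rw [← e.tsum_eq, ← tsum_fintype (L := .unconditional _)]
  exact h.symm

theorem sum_integral_nzTheta {ι : Type*} [Fintype ι] {I : ι → (FractionalIdeal (𝓞 K)⁰ K)ˣ}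
    (hI : Function.Bijective fun c => (I c : (FractionalIdeal (𝓞 K)⁰ K)ˣ ⧸ (toPrincipalIdeal (𝓞 K) K).range))
    {s : ℂ} (hs : 1 < s.re) :
    ∑ c, ((FractionalIdeal.absNorm (I c).1 : ℝ) : ℂ) ^ s *
      ∫ y, (unitWeight y * nzTheta (I c).1 y : ℂ) * Complex.exp (s * logNorm y) =
      gammaProd K s * ∑' B : {B : Ideal (𝓞 K) // B ≠ 0}, (Ideal.absNorm B.1 : ℂ) ^ (-s) := by
  rw [← sum_classes hI (summable_absNorm_cpow hs), Finset.mul_sum]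
  exact Finset.sum_congr rfl fun c _ => (integral_nzTheta (I c) hs).2

theorem exists_classReps : ∃ (ι : Type) (_ : Fintype ι) (I I' : ι → (FractionalIdeal (𝓞 K)⁰ K)ˣ),
    (Function.Bijective fun c => (I c : (FractionalIdeal (𝓞 K)⁰ K)ˣ ⧸ (toPrincipalIdeal (𝓞 K) K).range)) ∧
    (Function.Bijective fun c => (I' c : (FractionalIdeal (𝓞 K)⁰ K)ˣ ⧸ (toPrincipalIdeal (𝓞 K) K).range)) ∧
    (∀ c, (I' c).1 = FractionalIdeal.dual ℤ ℚ (I c).1) ∧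
    ∀ c, (I c).1 = FractionalIdeal.dual ℤ ℚ (I' c).1 := by
  let Q := (FractionalIdeal (𝓞 K)⁰ K)ˣ ⧸ (toPrincipalIdeal (𝓞 K) K).range
  have hfin : Finite Q := Finite.of_equiv _ (ClassGroup.equiv K).toEquiv
  let D : (FractionalIdeal (𝓞 K)⁰ K)ˣ :=
    Units.mk0 (FractionalIdeal.dual ℤ ℚ 1) (FractionalIdeal.dual_ne_zero ℤ ℚ one_ne_zero)
  have h1 : ∀ c : Q, ((D * (Quotient.out c)⁻¹ : (FractionalIdeal (𝓞 K)⁰ K)ˣ) : FractionalIdeal (𝓞 K)⁰ K) =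
      FractionalIdeal.dual ℤ ℚ ((Quotient.out c : (FractionalIdeal (𝓞 K)⁰ K)ˣ) : FractionalIdeal (𝓞 K)⁰ K) := by
    intro c
    rw [FractionalIdeal.dual_eq_mul_inv]
    simp [D]
  refine ⟨Q, Fintype.ofFinite Q, fun c => Quotient.out c, fun c => D * (Quotient.out c)⁻¹, ?_, ?_,
    h1, ?_⟩
  · convert! Function.bijective_id using 1
    funext c
    exact Quotient.out_eq c
  · have : (fun c : Q => ((D * (Quotient.out c)⁻¹ : (FractionalIdeal (𝓞 K)⁰ K)ˣ) : Q)) =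
        fun c => (D : Q) * c⁻¹ := by
      funext c
      rw [QuotientGroup.mk_mul, QuotientGroup.mk_inv]
      congr 2
      exact Quotient.out_eq c
    rw [this]
    exact (Group.mulLeft_bijective _).comp (MulEquiv.inv Q).bijective
  · intro c
    rw [h1, FractionalIdeal.dual_dual]

end

noncomputable section

open Real Filter MeasureTheory Set Matrix NumberField
open scoped nonZeroDivisors

variable {K : Type} [Field K] [NumberField K]

variable (K) in
def unitMeasure : Measure (InfinitePlace K → ℝ) :=
  volume.withDensity fun y => ENNReal.ofReal (unitWeight y)

theorem finrank_pos_real : (0 : ℝ) < Module.finrank ℚ K := by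
  exact_mod_cast Module.finrank_pos

instance isAddLeftInvariant_map_unitMeasure :
    (Measure.map logNorm (unitMeasure K)).IsAddLeftInvariant := by
  have hN := (continuous_logNorm (K := K)).measurable
  have hn := finrank_pos_real (K := K)
  refine ⟨fun r => ?_⟩
  have h1 : (fun x : ℝ => r + x) ∘ (logNorm (K := K)) =
      logNorm ∘ fun y => (r / Module.finrank ℚ K) • (1 : InfinitePlace K → ℝ) + y := by
    funext y
    simp only [Function.comp_apply, logNorm_add, logNorm_smul, logNorm_one]
    field_simp
  rw [Measure.map_map (by fun_prop) hN, h1, ← Measure.map_map hN (by fun_prop)]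
  congr 1
  ext s hs
  rw [Measure.map_apply (by fun_prop) hs, unitMeasure, withDensity_apply _ hs,
    withDensity_apply _ ((measurable_const_add _) hs)]
  rw [← lintegral_indicator hs, ← lintegral_indicator ((measurable_const_add _) hs)]
  conv_rhs => rw [← lintegral_add_left_eq_self _ ((r / Module.finrank ℚ K) • (1 : InfinitePlace K → ℝ))]
  refine lintegral_congr fun y => ?_
  simp only [indicator, mem_preimage]
  rw [add_comm _ y, unitWeight_add_smul_one]
  classical
  exact if_congr (by rw [mem_preimage, add_comm]) rfl rfl

theorem unitMeasure_Icc_lt_top : unitMeasure K {y | |logNorm y| ≤ 1} < ⊤ := by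
  have hm : MeasurableSet {y : InfinitePlace K → ℝ | |logNorm y| ≤ 1} := by
    have hN := (continuous_logNorm (K := K)).measurable
    measurability
  have hm2 : MeasurableSet {y : InfinitePlace K → ℝ | unitWeight y ≠ 0} :=
    (measurable_unitWeight (K := K)) (measurableSet_singleton 0).compl
  rw [unitMeasure, withDensity_apply _ hm]
  refine lt_of_le_of_lt ?_ (volume_unitWeight_lt_top (K := K))
  rw [← lintegral_indicator hm, ← setLIntegral_one, ← lintegral_indicator
    (show MeasurableSet {y : InfinitePlace K → ℝ | unitWeight y ≠ 0 ∧ |logNorm y| ≤ 1} from hm2.inter hm)]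
  refine lintegral_mono fun y => ?_
  simp only [indicator, mem_ofPred_eq]
  by_cases h : |logNorm y| ≤ 1 <;> by_cases h' : unitWeight y = 0
  · simp [h']
  · simp only [h, h', if_true, ne_eq, not_false_eq_true, and_self]
    exact ENNReal.ofReal_le_one.2 (unitWeight_le_one y)
  · simp [h]
  · simp [h]

instance isFiniteMeasureOnCompacts_map_unitMeasure :
    IsFiniteMeasureOnCompacts (Measure.map logNorm (unitMeasure K)) := by
  have hN := (continuous_logNorm (K := K)).measurable
  have : IsLocallyFiniteMeasure (Measure.map logNorm (unitMeasure K)) := by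
    refine ⟨fun x => ⟨Metric.closedBall x 1, Metric.closedBall_mem_nhds _ one_pos, ?_⟩⟩
    have h1 : Metric.closedBall x 1 = (fun y => -x + y) ⁻¹' (Metric.closedBall 0 1) := by
      simp
    rw [h1, measure_preimage_add, Measure.map_apply hN measurableSet_closedBall]
    convert! unitMeasure_Icc_lt_top (K := K) using 2
    ext y
    simp
  infer_instance

theorem exists_map_unitMeasure : ∃ κ : NNReal,
    Measure.map logNorm (unitMeasure K) = κ • (volume : Measure ℝ) :=
  ⟨_, Measure.isAddLeftInvariant_eq_smul _ _⟩

theorem integrable_unitMeasure_iff {f : (InfinitePlace K → ℝ) → ℂ} :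
    Integrable f (unitMeasure K) ↔ Integrable fun y => (unitWeight y : ℂ) * f y := by
  rw [unitMeasure, integrable_withDensity_iff_integrable_smul' (measurable_unitWeight.ennreal_ofReal)
    (Eventually.of_forall fun _ => ENNReal.ofReal_lt_top)]
  simp [ENNReal.toReal_ofReal, unitWeight_nonneg]

theorem integral_unitMeasure (f : (InfinitePlace K → ℝ) → ℂ) :
    ∫ y, f y ∂unitMeasure K = ∫ y, (unitWeight y : ℂ) * f y := by
  rw [unitMeasure, integral_withDensity_eq_integral_toReal_smul (measurable_unitWeight.ennreal_ofReal)
    (Eventually.of_forall fun _ => ENNReal.ofReal_lt_top)]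
  simp [ENNReal.toReal_ofReal, unitWeight_nonneg]

theorem map_neg_unitMeasure : MeasurePreserving Neg.neg (unitMeasure K) (unitMeasure K) := by
  refine ⟨measurable_neg, ?_⟩
  ext s hs
  rw [Measure.map_apply measurable_neg hs, unitMeasure, withDensity_apply _ hs,
    withDensity_apply _ (measurable_neg hs), ← lintegral_indicator hs,
    ← lintegral_indicator (measurable_neg hs)]
  conv_rhs => rw [← lintegral_neg_eq_self]
  refine lintegral_congr fun y => ?_
  simp only [indicator, unitWeight_neg]
  classical
  exact if_congr Set.mem_neg rfl rfl

theorem integrableOn_exp_unitMeasure {κ : NNReal}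
    (hκ : Measure.map logNorm (unitMeasure K) = κ • (volume : Measure ℝ)) {s : ℂ} (hs : 0 < s.re) :
    IntegrableOn (fun y => Complex.exp (s * logNorm y)) {y | logNorm y < 0} (unitMeasure K) ∧
    ∫ y in {y | logNorm y < 0}, Complex.exp (s * logNorm y) ∂(unitMeasure K) = κ / s := by
  have hN := (continuous_logNorm (K := K)).measurable
  have hmp : MeasurePreserving logNorm (unitMeasure K) (κ • (volume : Measure ℝ)) := ⟨hN, hκ⟩
  have hr : {y : InfinitePlace K → ℝ | logNorm y < 0} = logNorm ⁻¹' (Iio 0) := rfl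
  have hI : IntegrableOn (fun x : ℝ => Complex.exp (s * x)) (Iio 0) (κ • volume) := by
    rw [IntegrableOn, Measure.restrict_smul]
    exact ((integrableOn_exp_mul_complex_Iic hs 0).mono_set Iio_subset_Iic_self).smul_measure_nnreal
  have hmp' := hmp.restrict_preimage (measurableSet_Iio (a := (0 : ℝ)))
  constructor
  · rw [hr]
    exact hmp'.integrable_comp_of_integrable hI
  · rw [hr, ← integral_map (φ := logNorm) (f := fun x : ℝ => Complex.exp (s * x)) hN.aemeasurable (by fun_prop), hmp'.map_eq,
      Measure.restrict_smul, integral_smul_nnreal_measure, ← integral_Iic_eq_integral_Iio,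
      integral_exp_mul_complex_Iic hs]
    simp [NNReal.smul_def, div_eq_mul_inv]

end

noncomputable section

open Real Filter MeasureTheory Set Matrix NumberField
open scoped nonZeroDivisors

variable {K : Type} [Field K] [NumberField K]

theorem nzTheta_nonneg (I : FractionalIdeal (𝓞 K)⁰ K) (y : InfinitePlace K → ℝ) : 0 ≤ nzTheta I y :=
  tsum_nonneg fun _ => (Real.exp_pos _).le

def thetaUpper (I : FractionalIdeal (𝓞 K)⁰ K) (s : ℂ) : ℂ :=
  ∫ y in {y | 0 < logNorm y}, (nzTheta I y : ℂ) * Complex.exp (s * logNorm y) ∂(unitMeasure K)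

theorem integrable_nzTheta (J : (FractionalIdeal (𝓞 K)⁰ K)ˣ) {s : ℂ} (hs : 1 < s.re) :
    Integrable (fun y => (nzTheta J.1 y : ℂ) * Complex.exp (s * logNorm y)) (unitMeasure K) := by
  rw [integrable_unitMeasure_iff]
  simpa only [mul_assoc] using (integral_nzTheta J hs).1

theorem measurableSet_logNorm_pos : MeasurableSet {y : InfinitePlace K → ℝ | 0 < logNorm y} :=
  (continuous_logNorm (K := K)).measurable measurableSet_Ioi

theorem integrableOn_nzTheta (J : (FractionalIdeal (𝓞 K)⁰ K)ˣ) (s : ℂ) :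
    IntegrableOn (fun y => (nzTheta J.1 y : ℂ) * Complex.exp (s * logNorm y)) {y | 0 < logNorm y}
      (unitMeasure K) := by
  have h2 := measurable_nzTheta J
  have h3 := (continuous_logNorm (K := K)).measurable
  have h := (integrable_nzTheta J (s := ((|s.re| + 2 : ℝ) : ℂ)) (by
    rw [Complex.ofReal_re]; linarith [abs_nonneg s.re])).integrableOn (s := {y | 0 < logNorm y})
  refine MeasureTheory.Integrable.mono h (by fun_prop) ?_
  refine (ae_restrict_iff' measurableSet_logNorm_pos).2 (Eventually.of_forall fun y hy => ?_)
  rw [norm_mul, norm_mul, Complex.norm_exp, Complex.norm_exp]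
  have hy : 0 < logNorm y := hy
  refine mul_le_mul_of_nonneg_left (Real.exp_le_exp.2 ?_) (norm_nonneg _)
  simp only [Complex.re_mul_ofReal, Complex.ofReal_re]
  gcongr
  linarith [le_abs_self s.re]

def upperMeasure (I : FractionalIdeal (𝓞 K)⁰ K) : Measure (InfinitePlace K → ℝ) :=
  ((unitMeasure K).restrict {y | 0 < logNorm y}).withDensity fun y => ENNReal.ofReal (nzTheta I y)

theorem thetaUpper_eq_complexMGF (J : (FractionalIdeal (𝓞 K)⁰ K)ˣ) (s : ℂ) :
    thetaUpper J.1 s = ProbabilityTheory.complexMGF logNorm (upperMeasure J.1) s := by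
  rw [ProbabilityTheory.complexMGF, upperMeasure, integral_withDensity_eq_integral_toReal_smul
    (measurable_nzTheta J).ennreal_ofReal (Eventually.of_forall fun _ => ENNReal.ofReal_lt_top)]
  simp [thetaUpper, ENNReal.toReal_ofReal, nzTheta_nonneg]

theorem integrable_exp_upperMeasure (J : (FractionalIdeal (𝓞 K)⁰ K)ˣ) (t : ℝ) :
    Integrable (fun y => rexp (t * logNorm y)) (upperMeasure J.1) := by
  rw [upperMeasure, integrable_withDensity_iff_integrable_smul'
    (measurable_nzTheta J).ennreal_ofReal (Eventually.of_forall fun _ => ENNReal.ofReal_lt_top)]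
  have h := (integrableOn_nzTheta J (t : ℂ)).norm
  refine h.congr (Eventually.of_forall fun y => ?_)
  simp [ENNReal.toReal_ofReal, nzTheta_nonneg, Complex.norm_exp, abs_of_nonneg]

theorem differentiable_thetaUpper (J : (FractionalIdeal (𝓞 K)⁰ K)ˣ) :
    Differentiable ℂ (thetaUpper J.1) := by
  rw [funext (thetaUpper_eq_complexMGF J), ← differentiableOn_univ]
  have h : ProbabilityTheory.integrableExpSet logNorm (upperMeasure J.1) = univ :=
    eq_univ_of_forall fun t => integrable_exp_upperMeasure J t
  have := ProbabilityTheory.differentiableOn_complexMGF (X := logNorm) (μ := upperMeasure J.1)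
  simpa [h] using this

theorem norm_thetaUpper_le (J : (FractionalIdeal (𝓞 K)⁰ K)ˣ) (R : ℝ) :
    ∃ C, ∀ s : ℂ, s.re ≤ R → ‖thetaUpper J.1 s‖ ≤ C := by
  refine ⟨∫ y in {y | 0 < logNorm y}, ‖(nzTheta J.1 y : ℂ) * Complex.exp ((R : ℂ) * logNorm y)‖
    ∂(unitMeasure K), fun s hs => (norm_integral_le_integral_norm _).trans ?_⟩
  refine setIntegral_mono_on (integrableOn_nzTheta J s).norm (integrableOn_nzTheta J R).norm
    measurableSet_logNorm_pos fun y hy => ?_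
  rw [norm_mul, norm_mul, Complex.norm_exp, Complex.norm_exp]
  have hy : 0 < logNorm y := hy
  refine mul_le_mul_of_nonneg_left (Real.exp_le_exp.2 ?_) (norm_nonneg _)
  simp only [Complex.re_mul_ofReal, Complex.ofReal_re]
  gcongr

theorem integral_nzTheta_eq (J J' : (FractionalIdeal (𝓞 K)⁰ K)ˣ)
    (hJ : J'.1 = FractionalIdeal.dual ℤ ℚ J.1) {κ : NNReal}
    (hκ : Measure.map logNorm (unitMeasure K) = κ • (volume : Measure ℝ)) {s : ℂ} (hs : 1 < s.re) :
    ∫ y, (nzTheta J.1 y : ℂ) * Complex.exp (s * logNorm y) ∂(unitMeasure K) =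
      thetaUpper J.1 s + (((FractionalIdeal.absNorm J.1 : ℝ) * √|(discr K : ℝ)|)⁻¹ : ℝ) *
        (κ / (s - 1) + thetaUpper J'.1 (1 - s)) - κ / s := by
  set c : ℝ := ((FractionalIdeal.absNorm J.1 : ℝ) * √|(discr K : ℝ)|)⁻¹ with hc
  have hth : ∀ y, nzTheta J.1 y = c * rexp (-logNorm y) * (1 + nzTheta J'.1 (-y)) - 1 := by
    intro y
    have h := (idealTheta_functional J y).2
    rw [← hJ, idealTheta_eq_one_add, idealTheta_eq_one_add] at h
    rw [hc]
    linarith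
  have hN := (continuous_logNorm (K := K)).measurable
  have hnz := integrable_nzTheta J hs
  have hzero : unitMeasure K {y | logNorm y = 0} = 0 := by
    have : Measure.map logNorm (unitMeasure K) {0} = 0 := by
      rw [hκ]; simp
    rwa [Measure.map_apply hN (measurableSet_singleton 0)] at this
  have hcompl : ({y : InfinitePlace K → ℝ | 0 < logNorm y}ᶜ : Set _) =ᵐ[unitMeasure K] {y | logNorm y < 0} := by
    have h : ∀ᵐ y ∂(unitMeasure K), logNorm y ≠ 0 := by
      rw [ae_iff]
      simpa using hzero
    filter_upwards [h] with y hy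
    refine propext ?_
    change ¬ (0 < logNorm y) ↔ logNorm y < 0
    exact ⟨fun h => lt_of_le_of_ne (not_lt.1 h) hy, fun h => h.le.not_gt⟩
  rw [← integral_add_compl measurableSet_logNorm_pos hnz, setIntegral_congr_set hcompl]
  obtain ⟨i1, e1⟩ := integrableOn_exp_unitMeasure hκ (s := s - 1) (by simpa using hs)
  obtain ⟨i2, e2⟩ := integrableOn_exp_unitMeasure hκ (s := s) (by linarith)
  have hflip := (map_neg_unitMeasure (K := K)).restrict_preimage (measurableSet_logNorm_pos (K := K))
  have hpre : Neg.neg ⁻¹' {y : InfinitePlace K → ℝ | 0 < logNorm y} = {y | logNorm y < 0} := by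
    ext y
    simp [logNorm_neg]
  rw [hpre] at hflip
  have hemb : MeasurableEmbedding (Neg.neg : (InfinitePlace K → ℝ) → _) :=
    (MeasurableEquiv.neg _).measurableEmbedding
  have e3 := hflip.integral_comp hemb (fun y => (nzTheta J'.1 y : ℂ) * Complex.exp ((1 - s) * logNorm y))
  have i3 : Integrable (fun y => (nzTheta J'.1 (-y) : ℂ) * Complex.exp ((1 - s) * logNorm (-y)))
      ((unitMeasure K).restrict {y | logNorm y < 0}) :=
    (hflip.integrable_comp_emb hemb).2 (integrableOn_nzTheta J' (1 - s))
  have hpt : ∀ y, (nzTheta J.1 y : ℂ) * Complex.exp (s * logNorm y) =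
      c * (Complex.exp ((s - 1) * logNorm y) +
        (nzTheta J'.1 (-y) : ℂ) * Complex.exp ((1 - s) * logNorm (-y))) - Complex.exp (s * logNorm y) := by
    intro y
    have h1 : Complex.exp ((1 - s) * logNorm (-y)) = Complex.exp ((s - 1) * logNorm y) := by
      rw [logNorm_neg]
      congr 1
      push_cast
      ring
    have h2 : Complex.exp ((s - 1) * logNorm y) = (rexp (-logNorm y) : ℂ) * Complex.exp (s * logNorm y) := by
      rw [Complex.ofReal_exp, ← Complex.exp_add]
      congr 1
      push_cast
      ring
    rw [hth, h1, h2]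
    push_cast
    ring
  have hneg : ∫ y in {y | logNorm y < 0}, (nzTheta J.1 y : ℂ) * Complex.exp (s * logNorm y)
      ∂(unitMeasure K) = c * (κ / (s - 1) + thetaUpper J'.1 (1 - s)) - κ / s := by
    simp_rw [hpt]
    have i4 : Integrable (fun y => Complex.exp ((s - 1) * logNorm y) +
        (nzTheta J'.1 (-y) : ℂ) * Complex.exp ((1 - s) * logNorm (-y)))
        ((unitMeasure K).restrict {y | logNorm y < 0}) := Integrable.add i1 i3
    rw [integral_sub (i4.const_mul _) i2, integral_const_mul, integral_add i1 i3, e1, e2, e3, thetaUpper]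
  rw [hneg, add_sub_assoc]
  rfl

end

noncomputable section

open Real Filter MeasureTheory Set Matrix NumberField
open scoped nonZeroDivisors

variable {K : Type} [Field K] [NumberField K]

theorem absNorm_unit_pos (J : (FractionalIdeal (𝓞 K)⁰ K)ˣ) : (0 : ℝ) < FractionalIdeal.absNorm J.1 := by
  have h0 := FractionalIdeal.absNorm_nonneg J.1
  have h1 : FractionalIdeal.absNorm J.1 ≠ 0 := by
    rw [Ne, FractionalIdeal.absNorm_eq_zero_iff]
    exact J.ne_zero
  exact_mod_cast lt_of_le_of_ne h0 h1.symm

variable (K) in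
def absDiscr : ℝ := |(discr K : ℝ)|

variable (K) in
theorem absDiscr_pos : 0 < absDiscr K := by
  have := discr_ne_zero K
  unfold absDiscr
  positivity

theorem absNorm_mul_absNorm_dual {J J' : (FractionalIdeal (𝓞 K)⁰ K)ˣ}
    (h : J'.1 = FractionalIdeal.dual ℤ ℚ J.1) :
    (FractionalIdeal.absNorm J.1 : ℝ) * FractionalIdeal.absNorm J'.1 * absDiscr K = 1 := by
  have h' : J.1 = FractionalIdeal.dual ℤ ℚ J'.1 := by rw [h, FractionalIdeal.dual_dual]
  have e1 : _ = (_ * √(absDiscr K))⁻¹ * _ * _ := (idealTheta_functional J 0).2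
  have e2 : _ = (_ * √(absDiscr K))⁻¹ * _ * _ := (idealTheta_functional J' 0).2
  rw [← h] at e1
  rw [← h'] at e2
  have hpos : 0 < idealTheta J.1 0 := by
    rw [idealTheta_eq_one_add]
    linarith [nzTheta_nonneg J.1 0]
  rw [neg_zero] at e1 e2
  have hz : logNorm (0 : InfinitePlace K → ℝ) = 0 := by simp [logNorm]
  rw [hz, neg_zero, Real.exp_zero, mul_one] at e1 e2
  rw [e2] at e1
  have hJ := absNorm_unit_pos J
  have hJ' := absNorm_unit_pos J'
  have hD := absDiscr_pos K
  have hs : √(absDiscr K) * √(absDiscr K) = absDiscr K := Real.mul_self_sqrt hD.le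
  have hs0 : 0 < √(absDiscr K) := Real.sqrt_pos.2 hD
  field_simp at e1
  nlinarith

def residuePart (κ : ℝ) (J : FractionalIdeal (𝓞 K)⁰ K) (s : ℂ) : ℂ :=
  (absDiscr K : ℂ) ^ (s / 2) * ((FractionalIdeal.absNorm J : ℝ) : ℂ) ^ s * (s * thetaUpper J s - κ)

theorem differentiable_residuePart (κ : ℝ) (J : (FractionalIdeal (𝓞 K)⁰ K)ˣ) :
    Differentiable ℂ (residuePart κ J.1) := by
  have h1 := differentiable_thetaUpper J
  have h2 : ((FractionalIdeal.absNorm J.1 : ℝ) : ℂ) ≠ 0 := by exact_mod_cast (absNorm_unit_pos J).ne'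
  have h3 : (absDiscr K : ℂ) ≠ 0 := by exact_mod_cast (absDiscr_pos K).ne'
  unfold residuePart
  refine ((Differentiable.const_cpow (by fun_prop) (Or.inl h3)).mul
    (Differentiable.const_cpow (by fun_prop) (Or.inl h2))).mul ?_
  exact (differentiable_id.mul h1).sub_const _

theorem norm_residuePart_le (κ : ℝ) (J : (FractionalIdeal (𝓞 K)⁰ K)ˣ) (R : ℝ) :
    ∃ C, 0 ≤ C ∧ ∀ s : ℂ, |s.re| ≤ R → ‖residuePart κ J.1 s‖ ≤ C * (1 + |s.im|) := by
  obtain ⟨C, hC⟩ := norm_thetaUpper_le J R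
  have hJ := absNorm_unit_pos J
  have hD := absDiscr_pos K
  set M := max 0 C
  set A := rexp (|Real.log (absDiscr K)| * R) * rexp (|Real.log (FractionalIdeal.absNorm J.1 : ℝ)| * R)
  refine ⟨A * ((R + 1) * M + |κ|) ⊔ 0, le_sup_right, fun s hs => ?_⟩
  have hR : 0 ≤ R := (abs_nonneg _).trans hs
  have h1 : ‖(absDiscr K : ℂ) ^ (s / 2)‖ ≤ rexp (|Real.log (absDiscr K)| * R) := by
    rw [Complex.norm_cpow_eq_rpow_re_of_pos hD, Real.rpow_def_of_pos hD]
    refine Real.exp_le_exp.2 ((le_abs_self _).trans ?_)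
    rw [abs_mul]
    gcongr
    rw [show s / 2 = s / ((2 : ℝ) : ℂ) by norm_num, Complex.div_ofReal_re, abs_div]
    rw [abs_two]
    linarith [abs_nonneg s.re]
  have h2 : ‖((FractionalIdeal.absNorm J.1 : ℝ) : ℂ) ^ s‖ ≤
      rexp (|Real.log (FractionalIdeal.absNorm J.1 : ℝ)| * R) := by
    rw [Complex.norm_cpow_eq_rpow_re_of_pos hJ, Real.rpow_def_of_pos hJ]
    refine Real.exp_le_exp.2 ((le_abs_self _).trans ?_)
    rw [abs_mul]
    gcongr
  have h3 : ‖s * thetaUpper J.1 s - κ‖ ≤ ((R + 1) * M + |κ|) * (1 + |s.im|) := by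
    have h4 : ‖thetaUpper J.1 s‖ ≤ M := (hC s ((le_abs_self _).trans hs)).trans (le_max_right _ _)
    have h5 : ‖s‖ ≤ R + |s.im| := (Complex.norm_le_abs_re_add_abs_im s).trans (by linarith)
    have hM : 0 ≤ M := le_max_left _ _
    have h6 : 0 ≤ |s.im| := abs_nonneg _
    calc _ ≤ ‖s * thetaUpper J.1 s‖ + ‖(κ : ℂ)‖ := norm_sub_le _ _
      _ ≤ (R + |s.im|) * M + |κ| := by
        rw [norm_mul, Complex.norm_real, Real.norm_eq_abs]
        gcongr
      _ ≤ _ := by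
        nlinarith [mul_nonneg (mul_nonneg hR h6) hM, mul_nonneg h6 (abs_nonneg κ)]
  calc _ ≤ A * (((R + 1) * M + |κ|) * (1 + |s.im|)) := by
        rw [residuePart, norm_mul, norm_mul]
        exact mul_le_mul (mul_le_mul h1 h2 (norm_nonneg _) (Real.exp_pos _).le) h3 (norm_nonneg _)
          (by positivity)
    _ ≤ _ := by
        rw [← mul_assoc]
        gcongr
        exact le_sup_left

theorem completed_term (J J' : (FractionalIdeal (𝓞 K)⁰ K)ˣ)
    (hJ : J'.1 = FractionalIdeal.dual ℤ ℚ J.1) {κ : NNReal}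
    (hκ : Measure.map logNorm (unitMeasure K) = κ • (volume : Measure ℝ)) {s : ℂ} (hs : 1 < s.re) :
    s * (s - 1) * (absDiscr K : ℂ) ^ (s / 2) * (((FractionalIdeal.absNorm J.1 : ℝ) : ℂ) ^ s *
      ∫ y, (unitWeight y * nzTheta J.1 y : ℂ) * Complex.exp (s * logNorm y)) =
    (s - 1) * residuePart κ J.1 s - s * residuePart κ J'.1 (1 - s) := by
  have h : _ = _ + ((((FractionalIdeal.absNorm J.1 : ℝ) * √(absDiscr K))⁻¹ : ℝ) : ℂ) * _ - _ :=
    integral_nzTheta_eq J J' hJ hκ hs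
  rw [integral_unitMeasure] at h
  simp_rw [← mul_assoc] at h
  rw [h]
  have hN := absNorm_unit_pos J
  have hN' := absNorm_unit_pos J'
  have hD := absDiscr_pos K
  have hs0 : s ≠ 0 := by rintro rfl; norm_num at hs
  have hs1 : s - 1 ≠ 0 := by
    intro h
    rw [sub_eq_zero.1 h] at hs
    norm_num at hs
  have hrel := absNorm_mul_absNorm_dual hJ
  set D := absDiscr K with hDdef
  set n : ℝ := (FractionalIdeal.absNorm J.1 : ℝ)
  set n' : ℝ := (FractionalIdeal.absNorm J'.1 : ℝ)
  have hn' : n' = (n * D)⁻¹ := by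
    field_simp
    linarith
  have hlog : Real.log n' = -Real.log n - Real.log D := by
    rw [hn', Real.log_inv, Real.log_mul hN.ne' hD.ne']
    ring
  have key : (D : ℂ) ^ (s / 2) * (n : ℂ) ^ s * (((n * √D)⁻¹ : ℝ) : ℂ) =
      (D : ℂ) ^ ((1 - s) / 2) * (n' : ℂ) ^ (1 - s) := by
    have hc : (n * √D)⁻¹ = rexp (-Real.log n - Real.log D / 2) := by
      rw [Real.exp_sub, Real.exp_neg, Real.exp_log hN, ← Real.log_sqrt hD.le,
        Real.exp_log (Real.sqrt_pos.2 hD), mul_inv, div_eq_mul_inv]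
    have e1 : ∀ {x : ℝ} (_ : 0 < x) (z : ℂ), (x : ℂ) ^ z = Complex.exp ((Real.log x : ℝ) * z) := by
      intro x hx z
      rw [Complex.cpow_def_of_ne_zero (by exact_mod_cast hx.ne'), Complex.ofReal_log hx.le]
    rw [hc, e1 hD, e1 hN, e1 hD, e1 hN', hlog, Complex.ofReal_exp, ← Complex.exp_add, ← Complex.exp_add,
      ← Complex.exp_add]
    congr 1
    push_cast
    ring
  simp only [residuePart]
  rw [← key]
  field_simp
  ring

variable (K) in
theorem exists_completed : ∃ X : ℂ → ℂ, Differentiable ℂ X ∧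
    (∀ s : ℂ, 1 < s.re → X s = s * (s - 1) * (absDiscr K : ℂ) ^ (s / 2) * gammaProd K s *
      ∑' B : {B : Ideal (𝓞 K) // B ≠ 0}, (Ideal.absNorm B.1 : ℂ) ^ (-s) ∧ X (1 - s) = X s) ∧
    ∀ R, ∃ C, ∀ s : ℂ, |s.re| ≤ R → ‖X s‖ ≤ C * (1 + |s.im|) ^ 2 := by
  obtain ⟨κ, hκ⟩ := exists_map_unitMeasure (K := K)
  obtain ⟨ι, _, I, I', hI, hI', hd, hd'⟩ := exists_classReps (K := K)
  have main : ∀ (I I' : ι → (FractionalIdeal (𝓞 K)⁰ K)ˣ),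
      (Function.Bijective fun c => (I c : (FractionalIdeal (𝓞 K)⁰ K)ˣ ⧸ (toPrincipalIdeal (𝓞 K) K).range)) →
      (∀ c, (I' c).1 = FractionalIdeal.dual ℤ ℚ (I c).1) → ∀ s : ℂ, 1 < s.re →
      ∑ c, ((s - 1) * residuePart κ (I c).1 s - s * residuePart κ (I' c).1 (1 - s)) =
        s * (s - 1) * (absDiscr K : ℂ) ^ (s / 2) * gammaProd K s *
      ∑' B : {B : Ideal (𝓞 K) // B ≠ 0}, (Ideal.absNorm B.1 : ℂ) ^ (-s) := by
    intro I I' hI hd s hs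
    rw [mul_assoc _ (gammaProd K s), ← sum_integral_nzTheta hI hs, Finset.mul_sum]
    exact Finset.sum_congr rfl fun c _ => (completed_term (I c) (I' c) (hd c) hκ hs).symm
  obtain ⟨X, hX⟩ : ∃ X : ℂ → ℂ, ∀ s,
      X s = ∑ c, ((s - 1) * residuePart κ (I c).1 s - s * residuePart κ (I' c).1 (1 - s)) := ⟨_, fun _ => rfl⟩
  refine ⟨X, ?_, fun s hs => ⟨?_, ?_⟩, fun R => ?_⟩
  · have h1 := fun c => differentiable_residuePart κ (I c)
    have h2 := fun c => differentiable_residuePart κ (I' c)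
    rw [funext hX]
    refine Differentiable.fun_sum fun c _ => ?_
    exact ((differentiable_id.sub_const 1).mul (h1 c)).sub
      (differentiable_id.mul ((h2 c).comp ((differentiable_const 1).sub differentiable_id)))
  · rw [hX]
    exact main I I' hI hd s hs
  · rw [hX, hX, main I I' hI hd s hs, ← main I' I hI' hd' s hs]
    refine Finset.sum_congr rfl fun c _ => ?_
    rw [sub_sub_cancel]
    ring
  · choose C hC0 hC using fun c => norm_residuePart_le κ (I c) R
    choose C' hC0' hC' using fun c => norm_residuePart_le κ (I' c) (R + 1)
    refine ⟨∑ c, ((R + 1) * C c + (R + 1) * C' c), fun s hs => ?_⟩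
    rw [hX, Finset.sum_mul]
    refine (norm_sum_le _ _).trans (Finset.sum_le_sum fun c _ => ?_)
    have hR : 0 ≤ R := (abs_nonneg _).trans hs
    have h1 := hC c s hs
    have h2 := hC' c (1 - s) (by
      rw [Complex.sub_re, Complex.one_re]
      have := abs_sub 1 s.re
      rw [abs_one] at this
      linarith)
    rw [Complex.sub_im, Complex.one_im, zero_sub, abs_neg] at h2
    have hb := abs_nonneg s.im
    have h5 : ‖s‖ ≤ R + |s.im| := (Complex.norm_le_abs_re_add_abs_im s).trans (by linarith)
    have h6 : ‖s - 1‖ ≤ (R + 1) * (1 + |s.im|) := (norm_sub_le _ _).trans (by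
      rw [norm_one]; nlinarith)
    have h7 : ‖s‖ ≤ (R + 1) * (1 + |s.im|) := by nlinarith
    calc _ ≤ ‖s - 1‖ * ‖residuePart κ (I c).1 s‖ + ‖s‖ * ‖residuePart κ (I' c).1 (1 - s)‖ := by
          rw [← norm_mul, ← norm_mul]
          exact norm_sub_le _ _
      _ ≤ ((R + 1) * (1 + |s.im|)) * (C c * (1 + |s.im|)) +
          ((R + 1) * (1 + |s.im|)) * (C' c * (1 + |s.im|)) := by gcongr
      _ = _ := by ring

end

noncomputable section

open Real Filter MeasureTheory Set Matrix NumberField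
open scoped nonZeroDivisors

variable {K : Type} [Field K] [NumberField K]

theorem norm_sin_le (z : ℂ) : ‖Complex.sin z‖ ≤ rexp |z.im| := by
  rw [Complex.sin, norm_div, norm_mul, Complex.norm_I, mul_one, Complex.norm_two]
  have h1 : ‖Complex.exp (-z * Complex.I)‖ ≤ rexp |z.im| := by
    rw [Complex.norm_exp]
    refine Real.exp_le_exp.2 ?_
    simp [le_abs_self]
  have h2 : ‖Complex.exp (z * Complex.I)‖ ≤ rexp |z.im| := by
    rw [Complex.norm_exp]
    refine Real.exp_le_exp.2 ?_
    simp [neg_le_abs]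
  linarith [norm_sub_le (Complex.exp (-z * Complex.I)) (Complex.exp (z * Complex.I))]

theorem norm_Gamma_le_Gamma_re {z : ℂ} (hz : 0 < z.re) : ‖Complex.Gamma z‖ ≤ Real.Gamma z.re := by
  rw [Complex.Gamma_eq_integral hz, Complex.GammaIntegral, Real.Gamma_eq_integral hz]
  refine (norm_integral_le_integral_norm _).trans (le_of_eq ?_)
  refine setIntegral_congr_fun measurableSet_Ioi fun x hx => ?_
  rw [norm_mul, Complex.norm_cpow_eq_rpow_re_of_pos hx, Complex.norm_real,
    Real.norm_of_nonneg (Real.exp_pos _).le]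
  simp

theorem exists_norm_Gamma_inv_le : ∃ C, 0 < C ∧ ∀ z : ℂ, -1 ≤ z.re → z.re ≤ 2 → 1 / 2 ≤ |z.im| →
    ‖(Complex.Gamma z)⁻¹‖ ≤ C * rexp (π * |z.im|) := by
  obtain ⟨M, hM⟩ : ∃ M, ∀ x ∈ Icc (1 / 2 : ℝ) 3, Real.Gamma x ≤ M := by
    have hc : ContinuousOn Real.Gamma (Icc (1 / 2 : ℝ) 3) := fun x hx =>
      (Real.differentiableAt_Gamma fun m => by
        have := hx.1
        have : (0 : ℝ) ≤ m := m.cast_nonneg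
        intro h
        linarith).continuousAt.continuousWithinAt
    obtain ⟨M, hM⟩ := isCompact_Icc.bddAbove_image hc
    exact ⟨M, fun x hx => hM ⟨x, hx, rfl⟩⟩
  have hM0 : 0 < M := lt_of_lt_of_le (Real.Gamma_pos_of_pos one_pos) (hM 1 (by norm_num))
  have h1 : ∀ z : ℂ, -2 ≤ z.re → z.re ≤ 1 / 2 → 1 / 2 ≤ |z.im| →
      ‖(Complex.Gamma z)⁻¹‖ ≤ M * rexp (π * |z.im|) := by
    intro z h1 h2 h3
    have hz : Complex.sin (π * z) ≠ 0 := by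
      intro h
      rw [Complex.sin_eq_zero_iff] at h
      obtain ⟨k, hk⟩ := h
      have := congrArg Complex.im hk
      simp [Real.pi_ne_zero] at this
      rw [this] at h3
      norm_num at h3
    have hG : Complex.Gamma z ≠ 0 := by
      refine Complex.Gamma_ne_zero fun m hm => ?_
      rw [hm] at h3
      norm_num at h3
    have h := Complex.Gamma_mul_Gamma_one_sub z
    have e : (Complex.Gamma z)⁻¹ = Complex.Gamma (1 - z) * Complex.sin (π * z) / π := by
      have hpi : (π : ℂ) ≠ 0 := by exact_mod_cast Real.pi_ne_zero
      rw [eq_div_iff hz] at h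
      rw [eq_div_iff hpi, inv_mul_eq_iff_eq_mul₀ hG]
      linear_combination -h
    have hG2 := norm_Gamma_le_Gamma_re (z := 1 - z) (by simp; linarith)
    have hG3 := hM (1 - z).re ⟨by simp; linarith, by simp; linarith⟩
    have hs := norm_sin_le (π * z)
    have him : |((π : ℂ) * z).im| = π * |z.im| := by
      simp [abs_mul, abs_of_pos Real.pi_pos]
    rw [him] at hs
    rw [e, norm_div, norm_mul, Complex.norm_real, Real.norm_of_nonneg Real.pi_pos.le]
    have : 1 ≤ π := by linarith [Real.pi_gt_three]
    exact (div_le_self (by positivity) this).trans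
      (mul_le_mul (hG2.trans hG3) hs (norm_nonneg _) hM0.le)
  have step : ∀ z : ℂ, 1 / 2 ≤ |z.im| → ‖(Complex.Gamma z)⁻¹‖ ≤ 2 * ‖(Complex.Gamma (z - 1))⁻¹‖ := by
    intro z hz
    have hz1 : z - 1 ≠ 0 := by
      intro h
      rw [sub_eq_zero.1 h] at hz
      norm_num at hz
    have h := Complex.Gamma_add_one (z - 1) hz1
    rw [sub_add_cancel] at h
    have h2 : 1 / 2 ≤ ‖z - 1‖ := hz.trans (by simpa using Complex.abs_im_le_norm (z - 1))
    rw [h, mul_inv, norm_mul, norm_inv]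
    gcongr
    exact (inv_le_comm₀ (by linarith) two_pos).2 (by linarith)
  refine ⟨4 * M, by positivity, fun z hz1 hz2 hz3 => ?_⟩
  have e1 := step z hz3
  have e2 := step (z - 1) (by simpa using hz3)
  have h4 : 0 < M * rexp (π * |z.im|) := by positivity
  have hc : -2 ≤ (z - 1).re := by simp; linarith
  have him1 : (z - 1).im = z.im := by simp
  have him2 : (z - 1 - 1).im = z.im := by simp
  rcases le_total z.re (1 / 2) with h | h
  · linarith [h1 z (by linarith) h hz3]
  rcases le_total z.re (3 / 2) with h' | h'
  · have := h1 (z - 1) hc (by simp; linarith) (by rwa [him1])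
    rw [him1] at this
    linarith
  · have := h1 (z - 1 - 1) (by simp; linarith) (by simp; linarith) (by rwa [him2])
    rw [him2] at this
    linarith

variable (K) in
def gammaProdInv (s : ℂ) : ℂ :=
  ∏ v : InfinitePlace K, (2 * ((π * v.mult : ℝ) : ℂ) ^ ((v.mult * s / 2) : ℂ) *
    (Complex.Gamma (v.mult * s / 2))⁻¹)

omit [NumberField K] in
theorem pi_mult_pos (v : InfinitePlace K) : (0 : ℝ) < π * v.mult := by
  have : (0 : ℝ) < v.mult := by exact_mod_cast v.mult_pos
  exact mul_pos Real.pi_pos this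

theorem differentiable_gammaProdInv : Differentiable ℂ (gammaProdInv K) := by
  unfold gammaProdInv
  refine Differentiable.fun_finsetProd fun v _ => ?_
  have hv := pi_mult_pos v
  refine ((Differentiable.const_cpow (by fun_prop) (Or.inl (by exact_mod_cast hv.ne'))).const_mul _).mul ?_
  exact Complex.differentiable_one_div_Gamma.comp (by fun_prop : Differentiable ℂ fun s : ℂ => (v.mult : ℂ) * s / 2)

theorem gammaProd_mul_inv {s : ℂ} (hs : 0 < s.re) : gammaProd K s * gammaProdInv K s = 1 := by
  rw [gammaProd, gammaProdInv, ← Finset.prod_mul_distrib]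
  refine Finset.prod_eq_one fun v _ => ?_
  have hv := pi_mult_pos v
  have hm : (0 : ℝ) < v.mult := by exact_mod_cast v.mult_pos
  have h1 : Complex.Gamma (v.mult * s / 2) ≠ 0 := by
    refine Complex.Gamma_ne_zero_of_re_pos ?_
    have : ((v.mult : ℂ) * s / 2).re = v.mult * s.re / 2 := by
      rw [show (v.mult : ℂ) * s / 2 = ((v.mult / 2 : ℝ) : ℂ) * s by push_cast; ring, Complex.re_ofReal_mul]
      ring
    rw [this]
    positivity
  have h2 : ((π * v.mult : ℝ) : ℂ) ^ ((v.mult * s / 2) : ℂ) ≠ 0 := by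
    rw [Ne, Complex.cpow_eq_zero_iff]
    exact fun h => hv.ne' (by exact_mod_cast h.1)
  rw [Complex.cpow_neg]
  field_simp

theorem gammaProdInv_zero : gammaProdInv K 0 = 0 := by
  obtain ⟨v⟩ := (inferInstance : Nonempty (InfinitePlace K))
  exact Finset.prod_eq_zero (Finset.mem_univ v) (by simp [Complex.Gamma_zero])

end

noncomputable section

open Real Filter MeasureTheory Set Matrix NumberField
open scoped nonZeroDivisors

variable {K : Type} [Field K] [NumberField K]

variable (K) in
/-- The Dirichlet series of the Dedekind zeta function. -/
def zetaSeries (s : ℂ) : ℂ :=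
  ∑' B : {B : Ideal (𝓞 K) // B ≠ 0}, (Ideal.absNorm B.1 : ℂ) ^ (-s)

variable (K) in
theorem exists_norm_gammaProdInv_le : ∃ C, 0 < C ∧ ∀ s : ℂ, -1 ≤ s.re → s.re ≤ 2 → 1 ≤ |s.im| →
    ‖gammaProdInv K s‖ ≤ C * rexp (C * |s.im|) := by
  obtain ⟨C, hC, h⟩ := exists_norm_Gamma_inv_le
  set N := Fintype.card (InfinitePlace K) with hN
  set M := max ((2 * (2 * π) ^ (2 : ℝ) * C) ^ N) (N * π) with hM
  have hM0 : 0 < M := lt_of_lt_of_le (by positivity) (le_max_left _ _)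
  refine ⟨M, hM0, fun s h1 h2 h3 => ?_⟩
  have key : ∀ v : InfinitePlace K, ‖2 * ((π * v.mult : ℝ) : ℂ) ^ ((v.mult * s / 2) : ℂ) *
    (Complex.Gamma (v.mult * s / 2))⁻¹‖ ≤ (2 * (2 * π) ^ (2 : ℝ) * C) * rexp (π * |s.im|) := by
    intro v
    have hm1 : (1 : ℝ) ≤ v.mult := by exact_mod_cast v.mult_pos
    have hm2 : (v.mult : ℝ) ≤ 2 := by
      have : v.mult ≤ 2 := by unfold InfinitePlace.mult; split_ifs <;> norm_num
      exact_mod_cast this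
    set m : ℝ := (v.mult : ℝ) with hm
    have e : ((v.mult : ℂ) * s / 2) = ((m / 2 : ℝ) : ℂ) * s := by rw [hm]; push_cast; ring
    have er : ((v.mult : ℂ) * s / 2).re = m / 2 * s.re := by rw [e, Complex.re_ofReal_mul]
    have ei : ((v.mult : ℂ) * s / 2).im = m / 2 * s.im := by rw [e, Complex.im_ofReal_mul]
    have ei' : |((v.mult : ℂ) * s / 2).im| = m / 2 * |s.im| := by
      rw [ei, abs_mul, abs_of_pos (by positivity)]
    have hg := h ((v.mult : ℂ) * s / 2) (by rw [er]; nlinarith) (by rw [er]; nlinarith)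
      (by rw [ei']; nlinarith)
    have hv : 0 < π * m := by positivity
    rw [norm_mul, norm_mul, Complex.norm_two, Complex.norm_cpow_eq_rpow_re_of_pos hv, er]
    have hp : (π * m) ^ (m / 2 * s.re) ≤ (2 * π) ^ (2 : ℝ) := by
      have : 1 ≤ π * m := by nlinarith [Real.pi_gt_three]
      refine (Real.rpow_le_rpow_of_exponent_le this (y := m / 2 * s.re) (z := 2) (by nlinarith)).trans ?_
      refine Real.rpow_le_rpow hv.le (by nlinarith [Real.pi_pos]) (by norm_num)
    have he : rexp (π * |((v.mult : ℂ) * s / 2).im|) ≤ rexp (π * |s.im|) := by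
      rw [ei']
      refine Real.exp_le_exp.2 ?_
      have := abs_nonneg s.im
      gcongr
      nlinarith
    calc _ ≤ 2 * (2 * π) ^ (2 : ℝ) * (C * rexp (π * |s.im|)) := by
          gcongr
          exact hg.trans (by gcongr)
      _ = _ := by ring
  rw [gammaProdInv, norm_prod]
  calc _ ≤ ∏ _v : InfinitePlace K, (2 * (2 * π) ^ (2 : ℝ) * C) * rexp (π * |s.im|) :=
        Finset.prod_le_prod (fun _ _ => norm_nonneg _) fun v _ => key v
    _ = (2 * (2 * π) ^ (2 : ℝ) * C) ^ N * rexp (N * π * |s.im|) := by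
        rw [Finset.prod_const, Finset.card_univ, ← hN, mul_pow, ← Real.exp_nat_mul]
        ring_nf
    _ ≤ _ := by
        gcongr
        · exact le_max_left _ _
        · exact le_max_right _ _

variable (K) in
theorem exists_entire : ∃ W : ℂ → ℂ, Differentiable ℂ W ∧
    (∀ s, 1 < s.re → W s = (s - 1) * zetaSeries K s) ∧
    (∀ s, 1 < s.re → ‖W (1 - s)‖ = ‖s‖ * ‖zetaSeries K s‖ * absDiscr K ^ (s.re - 1 / 2) *
      (‖gammaProd K s‖ * ‖gammaProdInv K (1 - s)‖)) ∧
    ∃ C, ∀ s, -1 ≤ s.re → s.re ≤ 2 → 1 ≤ |s.im| → ‖W s‖ ≤ C * rexp (C * |s.im|) := by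
  obtain ⟨X, hX, hX1, hX2⟩ := exists_completed K
  have hD := absDiscr_pos K
  have hD' : (absDiscr K : ℂ) ≠ 0 := by exact_mod_cast hD.ne'
  have hdiff : Differentiable ℂ fun s => X s * gammaProdInv K s := hX.mul differentiable_gammaProdInv
  set W : ℂ → ℂ := fun s => (absDiscr K : ℂ) ^ (-(s / 2)) *
    dslope (fun s => X s * gammaProdInv K s) 0 s with hW
  have hWs : ∀ s, s ≠ 0 → W s = (absDiscr K : ℂ) ^ (-(s / 2)) * (X s * gammaProdInv K s / s) := by
    intro s hs
    simp only [hW]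
    rw [dslope_of_ne _ hs, slope_def_field, gammaProdInv_zero]
    simp
  refine ⟨W, ?_, ?_, ?_, ?_⟩
  · refine (Differentiable.const_cpow (by fun_prop) (Or.inl hD')).mul ?_
    rw [← differentiableOn_univ]
    exact (Complex.differentiableOn_dslope univ_mem).2 hdiff.differentiableOn
  · intro s hs
    have hs0 : s ≠ 0 := by rintro rfl; norm_num at hs
    have hg := gammaProd_mul_inv (K := K) (s := s) (by linarith)
    have hp : (absDiscr K : ℂ) ^ (-(s / 2)) * (absDiscr K : ℂ) ^ (s / 2) = 1 := by
      rw [← Complex.cpow_add _ _ hD', neg_add_cancel, Complex.cpow_zero]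
    rw [hWs s hs0, (hX1 s hs).1]
    change _ = (s - 1) * ∑' B : {B : Ideal (𝓞 K) // B ≠ 0}, (Ideal.absNorm B.1 : ℂ) ^ (-s)
    set T := ∑' B : {B : Ideal (𝓞 K) // B ≠ 0}, (Ideal.absNorm B.1 : ℂ) ^ (-s)
    calc _ = (absDiscr K : ℂ) ^ (-(s / 2)) * (absDiscr K : ℂ) ^ (s / 2) *
          (gammaProd K s * gammaProdInv K s) * ((s - 1) * T) * (s / s) := by ring
      _ = _ := by rw [hg, hp, div_self hs0]; ring
  · intro s hs
    have hs0 : 1 - s ≠ 0 := by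
      intro h
      rw [← sub_eq_zero.1 h] at hs
      norm_num at hs
    rw [hWs _ hs0, (hX1 s hs).2, (hX1 s hs).1]
    have e : s * (s - 1) = -(s * (1 - s)) := by ring
    rw [e]
    simp only [norm_mul, norm_div, norm_neg]
    rw [Complex.norm_cpow_eq_rpow_re_of_pos hD, Complex.norm_cpow_eq_rpow_re_of_pos hD]
    have e1 : (s / 2).re = s.re / 2 := by simp
    have e2 : (-((1 - s) / 2)).re = (s.re - 1) / 2 := by simp; ring
    rw [e1, e2, show s.re - 1 / 2 = (s.re - 1) / 2 + s.re / 2 by ring, Real.rpow_add hD]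
    have hn : ‖1 - s‖ ≠ 0 := norm_ne_zero_iff.2 hs0
    rw [zetaSeries]
    field_simp
  · obtain ⟨C1, h1⟩ := hX2 2
    obtain ⟨C2, hC2, h2⟩ := exists_norm_gammaProdInv_le K
    set E := rexp |Real.log (absDiscr K)| with hE
    set C0 := E * (|C1| * 4 * C2) with hC0
    refine ⟨max C0 (2 + C2), fun s hs1 hs2 hs3 => ?_⟩
    have hs0 : s ≠ 0 := by
      rintro rfl
      norm_num at hs3
    have hn : 1 ≤ ‖s‖ := hs3.trans (Complex.abs_im_le_norm s)
    rw [hWs s hs0, norm_mul, norm_div, norm_mul, Complex.norm_cpow_eq_rpow_re_of_pos hD]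
    have b1 : absDiscr K ^ (-(s / 2)).re ≤ E := by
      rw [Real.rpow_def_of_pos hD, hE]
      refine Real.exp_le_exp.2 ((le_abs_self _).trans ?_)
      rw [abs_mul]
      refine mul_le_of_le_one_right (abs_nonneg _) ?_
      have : (-(s / 2)).re = -(s.re / 2) := by simp
      rw [this, abs_le]
      constructor <;> linarith
    have b2 : ‖X s‖ ≤ |C1| * 4 * rexp (2 * |s.im|) := by
      refine (h1 s (abs_le.2 ⟨by linarith, hs2⟩)).trans ?_
      have q : 1 + |s.im| ≤ 2 * rexp (|s.im|) := by
        linarith [Real.add_one_le_exp |s.im|, Real.exp_pos |s.im|]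
      have q2 : (1 + |s.im|) ^ 2 ≤ 4 * rexp (2 * |s.im|) := by
        rw [two_mul |s.im|, Real.exp_add]
        nlinarith [abs_nonneg s.im]
      calc _ ≤ |C1| * (1 + |s.im|) ^ 2 := by gcongr; exact le_abs_self _
        _ ≤ |C1| * (4 * rexp (2 * |s.im|)) := by gcongr
        _ = _ := by ring
    have b3 := h2 s hs1 hs2 hs3
    calc _ ≤ E * (‖X s‖ * ‖gammaProdInv K s‖) := by
          gcongr
          exact div_le_self (by positivity) hn
      _ ≤ E * ((|C1| * 4 * rexp (2 * |s.im|)) * (C2 * rexp (C2 * |s.im|))) := by gcongr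
      _ = C0 * rexp ((2 + C2) * |s.im|) := by rw [add_mul, Real.exp_add, hC0]; ring
      _ ≤ _ := by
          gcongr
          · exact le_max_left _ _
          · exact le_max_right _ _

end

noncomputable section

open Real Filter MeasureTheory Set Matrix NumberField
open scoped nonZeroDivisors

theorem sum_inv_sq_le_two (N : ℕ) : ∑ j ∈ Finset.range N, 1 / ((j : ℝ) + 1) ^ 2 ≤ 2 := by
  have h : ∀ N : ℕ, ∑ j ∈ Finset.range (N + 1), 1 / ((j : ℝ) + 1) ^ 2 ≤ 2 - 1 / ((N : ℝ) + 1) := by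
    intro N
    induction N with
    | zero => norm_num
    | succ N ih =>
      rw [Finset.sum_range_succ]
      have : 1 / (((N + 1 : ℕ) : ℝ) + 1) ^ 2 ≤ 1 / ((N : ℝ) + 1) - 1 / (((N + 1 : ℕ) : ℝ) + 1) := by
        push_cast
        have hN : (0 : ℝ) ≤ N := N.cast_nonneg
        rw [div_sub_div _ _ (by positivity) (by positivity), div_le_div_iff₀ (by positivity) (by positivity)]
        nlinarith
      linarith
  cases N with
  | zero => norm_num
  | succ N =>
    refine (h N).trans ?_
    have : (0 : ℝ) ≤ 1 / ((N : ℝ) + 1) := by positivity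
    linarith

theorem factor_le {ε x y : ℝ} (hε : 0 < ε) (hε1 : ε ≤ 1) (hx : 0 < x) :
    (x ^ 2 + y ^ 2) / ((x + ε) ^ 2 + y ^ 2) * ((x + 1) ^ 2 + y ^ 2) ^ ε ≤
      (x ^ 2 + y ^ 2) ^ ε * rexp (ε * (1 / x ^ 2)) := by
  have hA : 0 < x ^ 2 + y ^ 2 := by positivity
  have hC : 0 < (x + ε) ^ 2 + y ^ 2 := by positivity
  have hB : ((x + 1) ^ 2 + y ^ 2) = (x ^ 2 + y ^ 2) * (1 + (2 * x + 1) / (x ^ 2 + y ^ 2)) := by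
    field_simp
    ring
  have hu : 0 ≤ (2 * x + 1) / (x ^ 2 + y ^ 2) := by positivity
  have hb := rpow_one_add_le_one_add_mul_self (s := (2 * x + 1) / (x ^ 2 + y ^ 2)) (p := ε)
    (by linarith) hε.le hε1
  rw [hB, Real.mul_rpow hA.le (by positivity)]
  have h1 : (x ^ 2 + y ^ 2) / ((x + ε) ^ 2 + y ^ 2) * (1 + ε * ((2 * x + 1) / (x ^ 2 + y ^ 2))) ≤
      1 + ε * (1 / x ^ 2) := by
    have e : (x ^ 2 + y ^ 2) / ((x + ε) ^ 2 + y ^ 2) * (1 + ε * ((2 * x + 1) / (x ^ 2 + y ^ 2))) =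
      ((x ^ 2 + y ^ 2) + ε * (2 * x + 1)) / ((x + ε) ^ 2 + y ^ 2) := by
      field_simp
    rw [e, div_le_iff₀ hC]
    have e2 : ε * (1 / x ^ 2) * ((x + ε) ^ 2 + y ^ 2) ≥ ε := by
      have : 1 ≤ 1 / x ^ 2 * ((x + ε) ^ 2 + y ^ 2) := by
        rw [one_div, ← div_eq_inv_mul, one_le_div (by positivity)]
        nlinarith [sq_nonneg y]
      nlinarith
    nlinarith
  have h2 := Real.add_one_le_exp (ε * (1 / x ^ 2))
  calc _ = (x ^ 2 + y ^ 2) ^ ε * ((x ^ 2 + y ^ 2) / ((x + ε) ^ 2 + y ^ 2) *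
          (1 + (2 * x + 1) / (x ^ 2 + y ^ 2)) ^ ε) := by ring
    _ ≤ (x ^ 2 + y ^ 2) ^ ε * ((x ^ 2 + y ^ 2) / ((x + ε) ^ 2 + y ^ 2) *
          (1 + ε * ((2 * x + 1) / (x ^ 2 + y ^ 2)))) := by gcongr
    _ ≤ _ := by gcongr; linarith

theorem prod_factor_le {ε y : ℝ} (hε : 0 < ε) (hε1 : ε ≤ 1) (N : ℕ) :
    (∏ j ∈ Finset.range N, (((j : ℝ) + 1) ^ 2 + y ^ 2) / (((j : ℝ) + 1 + ε) ^ 2 + y ^ 2)) *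
      (((N : ℝ) + 1) ^ 2 + y ^ 2) ^ ε ≤
      (1 + y ^ 2) ^ ε * rexp (ε * ∑ j ∈ Finset.range N, 1 / ((j : ℝ) + 1) ^ 2) := by
  induction N with
  | zero => simp
  | succ N ih =>
    rw [Finset.prod_range_succ, Finset.sum_range_succ, mul_add ε, Real.exp_add]
    have h := factor_le (y := y) hε hε1 (x := (N : ℝ) + 1) (by positivity)
    push_cast
    set P := ∏ j ∈ Finset.range N, (((j : ℝ) + 1) ^ 2 + y ^ 2) / (((j : ℝ) + 1 + ε) ^ 2 + y ^ 2)
    have hP : 0 ≤ P := Finset.prod_nonneg fun j _ => by positivity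
    calc _ = P * ((((N : ℝ) + 1) ^ 2 + y ^ 2) / (((N : ℝ) + 1 + ε) ^ 2 + y ^ 2) *
            (((N : ℝ) + 1 + 1) ^ 2 + y ^ 2) ^ ε) := by ring
      _ ≤ P * ((((N : ℝ) + 1) ^ 2 + y ^ 2) ^ ε * rexp (ε * (1 / ((N : ℝ) + 1) ^ 2))) := by gcongr
      _ = P * (((N : ℝ) + 1) ^ 2 + y ^ 2) ^ ε * rexp (ε * (1 / ((N : ℝ) + 1) ^ 2)) := by ring
      _ ≤ _ := by
        rw [← mul_assoc]
        gcongr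

theorem norm_sq_GammaSeq {x y : ℝ} {n : ℕ} (hn : 0 < n) :
    ‖Complex.GammaSeq (1 + x + y * Complex.I) n‖ ^ 2 =
      ((n : ℝ) ^ 2) ^ (1 + x) * (n.factorial : ℝ) ^ 2 /
        ∏ j ∈ Finset.range (n + 1), (((j : ℝ) + 1 + x) ^ 2 + y ^ 2) := by
  have hn' : (0 : ℝ) < n := by exact_mod_cast hn
  rw [Complex.GammaSeq, norm_div, norm_mul, norm_prod, div_pow, mul_pow, ← Finset.prod_pow]
  have e1 : ‖(n : ℂ) ^ (1 + x + y * Complex.I : ℂ)‖ ^ 2 = ((n : ℝ) ^ 2) ^ (1 + x) := by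
    rw [show (n : ℂ) = ((n : ℝ) : ℂ) by simp, Complex.norm_cpow_eq_rpow_re_of_pos hn']
    have : (1 + x + y * Complex.I : ℂ).re = 1 + x := by simp
    rw [this, ← Real.rpow_natCast, ← Real.rpow_mul hn'.le, ← Real.rpow_natCast, ← Real.rpow_mul hn'.le,
      mul_comm]
  rw [e1, Complex.norm_natCast]
  congr 1
  refine Finset.prod_congr rfl fun j _ => ?_
  rw [← Complex.normSq_eq_norm_sq, Complex.normSq_apply]
  simp
  ring

theorem norm_sq_Gamma_le {ε y : ℝ} (hε : 0 < ε) (hε1 : ε ≤ 1) :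
    ‖Complex.Gamma (1 + ε + y * Complex.I)‖ ^ 2 ≤
      ‖Complex.Gamma (1 + y * Complex.I)‖ ^ 2 * ((1 + y ^ 2) ^ ε * rexp (2 * ε)) := by
  have t1 := ((Complex.GammaSeq_tendsto_Gamma (1 + ε + y * Complex.I)).norm).pow 2
  have t2 := (((Complex.GammaSeq_tendsto_Gamma (1 + y * Complex.I)).norm).pow 2).mul_const
    ((1 + y ^ 2) ^ ε * rexp (2 * ε))
  refine le_of_tendsto_of_tendsto t1 t2 ?_
  filter_upwards [eventually_gt_atTop 0] with n hn
  have hn' : (0 : ℝ) < n := by exact_mod_cast hn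
  have e0 := norm_sq_GammaSeq (x := 0) (y := y) hn
  simp only [Complex.ofReal_zero, add_zero] at e0
  rw [e0, norm_sq_GammaSeq hn, Real.rpow_add (by positivity), Real.rpow_one]
  have h := prod_factor_le (y := y) hε hε1 (n + 1)
  rw [Finset.prod_div_distrib] at h
  set P0 := ∏ j ∈ Finset.range (n + 1), (((j : ℝ) + 1) ^ 2 + y ^ 2)
  set P1 := ∏ j ∈ Finset.range (n + 1), (((j : ℝ) + 1 + ε) ^ 2 + y ^ 2)
  have hP0 : 0 < P0 := Finset.prod_pos fun j _ => by positivity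
  have hP1 : 0 < P1 := Finset.prod_pos fun j _ => by positivity
  have hb : ((n : ℝ) ^ 2) ^ ε ≤ ((((n + 1 : ℕ) : ℝ) + 1) ^ 2 + y ^ 2) ^ ε := by
    refine Real.rpow_le_rpow (by positivity) ?_ hε.le
    push_cast
    nlinarith [sq_nonneg y]
  have h3 : P0 / P1 * ((n : ℝ) ^ 2) ^ ε ≤ (1 + y ^ 2) ^ ε * rexp (2 * ε) := by
    refine (mul_le_mul_of_nonneg_left hb (by positivity)).trans (h.trans ?_)
    rw [mul_comm 2 ε]
    gcongr
    exact sum_inv_sq_le_two _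
  calc _ = (n : ℝ) ^ 2 * (n.factorial : ℝ) ^ 2 / P0 * (P0 / P1 * ((n : ℝ) ^ 2) ^ ε) := by
        field_simp
    _ ≤ _ := by gcongr

theorem norm_sq_Gamma_one_add_I (y : ℝ) :
    ‖Complex.Gamma (1 + y * Complex.I)‖ ^ 2 * Real.sinh (π * y) = π * y := by
  rcases eq_or_ne y 0 with rfl | hy
  · simp
  have hz : (y * Complex.I : ℂ) ≠ 0 := by simp [hy]
  have h1 := Complex.Gamma_mul_Gamma_one_sub (y * Complex.I)
  have h2 := Complex.Gamma_add_one _ hz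
  have h3 : Complex.Gamma (1 - y * Complex.I) = (starRingEnd ℂ) (Complex.Gamma (1 + y * Complex.I)) := by
    rw [← Complex.Gamma_conj]
    simp [sub_eq_add_neg]
  have hs : Real.sinh (π * y) ≠ 0 := by
    rw [Ne, Real.sinh_eq_zero]
    exact mul_ne_zero Real.pi_ne_zero hy
  have e : Complex.sin (π * (y * Complex.I)) = Real.sinh (π * y) * Complex.I := by
    rw [← mul_assoc, Complex.sin_mul_I]
    push_cast
    rfl
  have hs' : ((Real.sinh (π * y) : ℝ) : ℂ) * Complex.I ≠ 0 :=
    mul_ne_zero (by exact_mod_cast hs) Complex.I_ne_zero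
  rw [e, h3, eq_div_iff hs'] at h1
  have h4 : Complex.Gamma (1 + y * Complex.I) * (starRingEnd ℂ) (Complex.Gamma (1 + y * Complex.I)) *
      (Real.sinh (π * y) : ℝ) = π * y := by
    rw [add_comm] at h2
    have hI : Complex.I ≠ 0 := Complex.I_ne_zero
    refine mul_right_cancel₀ hI ?_
    nth_rewrite 1 [h2]
    linear_combination (y * Complex.I) * h1
  rw [Complex.mul_conj, Complex.normSq_eq_norm_sq] at h4
  exact_mod_cast h4

theorem norm_sq_Gamma_mul_cosh_le (y : ℝ) :
    ‖Complex.Gamma (1 + y * Complex.I)‖ ^ 2 ≤ 1 ∧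
    ‖Complex.Gamma (1 + y * Complex.I)‖ ^ 2 * Real.cosh (π * y) ≤ 1 + π * |y| := by
  have h := norm_sq_Gamma_one_add_I y
  rcases eq_or_ne y 0 with rfl | hy
  · simp [Complex.Gamma_one]
  set g := ‖Complex.Gamma (1 + y * Complex.I)‖ ^ 2
  have hw : |π * y| = π * |y| := by rw [abs_mul, abs_of_pos Real.pi_pos]
  set w := π * |y| with hwd
  have hwp : 0 < w := mul_pos Real.pi_pos (abs_pos.2 hy)
  have h' : g * Real.sinh w = w := by
    rcases abs_cases y with ⟨e, _⟩ | ⟨e, _⟩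
    · rw [hwd, e, h]
    · rw [hwd, e, mul_neg, Real.sinh_neg]
      linarith
  have hc : Real.cosh (π * y) = Real.cosh w := by rw [← Real.cosh_abs, hw]
  have hsp : 0 < Real.sinh w := Real.sinh_pos_iff.2 hwp
  have hs := (Real.self_le_sinh_iff.2 hwp.le)
  have hg : g = w / Real.sinh w := by rw [eq_div_iff hsp.ne']; exact h'
  rw [hc, hg]
  refine ⟨(div_le_one hsp).2 hs, ?_⟩
  rw [div_mul_eq_mul_div, div_le_iff₀ hsp]
  have e1 := Real.cosh_sub_sinh w
  have e2 : rexp (-w) ≤ 1 := Real.exp_le_one_iff.2 (by linarith)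
  nlinarith

theorem norm_sin_le_cosh (z : ℂ) : ‖Complex.sin z‖ ≤ Real.cosh z.im := by
  rw [Complex.sin, norm_div, norm_mul, Complex.norm_I, mul_one, Complex.norm_two, Real.cosh_eq]
  have h1 : ‖Complex.exp (-z * Complex.I)‖ = rexp z.im := by
    rw [Complex.norm_exp]
    simp
  have h2 : ‖Complex.exp (z * Complex.I)‖ = rexp (-z.im) := by
    rw [Complex.norm_exp]
    simp
  have := norm_sub_le (Complex.exp (-z * Complex.I)) (Complex.exp (z * Complex.I))
  rw [h1, h2] at this
  linarith

end

noncomputable section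

open Real Filter MeasureTheory Set Matrix NumberField
open scoped nonZeroDivisors

theorem norm_Gamma_inv_le {z : ℂ} (hz : z.re < 0) :
    ‖(Complex.Gamma z)⁻¹‖ ≤ ‖Complex.Gamma (1 - z)‖ * Real.cosh (π * z.im) / π := by
  by_cases hG : Complex.Gamma z = 0
  · rw [hG, _root_.inv_zero, norm_zero]
    have := Real.pi_pos
    have := Real.cosh_pos (π * z.im)
    positivity
  have hs : Complex.sin (π * z) ≠ 0 := by
    intro h
    obtain ⟨k, hk⟩ := Complex.sin_eq_zero_iff.1 h
    have hpi : (π : ℂ) ≠ 0 := by exact_mod_cast Real.pi_ne_zero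
    have hzk : z = k := mul_left_cancel₀ hpi (by rw [hk, mul_comm])
    have hk0 : k < 0 := by
      rw [hzk, Complex.intCast_re] at hz
      exact_mod_cast hz
    obtain ⟨m, hm⟩ := Int.eq_ofNat_of_zero_le (show 0 ≤ -k by omega)
    refine hG ((Complex.Gamma_eq_zero_iff z).2 ⟨m, ?_⟩)
    rw [hzk, show k = -(m : ℤ) by simpa using congrArg Neg.neg hm]
    push_cast
    rfl
  have h := Complex.Gamma_mul_Gamma_one_sub z
  have hpi : (π : ℂ) ≠ 0 := by exact_mod_cast Real.pi_ne_zero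
  have e : (Complex.Gamma z)⁻¹ = Complex.Gamma (1 - z) * Complex.sin (π * z) / π := by
    rw [eq_div_iff hs] at h
    rw [eq_div_iff hpi, inv_mul_eq_iff_eq_mul₀ hG]
    linear_combination -h
  have h2 := norm_sin_le_cosh (π * z)
  rw [Complex.im_ofReal_mul] at h2
  rw [e, norm_div, norm_mul, Complex.norm_real, Real.norm_of_nonneg Real.pi_pos.le]
  have := Real.pi_pos
  gcongr

theorem real_place_le {ε y : ℝ} (hε : 0 < ε) (hε1 : ε ≤ 1) :
    (π ^ (-(1 / 2 + ε)) * (‖Complex.Gamma ((1 + ε + y * Complex.I) / 2)‖ *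
      ‖(Complex.Gamma ((1 - (1 + ε + y * Complex.I)) / 2))⁻¹‖)) ^ 2 ≤
      (1 + |y|) / (2 * π) * ((1 + y ^ 2) ^ ε * rexp (2 * ε)) := by
  have hpi := Real.pi_pos
  set s : ℂ := 1 + ε + y * Complex.I with hs
  have hre : ((1 - s) / 2).re = -ε / 2 := by simp [hs]
  have him : ((1 - s) / 2).im = -(y / 2) := by simp [hs]; ring
  have h1 := norm_Gamma_inv_le (z := (1 - s) / 2) (by rw [hre]; linarith)
  rw [him, mul_neg, Real.cosh_neg, show 1 - (1 - s) / 2 = s / 2 + 1 / 2 by ring] at h1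
  have h2 := congrArg norm (Complex.Gamma_mul_Gamma_add_half (s / 2))
  rw [norm_mul, norm_mul, norm_mul, show 2 * (s / 2) = s by ring, Complex.norm_real,
    Real.norm_of_nonneg (Real.sqrt_nonneg _)] at h2
  have h3 : ‖(2 : ℂ) ^ (1 - s)‖ ≤ 1 := by
    rw [show (2 : ℂ) = ((2 : ℝ) : ℂ) by simp, Complex.norm_cpow_eq_rpow_re_of_pos two_pos]
    refine Real.rpow_le_one_of_one_le_of_nonpos (by norm_num) ?_
    simp [hs, hε.le]
  have h4 : π ^ (-(1 / 2 + ε)) * √π ≤ 1 := by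
    rw [Real.sqrt_eq_rpow, ← Real.rpow_add hpi]
    exact Real.rpow_le_one_of_one_le_of_nonpos (by linarith [Real.pi_gt_three]) (by linarith)
  have hc := Real.cosh_pos (π * (y / 2))
  have main : π ^ (-(1 / 2 + ε)) * (‖Complex.Gamma (s / 2)‖ * ‖(Complex.Gamma ((1 - s) / 2))⁻¹‖) ≤
      ‖Complex.Gamma s‖ * Real.cosh (π * (y / 2)) / π := by
    calc _ ≤ π ^ (-(1 / 2 + ε)) * (‖Complex.Gamma (s / 2)‖ *
          (‖Complex.Gamma (s / 2 + 1 / 2)‖ * Real.cosh (π * (y / 2)) / π)) := by gcongr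
      _ = π ^ (-(1 / 2 + ε)) * (‖Complex.Gamma (s / 2)‖ * ‖Complex.Gamma (s / 2 + 1 / 2)‖) *
          Real.cosh (π * (y / 2)) / π := by ring
      _ = (π ^ (-(1 / 2 + ε)) * √π) * ‖(2 : ℂ) ^ (1 - s)‖ * ‖Complex.Gamma s‖ *
          Real.cosh (π * (y / 2)) / π := by rw [h2]; ring
      _ ≤ 1 * 1 * ‖Complex.Gamma s‖ * Real.cosh (π * (y / 2)) / π := by gcongr
      _ = _ := by ring
  have hG := norm_sq_Gamma_le (y := y) hε hε1
  obtain ⟨g1, g2⟩ := norm_sq_Gamma_mul_cosh_le y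
  set g := ‖Complex.Gamma (1 + y * Complex.I)‖ ^ 2
  set G := (1 + y ^ 2) ^ ε * rexp (2 * ε)
  have hGp : 0 < G := by positivity
  have hcc : Real.cosh (π * (y / 2)) ^ 2 = (1 + Real.cosh (π * y)) / 2 := by
    have := Real.cosh_sq (π * (y / 2))
    have h5 := Real.cosh_two_mul (π * (y / 2))
    rw [show 2 * (π * (y / 2)) = π * y by ring] at h5
    linarith
  calc _ ≤ (‖Complex.Gamma s‖ * Real.cosh (π * (y / 2)) / π) ^ 2 := by gcongr
    _ = ‖Complex.Gamma s‖ ^ 2 * ((1 + Real.cosh (π * y)) / 2) / π ^ 2 := by rw [← hcc]; ring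
    _ ≤ (g * G) * ((1 + Real.cosh (π * y)) / 2) / π ^ 2 := by
        have := Real.cosh_pos (π * y)
        gcongr
    _ = (g + g * Real.cosh (π * y)) * G / (2 * π ^ 2) := by ring
    _ ≤ (π * (1 + |y|)) * G / (2 * π ^ 2) := by
        gcongr
        linarith [Real.pi_gt_three]
    _ = _ := by field_simp

theorem complex_place_le {ε y : ℝ} (hε : 0 < ε) (hε1 : ε ≤ 1) :
    (π * 2) ^ (-(1 + 2 * ε)) * (‖Complex.Gamma (1 + ε + y * Complex.I)‖ *
      ‖(Complex.Gamma (1 - (1 + ε + y * Complex.I)))⁻¹‖) ≤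
      (1 + |y|) / (2 * π) * ((1 + y ^ 2) ^ ε * rexp (2 * ε)) := by
  have hpi := Real.pi_pos
  set s : ℂ := 1 + ε + y * Complex.I with hs
  have hre : (1 - s).re = -ε := by simp [hs]
  have him : (1 - s).im = -y := by simp [hs]
  have h1 := norm_Gamma_inv_le (z := 1 - s) (by rw [hre]; linarith)
  rw [him, mul_neg, Real.cosh_neg, show 1 - (1 - s) = s by ring] at h1
  have h4 : (π * 2) ^ (-(1 + 2 * ε)) ≤ (π * 2)⁻¹ := by
    rw [← Real.rpow_neg_one]
    exact Real.rpow_le_rpow_of_exponent_le (by linarith [Real.pi_gt_three]) (by linarith)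
  have hG := norm_sq_Gamma_le (y := y) hε hε1
  obtain ⟨g1, g2⟩ := norm_sq_Gamma_mul_cosh_le y
  set g := ‖Complex.Gamma (1 + y * Complex.I)‖ ^ 2
  set G := (1 + y ^ 2) ^ ε * rexp (2 * ε)
  have hGp : 0 < G := by positivity
  have hc := Real.cosh_pos (π * y)
  calc _ ≤ (π * 2)⁻¹ * (‖Complex.Gamma s‖ * (‖Complex.Gamma s‖ * Real.cosh (π * y) / π)) := by gcongr
    _ = (π * 2)⁻¹ * (‖Complex.Gamma s‖ ^ 2 * Real.cosh (π * y) / π) := by ring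
    _ ≤ (π * 2)⁻¹ * (g * G * Real.cosh (π * y) / π) := by gcongr
    _ = (π * 2)⁻¹ * (g * Real.cosh (π * y) * G / π) := by ring
    _ ≤ (π * 2)⁻¹ * ((π * (1 + |y|)) * G / π) := by
        have : g * Real.cosh (π * y) ≤ π * (1 + |y|) := by linarith [Real.pi_gt_three]
        gcongr
    _ = _ := by field_simp

variable {K : Type} [Field K] [NumberField K]

variable (K) in
theorem norm_gammaProd_mul_gammaProdInv_sq_le {ε y : ℝ} (hε : 0 < ε) (hε1 : ε ≤ 1) :
    (‖gammaProd K (1 + ε + y * Complex.I)‖ * ‖gammaProdInv K (1 - (1 + ε + y * Complex.I))‖) ^ 2 ≤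
      ((1 + |y|) / (2 * π) * ((1 + y ^ 2) ^ ε * rexp (2 * ε))) ^ (Module.finrank ℚ K) := by
  have hpi := Real.pi_pos
  have hr := real_place_le (y := y) hε hε1
  have hc := complex_place_le (y := y) hε hε1
  set s : ℂ := 1 + ε + y * Complex.I with hs
  set Q := (1 + |y|) / (2 * π) * ((1 + y ^ 2) ^ ε * rexp (2 * ε))
  have hre : s.re = 1 + ε := by simp [hs]
  have hQ : 0 < Q := by positivity
  rw [← NumberField.InfinitePlace.sum_mult_eq, ← Finset.prod_pow_eq_pow_sum, gammaProd, gammaProdInv,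
    norm_prod, norm_prod, ← Finset.prod_mul_distrib, ← Finset.prod_pow]
  refine Finset.prod_le_prod (fun v _ => by positivity) fun v _ => ?_
  have hv := pi_mult_pos v
  have e1 : (-(v.mult * s / 2 : ℂ)).re = -(v.mult * (1 + ε) / 2) := by
    rw [show (v.mult * s / 2 : ℂ) = ((v.mult / 2 : ℝ) : ℂ) * s by push_cast; ring, Complex.neg_re,
      Complex.re_ofReal_mul, hre]
    ring
  have e2 : (v.mult * (1 - s) / 2 : ℂ).re = -(v.mult * ε / 2) := by
    rw [show (v.mult * (1 - s) / 2 : ℂ) = ((v.mult / 2 : ℝ) : ℂ) * (1 - s) by push_cast; ring,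
      Complex.re_ofReal_mul, Complex.sub_re, hre, Complex.one_re]
    ring
  have e : ‖1 / 2 * ((π * v.mult : ℝ) : ℂ) ^ (-(v.mult * s / 2 : ℂ)) * Complex.Gamma (v.mult * s / 2)‖ *
      ‖2 * ((π * v.mult : ℝ) : ℂ) ^ (v.mult * (1 - s) / 2 : ℂ) * (Complex.Gamma (v.mult * (1 - s) / 2))⁻¹‖ =
      (π * v.mult) ^ (-(v.mult * (1 / 2 + ε) : ℝ)) * (‖Complex.Gamma (v.mult * s / 2)‖ *
        ‖(Complex.Gamma (v.mult * (1 - s) / 2))⁻¹‖) := by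
    rw [norm_mul, norm_mul, norm_mul, norm_mul, Complex.norm_cpow_eq_rpow_re_of_pos hv,
      Complex.norm_cpow_eq_rpow_re_of_pos hv, e1, e2,
      show (-(v.mult * (1 / 2 + ε) : ℝ)) = -(v.mult * (1 + ε) / 2) + -(v.mult * ε / 2) by ring,
      Real.rpow_add hv]
    simp only [norm_div, norm_one, Complex.norm_two]
    ring
  rw [e]
  have hm : v.mult = 1 ∨ v.mult = 2 := by
    unfold InfinitePlace.mult; split_ifs <;> simp
  rcases hm with h | h
  · rw [h]
    simpa using hr
  · rw [h]
    have hc' := pow_le_pow_left₀ (by positivity) hc 2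
    rw [show ((2 : ℕ) : ℂ) * s / 2 = s by push_cast; ring,
      show ((2 : ℕ) : ℂ) * (1 - s) / 2 = 1 - s by push_cast; ring,
      show -(((2 : ℕ) : ℝ) * (1 / 2 + ε)) = -(1 + 2 * ε) by push_cast; ring]
    exact_mod_cast hc'

end

noncomputable section

open Real Filter MeasureTheory Set Matrix NumberField
open scoped nonZeroDivisors

variable {K : Type} [Field K] [NumberField K]

/-- The summand `N(I)^{-s}` on nonzero ideals. -/
def normTerm (s : ℂ) (I : {B : Ideal (𝓞 K) // B ≠ 0}) : ℂ := (Ideal.absNorm I.1 : ℂ) ^ (-s)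

/-- Multiplication of a nonzero ideal by a prime ideal. -/
def primeMul (q : {p : Ideal (𝓞 K) // Prime p}) (I : {B : Ideal (𝓞 K) // B ≠ 0}) :
    {B : Ideal (𝓞 K) // B ≠ 0} := ⟨q.1 * I.1, mul_ne_zero q.2.ne_zero I.2⟩

theorem normTerm_primeMul (s : ℂ) (q : {p : Ideal (𝓞 K) // Prime p})
    (I : {B : Ideal (𝓞 K) // B ≠ 0}) :
    normTerm s (primeMul q I) = normTerm s ⟨q.1, q.2.ne_zero⟩ * normTerm s I := by
  simp only [normTerm, primeMul, map_mul, Nat.cast_mul]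
  exact Complex.natCast_mul_natCast_cpow _ _ _

theorem primeMul_injective (q : {p : Ideal (𝓞 K) // Prime p}) : Function.Injective (primeMul q) := by
  intro I J h
  exact Subtype.ext (mul_left_cancel₀ q.2.ne_zero (congrArg Subtype.val h))

theorem Prime.eq_of_dvd_ideal {p q : Ideal (𝓞 K)} (hp : Prime p) (hq : Prime q) (h : p ∣ q) : p = q :=
  associated_iff_eq.1 (hp.associated_of_dvd hq h)

open Classical in
theorem tsum_sieve {s : ℂ} (hs : 1 < s.re) (S : Finset {p : Ideal (𝓞 K) // Prime p}) :
    ∑' I : {B : Ideal (𝓞 K) // B ≠ 0}, (if ∀ q ∈ S, ¬ q.1 ∣ I.1 then normTerm s I else 0) =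
      (∏ q ∈ S, (1 - normTerm s ⟨q.1, q.2.ne_zero⟩)) * zetaSeries K s := by
  have hsum : Summable fun I : {B : Ideal (𝓞 K) // B ≠ 0} => normTerm s I :=
    summable_absNorm_cpow hs
  have hS : ∀ (P : {B : Ideal (𝓞 K) // B ≠ 0} → Prop) [DecidablePred P],
      Summable fun I => (if P I then normTerm s I else 0) := fun P _ => by
    refine (hsum.norm).of_norm_bounded fun I => ?_
    split_ifs <;> simp
  induction S using Finset.induction_on with
  | empty => simp [zetaSeries, normTerm]
  | insert q S hq ih =>
    rw [Finset.prod_insert hq, mul_assoc, ← ih, sub_mul, one_mul]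
    have h1 : normTerm s ⟨q.1, q.2.ne_zero⟩ *
        ∑' I : {B : Ideal (𝓞 K) // B ≠ 0}, (if ∀ q ∈ S, ¬ q.1 ∣ I.1 then normTerm s I else 0) =
        ∑' I : {B : Ideal (𝓞 K) // B ≠ 0},
          (if (∀ q ∈ S, ¬ q.1 ∣ I.1) ∧ q.1 ∣ I.1 then normTerm s I else 0) := by
      rw [← tsum_mul_left, ← (primeMul_injective q).tsum_eq (f := fun I =>
          if (∀ q ∈ S, ¬ q.1 ∣ I.1) ∧ q.1 ∣ I.1 then normTerm s I else 0)]
      · refine tsum_congr fun I => ?_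
        have e : (∀ r ∈ S, ¬ r.1 ∣ (primeMul q I).1) ↔ ∀ r ∈ S, ¬ r.1 ∣ I.1 := by
          refine forall₂_congr fun r hr => not_congr ⟨fun h => ?_, fun h => h.mul_left _⟩
          rcases r.2.dvd_or_dvd h with h | h
          · exact absurd (Subtype.ext (Prime.eq_of_dvd_ideal r.2 q.2 h)) (fun h => hq (h ▸ hr))
          · exact h
        have e2 : q.1 ∣ (primeMul q I).1 := dvd_mul_right _ _
        simp only [e, e2, and_true, normTerm_primeMul]
        split_ifs <;> simp
      · intro I hI
        rw [Function.mem_support] at hI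
        have hI2 : q.1 ∣ I.1 := by
          by_contra h
          exact hI (if_neg fun h' => h h'.2)
        obtain ⟨J, hJ⟩ := hI2
        refine ⟨⟨J, ?_⟩, Subtype.ext hJ.symm⟩
        rintro rfl
        exact I.2 (by rw [hJ, mul_zero])
    rw [h1, ← Summable.tsum_sub (hS fun I => ∀ q ∈ S, ¬ q.1 ∣ I.1)
      (hS fun I => (∀ q ∈ S, ¬ q.1 ∣ I.1) ∧ q.1 ∣ I.1)]
    refine tsum_congr fun I => ?_
    by_cases h2 : ∀ r ∈ S, ¬ r.1 ∣ I.1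
    · by_cases h3 : q.1 ∣ I.1
      · rw [if_neg (fun h => h q (Finset.mem_insert_self _ _) h3), if_pos h2, if_pos ⟨h2, h3⟩, sub_self]
      · rw [if_pos (fun r hr => ?_), if_pos h2, if_neg (fun h => h3 h.2), sub_zero]
        rcases Finset.mem_insert.1 hr with rfl | hr
        · exact h3
        · exact h2 r hr
    · rw [if_neg (fun h => h2 fun r hr => h r (Finset.mem_insert_of_mem hr)), if_neg h2,
        if_neg (fun h => h2 h.1), sub_zero]

open Classical in
theorem tendsto_prod_mul_zetaSeries {s : ℂ} (hs : 1 < s.re) :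
    Tendsto (fun S : Finset {p : Ideal (𝓞 K) // Prime p} =>
      (∏ q ∈ S, (1 - normTerm s ⟨q.1, q.2.ne_zero⟩)) * zetaSeries K s) atTop (nhds 1) := by
  have hsum : Summable fun I : {B : Ideal (𝓞 K) // B ≠ 0} => normTerm s I :=
    summable_absNorm_cpow hs
  simp_rw [← tsum_sieve hs]
  have h1 : (1 : ℂ) = ∑' I : {B : Ideal (𝓞 K) // B ≠ 0},
      (if I = ⟨1, one_ne_zero⟩ then (1 : ℂ) else 0) := by
    rw [tsum_ite_eq]
  rw [h1]
  refine tendsto_tsum_of_dominated_convergence hsum.norm (fun I => ?_)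
    (Eventually.of_forall fun S I => ?_)
  · by_cases hI : I = ⟨1, one_ne_zero⟩
    · refine tendsto_const_nhds.congr fun S => ?_
      rw [if_pos hI, if_pos fun q _ h => ?_]
      · rw [hI]
        simp [normTerm]
      · rw [hI] at h
        exact q.2.not_isUnit (isUnit_of_dvd_one h)
    · rw [if_neg hI]
      have hu : ¬ IsUnit I.1 := fun h => hI (Subtype.ext ((Ideal.isUnit_iff.1 h).trans Ideal.one_eq_top.symm))
      obtain ⟨p, hp, hpI⟩ := WfDvdMonoid.exists_irreducible_factor hu I.2
      refine tendsto_const_nhds.congr' ?_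
      filter_upwards [eventually_ge_atTop {⟨p, hp.prime⟩}] with S hS
      rw [if_neg fun h => h ⟨p, hp.prime⟩ (hS (Finset.mem_singleton_self _)) hpI]
  · split_ifs <;> simp

end

noncomputable section

open Real Filter MeasureTheory Set Matrix NumberField
open scoped nonZeroDivisors

variable {K : Type} [Field K] [NumberField K]

theorem two_le_absNorm_of_prime {p : Ideal (𝓞 K)} (hp : Prime p) : 2 ≤ Ideal.absNorm p := by
  have h0 : Ideal.absNorm p ≠ 0 := Ideal.absNorm_ne_zero_iff_mem_nonZeroDivisors.2
    (mem_nonZeroDivisors_of_ne_zero hp.ne_zero)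
  have h1 : Ideal.absNorm p ≠ 1 := fun h => hp.not_isUnit
    (Ideal.isUnit_iff.2 (Ideal.absNorm_eq_one_iff.1 h))
  omega

/-- The nonzero ideal `p ^ (k + 1)`. -/
def primePow (i : {p : Ideal (𝓞 K) // Prime p} × ℕ) : {B : Ideal (𝓞 K) // B ≠ 0} :=
  ⟨i.1.1 ^ (i.2 + 1), pow_ne_zero _ i.1.2.ne_zero⟩

theorem primePow_injective : Function.Injective (primePow (K := K)) := by
  rintro ⟨p, j⟩ ⟨q, k⟩ h
  have h' : p.1 ^ (j + 1) = q.1 ^ (k + 1) := congrArg Subtype.val h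
  have hpq : p = q := by
    refine Subtype.ext (Prime.eq_of_dvd_ideal p.2 q.2 (p.2.dvd_of_dvd_pow (n := k + 1) ?_))
    rw [← h']
    exact dvd_pow_self _ (Nat.succ_ne_zero _)
  subst hpq
  have h2 := congrArg Ideal.absNorm h'
  rw [map_pow, map_pow] at h2
  have := Nat.pow_right_injective (two_le_absNorm_of_prime p.2) h2
  rw [Prod.mk.injEq]
  exact ⟨rfl, by omega⟩

variable (K) in
theorem exists_euler_family : ∃ (ι : Type) (w ℓ : ι → ℝ), (∀ i, 0 ≤ w i) ∧ (∀ i, 0 < ℓ i) ∧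
    (∀ σ : ℝ, 1 < σ → Summable fun i => w i * rexp (-(σ * ℓ i))) ∧
    ∀ s : ℂ, 1 < s.re → zetaSeries K s = Complex.exp (∑' i, (w i : ℂ) * Complex.exp (-(s * ℓ i))) := by
  set w : {p : Ideal (𝓞 K) // Prime p} × ℕ → ℝ := fun i => 1 / ((i.2 : ℝ) + 1) with hw
  set ℓ : {p : Ideal (𝓞 K) // Prime p} × ℕ → ℝ :=
    fun i => ((i.2 : ℝ) + 1) * Real.log (Ideal.absNorm i.1.1) with hℓ
  have hN : ∀ p : {p : Ideal (𝓞 K) // Prime p}, (2 : ℝ) ≤ Ideal.absNorm p.1 := fun p => by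
    exact_mod_cast two_le_absNorm_of_prime p.2
  have hw0 : ∀ i, 0 ≤ w i := fun i => by simp only [hw]; positivity
  have hw1 : ∀ i, w i ≤ 1 := fun i => by
    simp only [hw]
    rw [div_le_one (by positivity)]
    linarith [(Nat.cast_nonneg i.2 : (0 : ℝ) ≤ i.2)]
  have hℓ0 : ∀ i, 0 < ℓ i := fun i => mul_pos (by positivity) (Real.log_pos (by linarith [hN i.1]))
  have hsum : ∀ σ : ℝ, 1 < σ → Summable fun i => w i * rexp (-(σ * ℓ i)) := by
    intro σ hσ
    have h := (summable_absNorm_rpow K hσ).comp_injective primePow_injective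
    refine h.of_nonneg_of_le (fun i => mul_nonneg (hw0 i) (Real.exp_pos _).le) fun i => ?_
    have hp : (0 : ℝ) < Ideal.absNorm i.1.1 := by linarith [hN i.1]
    have e : ((Ideal.absNorm (primePow i).1 : ℕ) : ℝ) ^ (-σ) = rexp (-(σ * ℓ i)) := by
      simp only [primePow, map_pow, Nat.cast_pow]
      rw [Real.rpow_def_of_pos (by positivity), Real.log_pow]
      simp only [hℓ]
      push_cast
      ring_nf
    simp only [Function.comp_apply]
    rw [e]
    exact mul_le_of_le_one_left (Real.exp_pos _).le (hw1 i)
  refine ⟨_, w, ℓ, hw0, hℓ0, hsum, fun s hs => ?_⟩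
  have hterm : ∀ i : {p : Ideal (𝓞 K) // Prime p} × ℕ, (w i : ℂ) * Complex.exp (-(s * ℓ i)) =
      normTerm s ⟨i.1.1, i.1.2.ne_zero⟩ ^ (i.2 + 1) / ((i.2 + 1 : ℕ) : ℂ) := by
    intro i
    have hp : ((Ideal.absNorm i.1.1 : ℕ) : ℂ) ≠ 0 := by
      have : (0 : ℝ) < Ideal.absNorm i.1.1 := by linarith [hN i.1]
      exact_mod_cast this.ne'
    simp only [normTerm]
    rw [Complex.cpow_def_of_ne_zero hp, ← Complex.exp_nat_mul, Complex.natCast_log.symm]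
    simp only [hw, hℓ]
    push_cast
    rw [one_div, div_eq_inv_mul]
    congr 2
    ring
  have hlt : ∀ p : {p : Ideal (𝓞 K) // Prime p}, ‖normTerm s ⟨p.1, p.2.ne_zero⟩‖ < 1 := by
    intro p
    have h2 := hN p
    simp only [normTerm]
    rw [show ((Ideal.absNorm p.1 : ℕ) : ℂ) = ((Ideal.absNorm p.1 : ℝ) : ℂ) by simp,
      Complex.norm_cpow_eq_rpow_re_of_pos (by linarith)]
    refine Real.rpow_lt_one_of_one_lt_of_neg (by linarith) ?_
    simp
    linarith
  have hne : ∀ p : {p : Ideal (𝓞 K) // Prime p}, 1 - normTerm s ⟨p.1, p.2.ne_zero⟩ ≠ 0 := by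
    intro p h
    have := hlt p
    rw [← sub_eq_zero.1 h] at this
    simp at this
  have hfib : ∀ p : {p : Ideal (𝓞 K) // Prime p}, HasSum
      (fun k : ℕ => (w (p, k) : ℂ) * Complex.exp (-(s * ℓ (p, k))))
      (-Complex.log (1 - normTerm s ⟨p.1, p.2.ne_zero⟩)) := by
    intro p
    have h := Complex.hasSum_taylorSeries_neg_log (hlt p)
    rw [← hasSum_nat_add_iff' 1] at h
    simp only [Finset.range_one, Finset.sum_singleton, Nat.cast_zero, div_zero, sub_zero] at h
    exact h.congr_fun fun k => hterm (p, k)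
  have hS : Summable fun i => (w i : ℂ) * Complex.exp (-(s * ℓ i)) := by
    refine (hsum s.re hs).of_norm_bounded fun i => le_of_eq ?_
    rw [norm_mul, Complex.norm_real, Real.norm_of_nonneg (hw0 i), Complex.norm_exp]
    simp
  have hH := hS.hasSum.prod_fiberwise hfib
  set H := ∑' i, (w i : ℂ) * Complex.exp (-(s * ℓ i))
  have t1 : Tendsto (fun S : Finset {p : Ideal (𝓞 K) // Prime p} =>
      (∏ q ∈ S, (1 - normTerm s ⟨q.1, q.2.ne_zero⟩)) * zetaSeries K s) atTop
      (nhds (Complex.exp (-H) * zetaSeries K s)) := by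
    refine Tendsto.mul_const _ ?_
    have h3 : Tendsto _ _ _ := ((Complex.continuous_exp.tendsto (-H)).comp (Filter.Tendsto.neg hH))
    refine h3.congr fun S => ?_
    simp only [Function.comp_apply]
    rw [← Finset.sum_neg_distrib, Complex.exp_sum]
    refine Finset.prod_congr rfl fun q _ => ?_
    rw [neg_neg, Complex.exp_log (hne q)]
  have h := tendsto_nhds_unique t1 (tendsto_prod_mul_zetaSeries hs)
  rw [Complex.exp_neg, inv_mul_eq_iff_eq_mul₀ (Complex.exp_ne_zero _), mul_one] at h
  exact h

end

noncomputable section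

open Real Filter MeasureTheory Set Matrix NumberField
open scoped nonZeroDivisors

theorem re_logDeriv_nonneg_of_strip {V : ℂ → ℂ} {α β : ℝ} (hαβ : α < β) (hpi : β - α < π) {Ω : Set ℂ}
    (hΩ : IsOpen Ω) (hsub : ∀ s : ℂ, α ≤ s.re → s.re ≤ β → s ∈ Ω) (hV : DifferentiableOn ℂ V Ω)
    (hgrowth : ∃ B, ∀ s : ℂ, α ≤ s.re → s.re ≤ β → 1 ≤ |s.im| → ‖V s‖ ≤ rexp (B * rexp |s.im|))
    (hleft : ∀ s : ℂ, s.re = α → ‖V s‖ ≤ 1) (hright : ∀ s : ℂ, s.re = β → ‖V s‖ ≤ 1)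
    {s₁ : ℂ} (hs₁ : s₁.re = β) (h1 : ‖V s₁‖ = 1) : 0 ≤ (deriv V s₁ / V s₁).re := by
  have hle : ∀ s : ℂ, α ≤ s.re → s.re ≤ β → ‖V s‖ ≤ 1 := by
    intro s hs hs'
    refine PhragmenLindelof.vertical_strip (a := α) (b := β) ?_ ?_ hleft hright hs hs'
    · refine DifferentiableOn.diffContOnCl (hV.mono ?_)
      rw [Complex.closure_preimage_re, closure_Ioo hαβ.ne]
      exact fun s hs => hsub s hs.1 hs.2
    · obtain ⟨B, hB⟩ := hgrowth
      refine ⟨1, by rwa [lt_div_iff₀ (by linarith), one_mul], B, ?_⟩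
      refine Asymptotics.IsBigO.of_bound 1 ?_
      have he : ∀ᶠ s in comap (_root_.abs ∘ Complex.im) atTop ⊓ 𝓟 (Complex.re ⁻¹' Ioo α β), 1 ≤ |Complex.im s| :=
        Filter.Eventually.filter_mono inf_le_left ((eventually_ge_atTop (1 : ℝ)).comap _)
      have he2 : ∀ᶠ s in comap (_root_.abs ∘ Complex.im) atTop ⊓ 𝓟 (Complex.re ⁻¹' Ioo α β),
          s ∈ Complex.re ⁻¹' Ioo α β :=
        Filter.Eventually.filter_mono inf_le_right (mem_principal_self _)
      filter_upwards [he, he2] with s h h'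
      rw [one_mul, one_mul, Real.norm_of_nonneg (Real.exp_pos _).le]
      exact hB s h'.1.le h'.2.le h
  have hV0 : V s₁ ≠ 0 := norm_ne_zero_iff.1 (by rw [h1]; exact one_ne_zero)
  have hd : HasDerivAt V (deriv V s₁) s₁ :=
    ((hV s₁ (hsub s₁ (by linarith) hs₁.le)).differentiableAt
      (hΩ.mem_nhds (hsub s₁ (by linarith) hs₁.le))).hasDerivAt
  have hd2 : HasDerivAt (fun z : ℂ => V (s₁ - z) / V s₁) (-(deriv V s₁ / V s₁)) ((0 : ℝ) : ℂ) := by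
    have h3 : HasDerivAt (fun z : ℂ => s₁ - z) (-1) ((0 : ℝ) : ℂ) := by
      simpa using (hasDerivAt_id ((0 : ℝ) : ℂ)).const_sub s₁
    have h4 : HasDerivAt V (deriv V s₁) (s₁ - ((0 : ℝ) : ℂ)) := by simpa using hd
    have := (h4.comp _ h3).div_const (V s₁)
    convert! this using 1
    ring
  have hr := hd2.real_of_complex
  have hr' := (hasDerivWithinAt_iff_tendsto_slope' (self_notMem_Ioi)).1 (hr.hasDerivWithinAt (s := Ioi 0))
  have hlim : (-(deriv V s₁ / V s₁)).re ≤ 0 := by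
    refine le_of_tendsto hr' ?_
    have : Ioo 0 (β - α) ∈ nhdsWithin (0 : ℝ) (Ioi 0) := Ioo_mem_nhdsGT (by linarith)
    filter_upwards [this] with h hh
    rw [slope_def_field]
    refine div_nonpos_of_nonpos_of_nonneg ?_ (by linarith [hh.1])
    have e1 : (V (s₁ - ((0 : ℝ) : ℂ)) / V s₁).re = 1 := by
      rw [Complex.ofReal_zero, sub_zero, div_self hV0, Complex.one_re]
    have e2 : (V (s₁ - (h : ℂ)) / V s₁).re ≤ 1 := by
      refine (Complex.re_le_norm _).trans ?_
      rw [norm_div, h1, div_one]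
      refine hle _ ?_ ?_
      · rw [Complex.sub_re, Complex.ofReal_re]
        linarith [hh.2]
      · rw [Complex.sub_re, Complex.ofReal_re]
        linarith [hh.1]
    rw [e1]
    linarith
  rw [Complex.neg_re] at hlim
  linarith

section CoshSeries

variable {ι : Type} {w ℓ : ι → ℝ}

theorem norm_cosh_le (z : ℂ) : ‖Complex.cosh z‖ ≤ Real.cosh z.re := by
  rw [Complex.cosh, norm_div, Complex.norm_two, Real.cosh_eq]
  have := norm_add_le (Complex.exp z) (Complex.exp (-z))
  rw [Complex.norm_exp, Complex.norm_exp, Complex.neg_re] at this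
  linarith

variable (w ℓ) in
/-- The summand of the harmonic interpolation of `log |ζ|` between the two edges of a strip. -/
def coshTerm (a : ℝ) (i : ι) (s : ℂ) : ℂ :=
  ((w i * rexp (-(a * ℓ i)) / Real.cosh (ℓ i * (a - 1 / 2)) : ℝ) : ℂ) *
    Complex.cosh (ℓ i * (s - 1 / 2))

variable (w ℓ) in
/-- The harmonic interpolation of `log |ζ|` between the two edges of a strip. -/
def coshSeries (a : ℝ) (s : ℂ) : ℂ := ∑' i, coshTerm w ℓ a i s

theorem norm_coshTerm_le (hw : ∀ i, 0 ≤ w i) (hℓ : ∀ i, 0 < ℓ i) {a r : ℝ} (hr : 0 ≤ r) (i : ι) {s : ℂ}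
    (hs : |s.re - 1 / 2| ≤ a - 1 / 2 + r) :
    ‖coshTerm w ℓ a i s‖ ≤ w i * rexp (-((a - r) * ℓ i)) := by
  have hc := Real.cosh_pos (ℓ i * (a - 1 / 2))
  have hw' := hw i
  rw [coshTerm, norm_mul, Complex.norm_real, Real.norm_of_nonneg (by positivity)]
  have e : (ℓ i * (s - 1 / 2) : ℂ).re = ℓ i * (s.re - 1 / 2) := by
    rw [Complex.re_ofReal_mul]
    simp
  have h1 := norm_cosh_le (ℓ i * (s - 1 / 2) : ℂ)
  rw [e] at h1
  have h2 : Real.cosh (ℓ i * (s.re - 1 / 2)) ≤ rexp (r * ℓ i) * Real.cosh (ℓ i * (a - 1 / 2)) := by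
    have h3 : Real.cosh (ℓ i * (s.re - 1 / 2)) ≤ Real.cosh (ℓ i * (a - 1 / 2 + r)) := by
      rw [Real.cosh_le_cosh, abs_mul, abs_mul]
      exact mul_le_mul_of_nonneg_left (hs.trans (le_abs_self _)) (abs_nonneg _)
    refine h3.trans ?_
    have hx : 0 ≤ r * ℓ i := mul_nonneg hr (hℓ i).le
    have h5 : rexp (-(r * ℓ i)) ≤ rexp (r * ℓ i) := Real.exp_le_exp.2 (by linarith)
    rw [show ℓ i * (a - 1 / 2 + r) = ℓ i * (a - 1 / 2) + r * ℓ i by ring, Real.cosh_eq, Real.cosh_eq,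
      neg_add, Real.exp_add, Real.exp_add]
    have := Real.exp_pos (-(ℓ i * (a - 1 / 2)))
    nlinarith
  calc _ ≤ w i * rexp (-(a * ℓ i)) / Real.cosh (ℓ i * (a - 1 / 2)) *
        (rexp (r * ℓ i) * Real.cosh (ℓ i * (a - 1 / 2))) := by
        gcongr
        exact h1.trans h2
    _ = w i * (rexp (-(a * ℓ i)) * rexp (r * ℓ i)) := by field_simp
    _ = _ := by rw [← Real.exp_add]; ring_nf

theorem re_coshTerm_edge {a y : ℝ} (i : ι) :
    (coshTerm w ℓ a i (a + y * Complex.I)).re = w i * rexp (-(a * ℓ i)) * Real.cos (y * ℓ i) ∧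
    (coshTerm w ℓ a i (1 - a + y * Complex.I)).re = w i * rexp (-(a * ℓ i)) * Real.cos (y * ℓ i) := by
  have hc := Real.cosh_pos (ℓ i * (a - 1 / 2))
  have key : ∀ x y : ℝ, (Complex.cosh (x + y * Complex.I)).re = Real.cosh x * Real.cos y := by
    intro x y
    rw [Complex.cosh_add, Complex.cosh_mul_I, Complex.sinh_mul_I]
    simp only [Complex.add_re, Complex.mul_re, Complex.mul_im, Complex.I_re, Complex.I_im,
      Complex.cosh_ofReal_re, Complex.cosh_ofReal_im, Complex.sinh_ofReal_re,
      Complex.sinh_ofReal_im, Complex.cos_ofReal_re, Complex.cos_ofReal_im, Complex.sin_ofReal_re,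
      Complex.sin_ofReal_im]
    ring
  constructor
  · rw [coshTerm, Complex.re_ofReal_mul,
      show (ℓ i * (a + y * Complex.I - 1 / 2) : ℂ) =
        ((ℓ i * (a - 1 / 2) : ℝ) : ℂ) + ((y * ℓ i : ℝ) : ℂ) * Complex.I by push_cast; ring, key]
    field_simp
  · rw [coshTerm, Complex.re_ofReal_mul,
      show (ℓ i * (1 - a + y * Complex.I - 1 / 2) : ℂ) =
        ((-(ℓ i * (a - 1 / 2)) : ℝ) : ℂ) + ((y * ℓ i : ℝ) : ℂ) * Complex.I by push_cast; ring, key,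
      Real.cosh_neg]
    field_simp

theorem re_deriv_coshTerm {a t : ℝ} (i : ι) :
    (deriv (coshTerm w ℓ a i) (a + t * Complex.I)).re =
      w i * ℓ i * rexp (-(a * ℓ i)) * Real.tanh (ℓ i * (a - 1 / 2)) * Real.cos (t * ℓ i) := by
  have hc := Real.cosh_pos (ℓ i * (a - 1 / 2))
  have key : ∀ x y : ℝ, (Complex.sinh (x + y * Complex.I)).re = Real.sinh x * Real.cos y := by
    intro x y
    rw [Complex.sinh_add, Complex.cosh_mul_I, Complex.sinh_mul_I]
    simp only [Complex.add_re, Complex.mul_re, Complex.mul_im, Complex.I_re, Complex.I_im,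
      Complex.cosh_ofReal_re, Complex.cosh_ofReal_im, Complex.sinh_ofReal_re,
      Complex.sinh_ofReal_im, Complex.cos_ofReal_re, Complex.cos_ofReal_im, Complex.sin_ofReal_re,
      Complex.sin_ofReal_im]
    ring
  have hd : HasDerivAt (coshTerm w ℓ a i)
      (((w i * rexp (-(a * ℓ i)) / Real.cosh (ℓ i * (a - 1 / 2)) : ℝ) : ℂ) *
        (Complex.sinh (ℓ i * (a + t * Complex.I - 1 / 2)) * ℓ i)) (a + t * Complex.I) := by
    unfold coshTerm
    refine HasDerivAt.const_mul _ (HasDerivAt.ccosh ?_)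
    have := ((hasDerivAt_id (a + t * Complex.I : ℂ)).sub_const (1 / 2)).const_mul (ℓ i : ℂ)
    rwa [mul_one] at this
  rw [hd.deriv, Complex.re_ofReal_mul, Complex.re_mul_ofReal,
    show (ℓ i * (a + t * Complex.I - 1 / 2) : ℂ) =
      ((ℓ i * (a - 1 / 2) : ℝ) : ℂ) + ((t * ℓ i : ℝ) : ℂ) * Complex.I by push_cast; ring, key,
    Real.tanh_eq_sinh_div_cosh]
  ring

theorem differentiable_coshTerm (a : ℝ) (i : ι) : Differentiable ℂ (coshTerm w ℓ a i) := by
  unfold coshTerm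
  fun_prop

/-- An open neighbourhood of the closed strip `1 - a ≤ Re s ≤ a`. -/
def openStrip (a r : ℝ) : Set ℂ := {s : ℂ | |s.re - 1 / 2| < a - 1 / 2 + r}

theorem isOpen_openStrip (a r : ℝ) : IsOpen (openStrip a r) := by
  unfold openStrip
  exact isOpen_lt (by fun_prop) continuous_const

variable (hw : ∀ i, 0 ≤ w i) (hℓ : ∀ i, 0 < ℓ i)
  (hsum : ∀ σ : ℝ, 1 < σ → Summable fun i => w i * rexp (-(σ * ℓ i)))
include hw hℓ hsum

theorem differentiableOn_coshSeries {a r : ℝ} (hr : 0 ≤ r) (ha : 1 < a - r) :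
    DifferentiableOn ℂ (coshSeries w ℓ a) (openStrip a r) :=
  Complex.differentiableOn_tsum_of_summable_norm (hsum _ ha)
    (fun i => (differentiable_coshTerm a i).differentiableOn) (isOpen_openStrip a r)
    fun i _ hs => norm_coshTerm_le hw hℓ hr i (le_of_lt hs)

theorem summable_coshTerm {a : ℝ} (ha : 1 < a) {s : ℂ} (hs : |s.re - 1 / 2| ≤ a - 1 / 2) :
    Summable fun i => coshTerm w ℓ a i s := by
  refine (hsum a ha).of_norm_bounded fun i => ?_
  simpa using norm_coshTerm_le hw hℓ le_rfl i (by simpa using hs)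

theorem norm_coshSeries_le {a : ℝ} (ha : 1 < a) {s : ℂ} (hs : |s.re - 1 / 2| ≤ a - 1 / 2) :
    ‖coshSeries w ℓ a s‖ ≤ ∑' i, w i * rexp (-(a * ℓ i)) := by
  refine tsum_of_norm_bounded (hsum a ha).hasSum fun i => ?_
  simpa using norm_coshTerm_le hw hℓ le_rfl i (by simpa using hs)

theorem re_coshSeries_edge {a : ℝ} (ha : 1 < a) (y : ℝ) :
    (coshSeries w ℓ a (a + y * Complex.I)).re =
      ∑' i, w i * rexp (-(a * ℓ i)) * Real.cos (y * ℓ i) ∧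
    (coshSeries w ℓ a (1 - a + y * Complex.I)).re =
      ∑' i, w i * rexp (-(a * ℓ i)) * Real.cos (y * ℓ i) := by
  have h1 := summable_coshTerm hw hℓ hsum ha (s := a + y * Complex.I)
    (by simp only [Complex.add_re, Complex.ofReal_re, Complex.re_ofReal_mul, Complex.I_re, mul_zero, add_zero]; rw [abs_of_pos (by linarith)])
  have h2 := summable_coshTerm hw hℓ hsum ha (s := 1 - a + y * Complex.I)
    (by simp only [Complex.add_re, Complex.sub_re, Complex.one_re, Complex.ofReal_re, Complex.re_ofReal_mul, Complex.I_re, mul_zero, add_zero]; rw [abs_of_neg (by linarith)]; linarith)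
  rw [coshSeries, coshSeries, Complex.re_tsum h1, Complex.re_tsum h2]
  exact ⟨tsum_congr fun i => (re_coshTerm_edge i).1, tsum_congr fun i => (re_coshTerm_edge i).2⟩

theorem hasSum_re_deriv_coshSeries {a : ℝ} (ha : 1 < a) (t : ℝ) :
    HasSum (fun i => w i * ℓ i * rexp (-(a * ℓ i)) * Real.tanh (ℓ i * (a - 1 / 2)) * Real.cos (t * ℓ i))
      (deriv (coshSeries w ℓ a) (a + t * Complex.I)).re := by
  have hr : 0 < (a - 1) / 2 := by linarith
  have h := Complex.hasSum_deriv_of_summable_norm (F := coshTerm w ℓ a) (U := openStrip a ((a - 1) / 2))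
    (hsum (a - (a - 1) / 2) (by linarith))
    (fun i => (differentiable_coshTerm a i).differentiableOn) (isOpen_openStrip a _)
    (fun i s hs => norm_coshTerm_le hw hℓ hr.le i (le_of_lt hs))
    (z := a + t * Complex.I) (by
      change |(a + t * Complex.I : ℂ).re - 1 / 2| < a - 1 / 2 + (a - 1) / 2
      simp only [Complex.add_re, Complex.ofReal_re, Complex.re_ofReal_mul, Complex.I_re, mul_zero, add_zero]
      rw [abs_of_pos (by linarith)]
      linarith)
  have h2 := Complex.hasSum_re h
  simp_rw [re_deriv_coshTerm] at h2
  exact h2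

end CoshSeries

end

noncomputable section

open Real Filter MeasureTheory Set Matrix NumberField
open scoped nonZeroDivisors

theorem Real.cosh_sub_le (t y : ℝ) : Real.cosh (t - y) ≤ rexp |t| * rexp |y| := by
  rw [← Real.exp_add, Real.cosh_eq]
  have h1 : rexp (t - y) ≤ rexp (|t| + |y|) :=
    Real.exp_le_exp.2 (by linarith [le_abs_self t, neg_abs_le y])
  have h2 : rexp (-(t - y)) ≤ rexp (|t| + |y|) :=
    Real.exp_le_exp.2 (by linarith [le_abs_self y, neg_abs_le t])
  linarith

section

variable {ι : Type} {w ℓ : ι → ℝ} (hw : ∀ i, 0 ≤ w i) (hℓ : ∀ i, 0 < ℓ i)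
  (hsum : ∀ σ : ℝ, 1 < σ → Summable fun i => w i * rexp (-(σ * ℓ i)))
include hw hℓ hsum

theorem tsum_tanh_le_re_logDeriv {a : ℝ} (ha : 1 < a) (ha1 : a ≤ 5 / 4) {U : ℂ → ℂ}
    (hU : Differentiable ℂ U)
    (hg : ∃ C, ∀ s : ℂ, -1 ≤ s.re → s.re ≤ 2 → 1 ≤ |s.im| → ‖U s‖ ≤ C * rexp (C * |s.im|))
    {t A P : ℝ} (hP : 0 ≤ P)
    (hright : ∀ y : ℝ, ‖U (a + y * Complex.I)‖ ≤ ‖(a + y * Complex.I) - (2 * a - 1 : ℝ)‖ *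
      rexp (∑' i, w i * rexp (-(a * ℓ i)) * Real.cos (y * ℓ i)))
    (heq : ‖U (a + t * Complex.I)‖ = ‖(a + t * Complex.I) - (2 * a - 1 : ℝ)‖ *
      rexp (∑' i, w i * rexp (-(a * ℓ i)) * Real.cos (t * ℓ i)))
    (hleft : ∀ y : ℝ, ‖U (1 - a + y * Complex.I)‖ ≤ ‖(1 - a + y * Complex.I) - (2 * a - 1 : ℝ)‖ *
      rexp (∑' i, w i * rexp (-(a * ℓ i)) * Real.cos (y * ℓ i)) *
      rexp (A * (2 * a - 1) + P * Real.sin (2 * a - 1) * Real.cosh (y - t))) :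
    ∑' i, w i * ℓ i * rexp (-(a * ℓ i)) * Real.tanh (ℓ i * (a - 1 / 2)) * Real.cos (t * ℓ i) ≤
      (deriv U (a + t * Complex.I) / U (a + t * Complex.I)).re -
        (1 / ((a + t * Complex.I) - (2 * a - 1 : ℝ))).re + A + P := by
  set s₁ : ℂ := a + t * Complex.I with hs₁
  have hre : s₁.re = a := by simp [hs₁]
  have him : s₁.im = t := by simp [hs₁]
  set b : ℝ := 2 * a - 1 with hb
  set E : ℂ → ℂ := fun s => -coshSeries w ℓ a s - (A * (s₁ - s) + P * Complex.sin (s₁ - s)) with hE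
  set V : ℂ → ℂ := fun s => U s / (s - b) * Complex.exp (E s) with hV
  set r : ℝ := (a - 1) / 2 with hr
  have hr0 : 0 ≤ r := by rw [hr]; linarith
  have hsub : ∀ s : ℂ, 1 - a ≤ s.re → s.re ≤ a → s ∈ openStrip a r := by
    intro s h1 h2
    change |s.re - 1 / 2| < a - 1 / 2 + r
    rw [abs_lt]
    constructor <;> linarith
  have hsb : ∀ s ∈ openStrip a r, s - b ≠ 0 := by
    intro s hs h
    change |s.re - 1 / 2| < a - 1 / 2 + r at hs
    have h2 : s.re = b := by rw [sub_eq_zero.1 h, Complex.ofReal_re]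
    rw [abs_lt, h2] at hs
    linarith [hs.2]
  have hDd : DifferentiableOn ℂ (coshSeries w ℓ a) (openStrip a r) :=
    differentiableOn_coshSeries hw hℓ hsum hr0 (by rw [hr]; linarith)
  have hEd : DifferentiableOn ℂ E (openStrip a r) :=
    hDd.neg.sub (Differentiable.differentiableOn (by fun_prop))
  have hVd : DifferentiableOn ℂ V (openStrip a r) :=
    (hU.differentiableOn.div (Differentiable.differentiableOn (by fun_prop)) hsb).mul hEd.cexp
  have hEre : ∀ s, (E s).re = -(coshSeries w ℓ a s).re - A * (s₁ - s).re - P * (Complex.sin (s₁ - s)).re := by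
    intro s
    simp only [hE, Complex.sub_re, Complex.neg_re, Complex.add_re, Complex.re_ofReal_mul]
    ring
  have hsinre : ∀ x y : ℝ, (Complex.sin (x + y * Complex.I)).re = Real.sin x * Real.cosh y := by
    intro x y
    rw [Complex.sin_add, Complex.cos_mul_I, Complex.sin_mul_I]
    simp only [Complex.add_re, Complex.mul_re, Complex.mul_im, Complex.I_re, Complex.I_im,
      Complex.cosh_ofReal_re, Complex.cosh_ofReal_im, Complex.sinh_ofReal_re,
      Complex.sinh_ofReal_im, Complex.cos_ofReal_re, Complex.cos_ofReal_im, Complex.sin_ofReal_re,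
      Complex.sin_ofReal_im]
    ring
  have hER : ∀ y : ℝ, (E (a + y * Complex.I)).re =
      -∑' i, w i * rexp (-(a * ℓ i)) * Real.cos (y * ℓ i) := by
    intro y
    rw [hEre, (re_coshSeries_edge hw hℓ hsum ha y).1]
    have e : s₁ - (a + y * Complex.I) = ((0 : ℝ) : ℂ) + ((t - y : ℝ) : ℂ) * Complex.I := by
      rw [hs₁]; push_cast; ring
    rw [e, hsinre]
    simp
  have hEL : ∀ y : ℝ, (E (1 - a + y * Complex.I)).re =
      -∑' i, w i * rexp (-(a * ℓ i)) * Real.cos (y * ℓ i) - A * b - P * Real.sin b * Real.cosh (y - t) := by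
    intro y
    rw [hEre, (re_coshSeries_edge hw hℓ hsum ha y).2]
    have e : s₁ - (1 - a + y * Complex.I) = (b : ℂ) + ((t - y : ℝ) : ℂ) * Complex.I := by
      rw [hs₁, hb]; push_cast; ring
    rw [e, hsinre, ← Real.cosh_neg (t - y), neg_sub]
    simp
    ring
  have hVnorm : ∀ s, ‖V s‖ = ‖U s‖ / ‖s - b‖ * rexp (E s).re := by
    intro s
    simp only [hV]
    rw [norm_mul, norm_div, Complex.norm_exp]
  have hedge : ∀ s : ℂ, s = s.re + s.im * Complex.I := fun s => (Complex.re_add_im s).symm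
  have hR : ∀ s : ℂ, s.re = a → ‖V s‖ ≤ 1 := by
    intro s hs
    have h0 : 0 < ‖s - b‖ := norm_pos_iff.2 (hsb s (hsub s (by linarith) hs.le))
    have h := hright s.im
    have h2 := hER s.im
    rw [← hs, ← hedge s, hs] at h h2
    rw [hVnorm, h2, Real.exp_neg, ← div_eq_mul_inv, div_div, div_le_one (by positivity)]
    exact h
  have hL : ∀ s : ℂ, s.re = 1 - a → ‖V s‖ ≤ 1 := by
    intro s hs
    have h0 : 0 < ‖s - b‖ := norm_pos_iff.2 (hsb s (hsub s hs.ge (by linarith)))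
    have h := hleft s.im
    have h2 := hEL s.im
    have e : (1 - a + s.im * Complex.I : ℂ) = s := by
      conv_rhs => rw [hedge s, hs]
      push_cast
      ring
    rw [e] at h h2
    rw [hVnorm, h2, show -∑' i, w i * rexp (-(a * ℓ i)) * Real.cos (s.im * ℓ i) - A * b -
      P * Real.sin b * Real.cosh (s.im - t) = -(∑' i, w i * rexp (-(a * ℓ i)) * Real.cos (s.im * ℓ i) +
      (A * b + P * Real.sin b * Real.cosh (s.im - t))) by ring, Real.exp_neg, ← div_eq_mul_inv, div_div,
      div_le_one (by positivity), Real.exp_add, ← mul_assoc]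
    exact h
  have h1 : ‖V s₁‖ = 1 := by
    have h0 : 0 < ‖s₁ - b‖ := norm_pos_iff.2 (hsb s₁ (hsub s₁ (by linarith) hre.le))
    have h2 := hER t
    rw [← hs₁] at h2
    rw [hVnorm, h2, heq, Real.exp_neg, mul_div_cancel_left₀ _ h0.ne',
      mul_inv_cancel₀ (Real.exp_ne_zero _)]
  have hgrowth : ∃ B, ∀ s : ℂ, 1 - a ≤ s.re → s.re ≤ a → 1 ≤ |s.im| → ‖V s‖ ≤ rexp (B * rexp |s.im|) := by
    obtain ⟨C, hC⟩ := hg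
    set S := ∑' i, w i * rexp (-(a * ℓ i)) with hS
    refine ⟨C + C + S + |A| * (b + |t| + 1) + P * rexp |t|, fun s hs1 hs2 hs3 => ?_⟩
    have hUs := hC s (by linarith) (by linarith) hs3
    have hC0 : 0 ≤ C := nonneg_of_mul_nonneg_left ((norm_nonneg _).trans hUs) (Real.exp_pos _)
    have hS0 : 0 ≤ S := tsum_nonneg fun i => mul_nonneg (hw i) (Real.exp_pos _).le
    have hb0 : 1 ≤ ‖s - b‖ := hs3.trans (by simpa using Complex.abs_im_le_norm (s - b))
    have hX1 : 1 ≤ rexp |s.im| := Real.one_le_exp (abs_nonneg _)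
    have hX2 : |s.im| ≤ rexp |s.im| := by linarith [Real.add_one_le_exp |s.im|]
    have hEb : (E s).re ≤ S + |A| * (b + |t| + |s.im|) + P * (rexp |t| * rexp |s.im|) := by
      rw [hEre]
      have i1 : -(coshSeries w ℓ a s).re ≤ S :=
        ((neg_le_abs _).trans (Complex.abs_re_le_norm _)).trans
          (norm_coshSeries_le hw hℓ hsum ha (abs_le.2 ⟨by linarith, by linarith⟩))
      have i2 : -(A * (s₁ - s).re) ≤ |A| * (b + |t| + |s.im|) := by
        refine (neg_le_abs _).trans ?_
        rw [abs_mul]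
        gcongr
        rw [Complex.sub_re, hre, abs_of_nonneg (by linarith)]
        linarith [abs_nonneg t, abs_nonneg s.im]
      have i3 : -(P * (Complex.sin (s₁ - s)).re) ≤ P * (rexp |t| * rexp |s.im|) := by
        rw [← mul_neg]
        gcongr
        refine ((neg_le_abs _).trans (Complex.abs_re_le_norm _)).trans ((norm_sin_le_cosh _).trans ?_)
        rw [Complex.sub_im, him]
        exact Real.cosh_sub_le _ _
      linarith
    rw [hVnorm]
    have hb1 : 0 ≤ b := by linarith
    calc _ ≤ ‖U s‖ * rexp (E s).re := by
          gcongr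
          exact div_le_self (norm_nonneg _) hb0
      _ ≤ (rexp C * rexp (C * |s.im|)) * rexp (S + |A| * (b + |t| + |s.im|) + P * (rexp |t| * rexp |s.im|)) := by
          gcongr
          refine hUs.trans ?_
          gcongr
          linarith [Real.add_one_le_exp C]
      _ = rexp (C + C * |s.im| + (S + |A| * (b + |t| + |s.im|) + P * (rexp |t| * rexp |s.im|))) := by
          rw [← Real.exp_add, ← Real.exp_add]
      _ ≤ _ := by
          refine Real.exp_le_exp.2 ?_
          have j1 : C ≤ C * rexp |s.im| := le_mul_of_one_le_right hC0 hX1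
          have j2 : C * |s.im| ≤ C * rexp |s.im| := by gcongr
          have j3 : S ≤ S * rexp |s.im| := le_mul_of_one_le_right hS0 hX1
          have j4 : |A| * (b + |t| + |s.im|) ≤ |A| * (b + |t| + 1) * rexp |s.im| := by
            rw [mul_assoc]
            gcongr
            nlinarith [abs_nonneg t]
          nlinarith
  have main := re_logDeriv_nonneg_of_strip (α := 1 - a) (β := a) (by linarith)
    (by linarith [Real.pi_gt_three]) (isOpen_openStrip a r) hsub hVd hgrowth hL hR hre h1
  have hs₁mem := hsub s₁ (by linarith) hre.le
  have hsb1 := hsb s₁ hs₁mem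
  have hU1 : U s₁ ≠ 0 := by
    rw [← norm_ne_zero_iff, heq]
    exact mul_ne_zero (norm_ne_zero_iff.2 hsb1) (Real.exp_ne_zero _)
  have hDa : HasDerivAt (coshSeries w ℓ a) (deriv (coshSeries w ℓ a) s₁) s₁ :=
    ((hDd s₁ hs₁mem).differentiableAt ((isOpen_openStrip a r).mem_nhds hs₁mem)).hasDerivAt
  have hlin : HasDerivAt (fun s : ℂ => s₁ - s) (-1) s₁ := by
    simpa using (hasDerivAt_id s₁).const_sub s₁
  have hEa : HasDerivAt E (-deriv (coshSeries w ℓ a) s₁ + (A + P)) s₁ := by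
    have hsin : HasDerivAt (fun s : ℂ => Complex.sin (s₁ - s)) (-1) s₁ := by
      have := hlin.csin
      simpa using this
    have := hDa.neg.sub ((hlin.const_mul (A : ℂ)).add (hsin.const_mul (P : ℂ)))
    convert! this using 1
    ring
  have hVa : HasDerivAt V (((deriv U s₁ * (s₁ - b) - U s₁ * 1) / (s₁ - b) ^ 2) * Complex.exp (E s₁) +
      U s₁ / (s₁ - b) * (Complex.exp (E s₁) * (-deriv (coshSeries w ℓ a) s₁ + (A + P)))) s₁ :=
    ((hU s₁).hasDerivAt.div ((hasDerivAt_id s₁).sub_const (b : ℂ)) hsb1).mul hEa.cexp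
  have hquot : deriv V s₁ / V s₁ = deriv U s₁ / U s₁ - 1 / (s₁ - b) - deriv (coshSeries w ℓ a) s₁ + (A + P) := by
    rw [hVa.deriv]
    simp only [hV]
    have := Complex.exp_ne_zero (E s₁)
    field_simp
    ring
  rw [hquot] at main
  have hD := (hasSum_re_deriv_coshSeries hw hℓ hsum ha t).tsum_eq
  rw [← hs₁] at hD
  rw [hD]
  simp only [Complex.add_re, Complex.sub_re, Complex.ofReal_re] at main
  linarith

end

end

noncomputable section

open Real Filter MeasureTheory Set Matrix NumberField
open scoped nonZeroDivisors

section

variable {ι : Type} {w ℓ : ι → ℝ}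

variable (w ℓ) in
/-- The real part of the logarithmic derivative of `1 / ζ`, smoothed by its harmonic interpolation
at abscissa `a`. -/
def smoothSum (a t : ℝ) : ℝ :=
  ∑' i, w i * ℓ i * rexp (-(a * ℓ i)) * (1 + Real.tanh (ℓ i * (a - 1 / 2))) * Real.cos (t * ℓ i)

variable (hw : ∀ i, 0 ≤ w i) (hℓ : ∀ i, 0 < ℓ i)
  (hsum : ∀ σ : ℝ, 1 < σ → Summable fun i => w i * rexp (-(σ * ℓ i)))
include hw hℓ hsum

theorem summable_weight {a : ℝ} (ha : 1 < a) : Summable fun i => w i * ℓ i * rexp (-(a * ℓ i)) := by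
  set δ := (a - 1) / 2 with hδ
  have hδ0 : 0 < δ := by rw [hδ]; linarith
  refine ((hsum (a - δ) (by rw [hδ]; linarith)).mul_left δ⁻¹).of_nonneg_of_le
    (fun i => mul_nonneg (mul_nonneg (hw i) (hℓ i).le) (Real.exp_pos _).le) fun i => ?_
  have h1 : ℓ i ≤ δ⁻¹ * rexp (δ * ℓ i) := by
    rw [inv_mul_eq_div, le_div_iff₀ hδ0]
    linarith [Real.add_one_le_exp (δ * ℓ i)]
  calc _ ≤ w i * (δ⁻¹ * rexp (δ * ℓ i)) * rexp (-(a * ℓ i)) := by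
        gcongr
        exact hw i
    _ = δ⁻¹ * (w i * (rexp (δ * ℓ i) * rexp (-(a * ℓ i)))) := by ring
    _ = _ := by rw [← Real.exp_add]; ring_nf

theorem summable_smoothSum {a : ℝ} (ha : 1 < a) (t : ℝ) : Summable fun i =>
    w i * ℓ i * rexp (-(a * ℓ i)) * (1 + Real.tanh (ℓ i * (a - 1 / 2))) * Real.cos (t * ℓ i) := by
  refine ((summable_weight hw hℓ hsum ha).mul_left 2).of_norm_bounded fun i => ?_
  have h0 : 0 ≤ w i * ℓ i * rexp (-(a * ℓ i)) :=
    mul_nonneg (mul_nonneg (hw i) (hℓ i).le) (Real.exp_pos _).le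
  rw [norm_mul, norm_mul, Real.norm_of_nonneg h0, Real.norm_eq_abs, Real.norm_eq_abs]
  have h1 := Real.abs_cos_le_one (t * ℓ i)
  have h2 : |1 + Real.tanh (ℓ i * (a - 1 / 2))| ≤ 2 := by
    rw [abs_le]
    constructor <;> linarith [Real.neg_one_lt_tanh (ℓ i * (a - 1 / 2)), Real.tanh_lt_one (ℓ i * (a - 1 / 2))]
  calc _ ≤ w i * ℓ i * rexp (-(a * ℓ i)) * 2 * 1 := by gcongr
    _ = _ := by ring

theorem smoothSum_nonneg_comb {a : ℝ} (ha : 1 < a) (t c₀ c₁ c₂ c₃ c₄ : ℝ)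
    (hc : ∀ θ : ℝ, 0 ≤ c₀ + c₁ * Real.cos θ + c₂ * Real.cos (2 * θ) + c₃ * Real.cos (3 * θ) +
      c₄ * Real.cos (4 * θ)) :
    0 ≤ c₀ * smoothSum w ℓ a 0 + c₁ * smoothSum w ℓ a t + c₂ * smoothSum w ℓ a (2 * t) +
      c₃ * smoothSum w ℓ a (3 * t) + c₄ * smoothSum w ℓ a (4 * t) := by
  have hS := fun u => (summable_smoothSum hw hℓ hsum ha u).hasSum
  have h := (((((hS 0).mul_left c₀).add ((hS t).mul_left c₁)).add ((hS (2 * t)).mul_left c₂)).add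
    ((hS (3 * t)).mul_left c₃)).add ((hS (4 * t)).mul_left c₄)
  refine h.nonneg fun i => ?_
  have h0 : 0 ≤ w i * ℓ i * rexp (-(a * ℓ i)) * (1 + Real.tanh (ℓ i * (a - 1 / 2))) :=
    mul_nonneg (mul_nonneg (mul_nonneg (hw i) (hℓ i).le) (Real.exp_pos _).le)
      (by linarith [Real.neg_one_lt_tanh (ℓ i * (a - 1 / 2))])
  have h1 := mul_nonneg h0 (hc (t * ℓ i))
  rw [zero_mul, Real.cos_zero]
  rw [← mul_assoc, ← mul_assoc, ← mul_assoc] at h1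
  linarith

omit hℓ in
theorem norm_exp_tsum {a : ℝ} (ha : 1 < a) (y : ℝ) :
    ‖Complex.exp (∑' i, (w i : ℂ) * Complex.exp (-((a + y * Complex.I) * ℓ i)))‖ =
      rexp (∑' i, w i * rexp (-(a * ℓ i)) * Real.cos (y * ℓ i)) := by
  have hS : Summable fun i => (w i : ℂ) * Complex.exp (-((a + y * Complex.I) * ℓ i)) := by
    refine (hsum a ha).of_norm_bounded fun i => le_of_eq ?_
    rw [norm_mul, Complex.norm_real, Real.norm_of_nonneg (hw i), Complex.norm_exp]
    simp
  rw [Complex.norm_exp, Complex.re_tsum hS]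
  congr 1
  refine tsum_congr fun i => ?_
  rw [Complex.re_ofReal_mul, Complex.exp_re]
  simp [mul_assoc]

theorem re_logDeriv_eq_of_euler {a : ℝ} (ha : 1 < a) (t : ℝ) {W : ℂ → ℂ}
    (hW : ∀ s : ℂ, 1 < s.re → W s = (s - 1) * Complex.exp (∑' i, (w i : ℂ) * Complex.exp (-(s * ℓ i)))) :
    (deriv W (a + t * Complex.I) / W (a + t * Complex.I)).re =
      (a - 1) / ((a - 1) ^ 2 + t ^ 2) - ∑' i, w i * ℓ i * rexp (-(a * ℓ i)) * Real.cos (t * ℓ i) := by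
  set s₁ : ℂ := a + t * Complex.I with hs₁
  have hre : s₁.re = a := by simp [hs₁]
  set σ := (a + 1) / 2 with hσ
  set Ω : Set ℂ := {s | σ < s.re} with hΩ
  have hΩo : IsOpen Ω := isOpen_lt continuous_const Complex.continuous_re
  have hmem : s₁ ∈ Ω := by
    change σ < s₁.re
    rw [hre, hσ]; linarith
  have hF : ∀ i (s : ℂ), HasDerivAt (fun s : ℂ => (w i : ℂ) * Complex.exp (-(s * ℓ i)))
      (-((w i * ℓ i : ℝ) * Complex.exp (-(s * ℓ i)))) s := by
    intro i s
    have := ((((hasDerivAt_id s).mul_const (ℓ i : ℂ)).neg).cexp).const_mul (w i : ℂ)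
    convert! this using 1
    push_cast
    simp
    ring
  have hb : ∀ i, ∀ s ∈ Ω, ‖(w i : ℂ) * Complex.exp (-(s * ℓ i))‖ ≤ w i * rexp (-(σ * ℓ i)) := by
    intro i s hs
    rw [norm_mul, Complex.norm_real, Real.norm_of_nonneg (hw i), Complex.norm_exp]
    refine mul_le_mul_of_nonneg_left (Real.exp_le_exp.2 ?_) (hw i)
    simp only [Complex.neg_re, Complex.re_mul_ofReal]
    exact neg_le_neg (mul_le_mul_of_nonneg_right (le_of_lt hs) (hℓ i).le)
  have hu := hsum σ (by rw [hσ]; linarith)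
  have hFd : ∀ i, DifferentiableOn ℂ (fun s : ℂ => (w i : ℂ) * Complex.exp (-(s * ℓ i))) Ω :=
    fun i s _ => (hF i s).differentiableAt.differentiableWithinAt
  have hsd := Complex.hasSum_deriv_of_summable_norm hu hFd hΩo hb hmem
  have hHd := Complex.differentiableOn_tsum_of_summable_norm hu hFd hΩo hb
  set H : ℂ → ℂ := fun s => ∑' i, (w i : ℂ) * Complex.exp (-(s * ℓ i)) with hH
  have hHa : HasDerivAt H (deriv H s₁) s₁ :=
    ((hHd s₁ hmem).differentiableAt (hΩo.mem_nhds hmem)).hasDerivAt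
  have hWe : W =ᶠ[nhds s₁] fun s => (s - 1) * Complex.exp (H s) := by
    filter_upwards [hΩo.mem_nhds hmem] with s hs
    refine hW s (lt_trans ?_ (show σ < s.re from hs))
    rw [hσ]; linarith
  have hWa : HasDerivAt (fun s : ℂ => (s - 1) * Complex.exp (H s)) _ s₁ :=
    (((hasDerivAt_id s₁).sub_const 1)).mul hHa.cexp
  have hne : s₁ - 1 ≠ 0 := by
    intro h
    have := congrArg Complex.re h
    simp only [Complex.sub_re, Complex.one_re, Complex.zero_re] at this
    linarith
  have hq : deriv W s₁ / W s₁ = 1 / (s₁ - 1) + deriv H s₁ := by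
    rw [hWe.deriv_eq, hWe.eq_of_nhds, hWa.deriv]
    have := Complex.exp_ne_zero (H s₁)
    simp only [id]
    field_simp
  rw [hq, Complex.add_re]
  have h2 := Complex.hasSum_re hsd
  have h3 : ∀ i, (deriv (fun s : ℂ => (w i : ℂ) * Complex.exp (-(s * ℓ i))) s₁).re =
      -(w i * ℓ i * rexp (-(a * ℓ i)) * Real.cos (t * ℓ i)) := by
    intro i
    rw [(hF i s₁).deriv, Complex.neg_re, Complex.re_ofReal_mul, Complex.exp_re]
    simp [hs₁, mul_assoc]
  simp_rw [h3] at h2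
  have h4 : (1 / (s₁ - 1)).re = (a - 1) / ((a - 1) ^ 2 + t ^ 2) := by
    rw [one_div, Complex.inv_re, Complex.normSq_apply]
    simp [hs₁]
    ring
  have h5 := h2.tsum_eq
  rw [tsum_neg] at h5
  rw [h4, ← h5]
  ring

theorem smoothSum_eq {a : ℝ} (ha : 1 < a) (t : ℝ) : smoothSum w ℓ a t =
    ∑' i, w i * ℓ i * rexp (-(a * ℓ i)) * Real.cos (t * ℓ i) +
    ∑' i, w i * ℓ i * rexp (-(a * ℓ i)) * Real.tanh (ℓ i * (a - 1 / 2)) * Real.cos (t * ℓ i) := by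
  have h2 := (hasSum_re_deriv_coshSeries hw hℓ hsum ha t).summable
  have h1 : Summable fun i => w i * ℓ i * rexp (-(a * ℓ i)) * Real.cos (t * ℓ i) := by
    refine ((summable_smoothSum hw hℓ hsum ha t).sub h2).congr fun i => ?_
    ring
  rw [← h1.tsum_add h2]
  refine tsum_congr fun i => ?_
  ring

end

end

noncomputable section

open Real Filter MeasureTheory Set Matrix NumberField
open scoped nonZeroDivisors

section

variable {ι : Type} {w ℓ : ι → ℝ} (hw : ∀ i, 0 ≤ w i) (hℓ : ∀ i, 0 < ℓ i)
  (hsum : ∀ σ : ℝ, 1 < σ → Summable fun i => w i * rexp (-(σ * ℓ i)))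
  {W : ℂ → ℂ} (hWd : Differentiable ℂ W)
  (hg : ∃ C, ∀ s : ℂ, -1 ≤ s.re → s.re ≤ 2 → 1 ≤ |s.im| → ‖W s‖ ≤ C * rexp (C * |s.im|))
  (hW : ∀ s : ℂ, 1 < s.re → W s = (s - 1) * Complex.exp (∑' i, (w i : ℂ) * Complex.exp (-(s * ℓ i))))
  {a : ℝ} (ha : 1 < a) {t A P : ℝ} (hP : 0 ≤ P)
  (hleft : ∀ y : ℝ, ‖W (1 - a + y * Complex.I)‖ ≤ ‖(1 - a + y * Complex.I) - (2 * a - 1 : ℝ)‖ *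
      rexp (∑' i, w i * rexp (-(a * ℓ i)) * Real.cos (y * ℓ i)) *
      rexp (A * (2 * a - 1) + P * Real.sin (2 * a - 1) * Real.cosh (y - t)))
include hw hℓ hsum hWd hg hW ha hP hleft

omit hℓ hWd hg hP hleft in
theorem norm_right_edge (y : ℝ) : ‖W (a + y * Complex.I)‖ =
    ‖(a + y * Complex.I) - (2 * a - 1 : ℝ)‖ *
      rexp (∑' i, w i * rexp (-(a * ℓ i)) * Real.cos (y * ℓ i)) := by
  rw [hW _ (by simpa using ha), norm_mul, norm_exp_tsum hw hsum ha]
  congr 1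
  rw [show (a + y * Complex.I - 1 : ℂ) = ((a - 1 : ℝ) : ℂ) + y * Complex.I by push_cast; ring,
    show (a + y * Complex.I - (2 * a - 1 : ℝ) : ℂ) = ((-(a - 1) : ℝ) : ℂ) + y * Complex.I by
      push_cast; ring, Complex.norm_add_mul_I, Complex.norm_add_mul_I, neg_sq]

omit hw hℓ hsum hWd hg hW ha hP hleft in
theorem re_one_div_sub (a t : ℝ) : (1 / ((a + t * Complex.I) - (2 * a - 1 : ℝ)) : ℂ).re =
    -((a - 1) / ((a - 1) ^ 2 + t ^ 2)) := by
  rw [show (a + t * Complex.I - (2 * a - 1 : ℝ) : ℂ) = ((-(a - 1) : ℝ) : ℂ) + t * Complex.I by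
      push_cast; ring, one_div, Complex.inv_re, Complex.normSq_add_mul_I]
  rw [neg_sq, ← neg_div]
  simp

theorem smoothSum_le (ha1 : a ≤ 5 / 4) :
    smoothSum w ℓ a t ≤ 2 * ((a - 1) / ((a - 1) ^ 2 + t ^ 2)) + A + P := by
  have h := tsum_tanh_le_re_logDeriv hw hℓ hsum ha ha1 hWd hg hP
    (fun y => (norm_right_edge hw hsum hW ha y).le) (norm_right_edge hw hsum hW ha t) hleft
  rw [re_logDeriv_eq_of_euler hw hℓ hsum ha t hW, re_one_div_sub] at h
  rw [smoothSum_eq hw hℓ hsum ha]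
  linarith

theorem smoothSum_le_of_zero (ha1 : a ≤ 11 / 10) {β : ℝ} (hβ1 : β ≤ 1) (hβ : 2 - a ≤ β)
    (h0 : W (β + t * Complex.I) = 0) :
    smoothSum w ℓ a t ≤ 2 * ((a - 1) / ((a - 1) ^ 2 + t ^ 2)) - 2 / (a - β) + (A + 4 * (a - 1)) + P := by
  set ρ : ℂ := β + t * Complex.I with hρ
  set ρ' : ℂ := (2 * a - β : ℝ) + t * Complex.I with hρ'
  have haβ : 0 < a - β := by linarith
  have hfac : ∀ s, (s - ρ) * dslope W ρ s = W s := by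
    intro s
    have := sub_smul_dslope W ρ s
    rwa [h0, sub_zero, smul_eq_mul] at this
  have hDd : Differentiable ℂ (dslope W ρ) := by
    rw [← differentiableOn_univ] at hWd ⊢
    exact (Complex.differentiableOn_dslope univ_mem).2 hWd
  set U : ℂ → ℂ := fun s => dslope W ρ s * (s - ρ') with hU
  have hUd : Differentiable ℂ U := hDd.mul (by fun_prop)
  have hUnorm : ∀ s, s ≠ ρ → ‖U s‖ = ‖W s‖ * (‖s - ρ'‖ / ‖s - ρ‖) := by
    intro s hs
    have : ‖s - ρ‖ ≠ 0 := norm_ne_zero_iff.2 (sub_ne_zero.2 hs)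
    rw [← hfac s, hU, norm_mul, norm_mul]
    field_simp
  have hR : ∀ y : ℝ, ‖U (a + y * Complex.I)‖ = ‖W (a + y * Complex.I)‖ := by
    intro y
    have hne : (a + y * Complex.I : ℂ) ≠ ρ := by
      intro h
      have := congrArg Complex.re h
      simp [hρ] at this
      linarith
    have hn : ‖(a + y * Complex.I : ℂ) - ρ'‖ = ‖(a + y * Complex.I : ℂ) - ρ‖ := by
      rw [show (a + y * Complex.I - ρ' : ℂ) = ((-(a - β) : ℝ) : ℂ) + ((y - t : ℝ) : ℂ) * Complex.I by
          rw [hρ']; push_cast; ring,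
        show (a + y * Complex.I - ρ : ℂ) = ((a - β : ℝ) : ℂ) + ((y - t : ℝ) : ℂ) * Complex.I by
          rw [hρ]; push_cast; ring, Complex.norm_add_mul_I, Complex.norm_add_mul_I, neg_sq]
    rw [hUnorm _ hne, hn, div_self (norm_ne_zero_iff.2 (sub_ne_zero.2 hne)), mul_one]
  have hL : ∀ y : ℝ, ‖U (1 - a + y * Complex.I)‖ ≤
      ‖W (1 - a + y * Complex.I)‖ * rexp (4 * (a - 1) * (2 * a - 1)) := by
    intro y
    have hne : (1 - a + y * Complex.I : ℂ) ≠ ρ := by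
      intro h
      have := congrArg Complex.re h
      simp [hρ] at this
      linarith
    rw [hUnorm _ hne]
    gcongr
    have h1 : 1 + 4 * (a - 1) ≤ rexp (4 * (a - 1) * (2 * a - 1)) := by
      have := Real.add_one_le_exp (4 * (a - 1) * (2 * a - 1))
      nlinarith
    refine le_trans ?_ h1
    rw [div_le_iff₀ (norm_pos_iff.2 (sub_ne_zero.2 hne)),
      show (1 - a + y * Complex.I - ρ' : ℂ) = ((1 - 3 * a + β : ℝ) : ℂ) + ((y - t : ℝ) : ℂ) * Complex.I by
          rw [hρ']; push_cast; ring,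
        show (1 - a + y * Complex.I - ρ : ℂ) = ((1 - a - β : ℝ) : ℂ) + ((y - t : ℝ) : ℂ) * Complex.I by
          rw [hρ]; push_cast; ring, Complex.norm_add_mul_I, Complex.norm_add_mul_I]
    rw [Real.sqrt_le_left (by positivity), mul_pow, Real.sq_sqrt (by positivity)]
    have h2 : 3 * a - 1 - β ≤ (1 + 4 * (a - 1)) * (a + β - 1) := by nlinarith
    have h3 : (1 - 3 * a + β) ^ 2 ≤ (1 + 4 * (a - 1)) ^ 2 * (1 - a - β) ^ 2 := by
      have := pow_le_pow_left₀ (by linarith : 0 ≤ 3 * a - 1 - β) h2 2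
      rw [mul_pow] at this
      linarith
    have h4 : 1 ≤ (1 + 4 * (a - 1)) ^ 2 := by nlinarith
    nlinarith [sq_nonneg (y - t)]
  have hgU : ∃ C, ∀ s : ℂ, -1 ≤ s.re → s.re ≤ 2 → 1 ≤ |s.im| → ‖U s‖ ≤ C * rexp (C * |s.im|) := by
    obtain ⟨C, hC⟩ := hg
    have hC0 : 0 ≤ C := nonneg_of_mul_nonneg_left ((norm_nonneg _).trans
      (hC Complex.I (by simp) (by simp) (by simp))) (Real.exp_pos _)
    obtain ⟨M, hM⟩ := (isCompact_closedBall ρ 1).exists_bound_of_continuousOn hUd.continuous.continuousOn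
    have hM0 : 0 ≤ M := (norm_nonneg _).trans (hM ρ (Metric.mem_closedBall_self zero_le_one))
    have hq0 := norm_nonneg (ρ - ρ')
    refine ⟨M + C + C * (1 + ‖ρ - ρ'‖), fun s hs1 hs2 hs3 => ?_⟩
    have hX : 1 ≤ rexp ((M + C + C * (1 + ‖ρ - ρ'‖)) * |s.im|) := Real.one_le_exp (by positivity)
    have hCq : 0 ≤ C * (1 + ‖ρ - ρ'‖) := by positivity
    by_cases hs : s ∈ Metric.closedBall ρ 1
    · have := hM s hs
      nlinarith
    · have hs4 : 1 ≤ ‖s - ρ‖ := by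
        rw [Metric.mem_closedBall, not_le, dist_eq_norm] at hs
        exact hs.le
      have hne : s ≠ ρ := by
        rintro rfl
        simp at hs
      rw [hUnorm s hne]
      have h1 : ‖s - ρ'‖ / ‖s - ρ‖ ≤ 1 + ‖ρ - ρ'‖ := by
        rw [div_le_iff₀ (by linarith)]
        have := norm_sub_le_norm_sub_add_norm_sub s ρ ρ'
        nlinarith
      calc _ ≤ C * rexp (C * |s.im|) * (1 + ‖ρ - ρ'‖) := by
            gcongr
            exact hC s hs1 hs2 hs3
        _ ≤ C * rexp ((M + C + C * (1 + ‖ρ - ρ'‖)) * |s.im|) * (1 + ‖ρ - ρ'‖) := by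
            gcongr
            linarith
        _ ≤ _ := by nlinarith
  have h := tsum_tanh_le_re_logDeriv hw hℓ hsum ha (by linarith) hUd hgU hP (A := A + 4 * (a - 1))
    (fun y => ((hR y).trans (norm_right_edge hw hsum hW ha y)).le)
    ((hR t).trans (norm_right_edge hw hsum hW ha t))
    (fun y => by
      refine (hL y).trans ?_
      refine (mul_le_mul_of_nonneg_right (hleft y) (Real.exp_pos _).le).trans_eq ?_
      rw [mul_assoc _ (rexp _) (rexp (4 * (a - 1) * (2 * a - 1))), ← Real.exp_add]
      congr 2
      ring)
  have hs₁ρ : (a + t * Complex.I : ℂ) - ρ = ((a - β : ℝ) : ℂ) := by rw [hρ]; push_cast; ring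
  have hs₁ρ' : (a + t * Complex.I : ℂ) - ρ' = ((-(a - β) : ℝ) : ℂ) := by rw [hρ']; push_cast; ring
  have hlog : (deriv U (a + t * Complex.I) / U (a + t * Complex.I)).re =
      (deriv W (a + t * Complex.I) / W (a + t * Complex.I)).re - 2 / (a - β) := by
    set s₁ : ℂ := a + t * Complex.I with hs₁
    have hW1 : W s₁ ≠ 0 := by
      rw [hW _ (by simpa [hs₁] using ha)]
      refine mul_ne_zero (fun h => ?_) (Complex.exp_ne_zero _)
      have := congrArg Complex.re h
      simp [hs₁] at this
      linarith
    have hr1 : s₁ - ρ ≠ 0 := by rw [hs₁ρ]; exact_mod_cast haβ.ne'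
    have hr2 : s₁ - ρ' ≠ 0 := by rw [hs₁ρ']; exact_mod_cast (neg_ne_zero.2 haβ.ne')
    have hds : dslope W ρ s₁ ≠ 0 := by
      intro h
      have := hfac s₁
      rw [h, mul_zero] at this
      exact hW1 this.symm
    have hD := (hDd s₁).hasDerivAt
    have e1 : HasDerivAt W (1 * dslope W ρ s₁ + (s₁ - ρ) * deriv (dslope W ρ) s₁) s₁ := by
      have := ((hasDerivAt_id s₁).sub_const ρ).mul hD
      refine this.congr_of_eventuallyEq (Eventually.of_forall fun s => (hfac s).symm)
    have e2 : HasDerivAt U (deriv (dslope W ρ) s₁ * (s₁ - ρ') + dslope W ρ s₁ * 1) s₁ :=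
      hD.mul ((hasDerivAt_id s₁).sub_const ρ')
    have e3 : deriv U s₁ / U s₁ = deriv W s₁ / W s₁ - 1 / (s₁ - ρ) + 1 / (s₁ - ρ') := by
      rw [e1.deriv, e2.deriv, ← hfac s₁]
      simp only [hU]
      field_simp
      ring
    rw [e3, hs₁ρ, hs₁ρ', Complex.add_re, Complex.sub_re, one_div, one_div, ← Complex.ofReal_inv,
      ← Complex.ofReal_inv, Complex.ofReal_re, Complex.ofReal_re, inv_neg]
    ring
  rw [hlog, re_logDeriv_eq_of_euler hw hℓ hsum ha t hW, re_one_div_sub] at h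
  rw [smoothSum_eq hw hℓ hsum ha]
  linarith

end

end

noncomputable section

open Real Filter MeasureTheory Set Matrix NumberField
open scoped nonZeroDivisors

theorem three_quarters_le_sin {ε : ℝ} (hε : 0 < ε) (hε1 : ε ≤ 1 / 100) : 3 / 4 ≤ Real.sin (1 + 2 * ε) := by
  have h1 : Real.sin 1 ≤ Real.sin (1 + 2 * ε) :=
    Real.sin_le_sin_of_le_of_le_pi_div_two (by linarith [Real.pi_gt_three]) (by linarith [Real.pi_gt_three])
      (by linarith)
  have := Real.sin_gt_sub_cube (x := 1) one_pos
  norm_num at this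
  linarith

theorem gamma_factor_bound {ε : ℝ} (hε : 0 < ε) (hε1 : ε ≤ 1 / 100) {t τ : ℝ} (hτ : 1 ≤ τ)
    (ht : |t| ≤ 4 * τ) (y : ℝ) :
    (1 + |y|) / (2 * π) * ((1 + y ^ 2) ^ ε * rexp (2 * ε)) ≤
      rexp (2 * ((1 / 2 * Real.log τ) * (1 + 2 * ε) + 0.08 * Real.sin (1 + 2 * ε) * Real.cosh (y - t))) := by
  set u := |y - t| with hu
  have hu0 : 0 ≤ u := abs_nonneg _
  have hτ0 : 0 < τ := by linarith
  have h1 : 1 + |y| ≤ τ * (5 + u) := by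
    have : |y| ≤ u + |t| := by
      have := abs_add_le (y - t) t
      rwa [sub_add_cancel] at this
    nlinarith
  have hy0 := abs_nonneg y
  have e1 : (5 + u) / (2 * π) ≤ rexp ((5 + u) / 6.28 - 1) := by
    have h2 : (5 + u) / (2 * π) ≤ (5 + u) / 6.28 := by
      gcongr
      linarith [Real.pi_gt_d2]
    linarith [Real.add_one_le_exp ((5 + u) / 6.28 - 1)]
  have e2 : 5 + u ≤ rexp (4 + u) := by linarith [Real.add_one_le_exp (4 + u)]
  have hτe : τ = rexp (Real.log τ) := (Real.exp_log hτ0).symm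
  have e3 : 1 + |y| ≤ rexp (Real.log τ + (4 + u)) := by
    rw [Real.exp_add, Real.exp_log hτ0]
    refine h1.trans ?_
    gcongr
  have e4 : (1 + |y|) / (2 * π) ≤ rexp (Real.log τ + ((5 + u) / 6.28 - 1)) := by
    rw [Real.exp_add, Real.exp_log hτ0]
    calc _ ≤ τ * (5 + u) / (2 * π) := by gcongr
      _ = τ * ((5 + u) / (2 * π)) := by ring
      _ ≤ _ := by gcongr
  have e5 : (1 + y ^ 2) ^ ε ≤ rexp (2 * (Real.log τ + (4 + u)) * ε) := by
    rw [Real.exp_mul]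
    refine Real.rpow_le_rpow (by positivity) ?_ hε.le
    rw [two_mul, Real.exp_add]
    calc 1 + y ^ 2 ≤ (1 + |y|) * (1 + |y|) := by nlinarith [sq_abs y]
      _ ≤ _ := by gcongr
  have hcosh : 1 + u ^ 2 / 2 ≤ Real.cosh (y - t) := by
    rw [← Real.cosh_abs, ← hu]
    have h2 : u / 2 ≤ Real.sinh (u / 2) := Real.self_le_sinh_iff.2 (by linarith)
    have h3 := Real.cosh_two_mul (u / 2)
    rw [mul_div_cancel₀ _ two_ne_zero] at h3
    nlinarith [Real.cosh_sq (u / 2)]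
  calc _ ≤ rexp (Real.log τ + ((5 + u) / 6.28 - 1)) *
        (rexp (2 * (Real.log τ + (4 + u)) * ε) * rexp (2 * ε)) := by gcongr
    _ = rexp (Real.log τ + ((5 + u) / 6.28 - 1) + (2 * (Real.log τ + (4 + u)) * ε + 2 * ε)) := by
        rw [← Real.exp_add, ← Real.exp_add]
    _ ≤ _ := by
        refine Real.exp_le_exp.2 ?_
        have hs := three_quarters_le_sin hε hε1
        have h3 : 3 / 4 * (1 + u ^ 2 / 2) ≤ Real.sin (1 + 2 * ε) * Real.cosh (y - t) :=
          mul_le_mul hs hcosh (by positivity) (by linarith)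
        have h4 : (5 + u) * ε ≤ (5 + u) * (1 / 100) := by gcongr
        have h5 : (5 + u) / 6.28 ≤ 0.1593 * (5 + u) := by
          rw [div_le_iff₀ (by norm_num)]
          nlinarith
        nlinarith [sq_nonneg (u - 3 / 2)]

variable (K : Type) [Field K] [NumberField K]

theorem norm_left_edge {W : ℂ → ℂ}
    (hWl : ∀ s : ℂ, 1 < s.re → ‖W (1 - s)‖ = ‖s‖ * ‖zetaSeries K s‖ * absDiscr K ^ (s.re - 1/2) *
      (‖gammaProd K s‖ * ‖gammaProdInv K (1 - s)‖))
    {ι : Type} {w ℓ : ι → ℝ} (hw : ∀ i, 0 ≤ w i)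
    (hsum : ∀ σ : ℝ, 1 < σ → Summable fun i => w i * rexp (-(σ * ℓ i)))
    (hE : ∀ s : ℂ, 1 < s.re → zetaSeries K s =
      Complex.exp (∑' i, (w i : ℂ) * Complex.exp (-(s * ℓ i))))
    {ε : ℝ} (hε : 0 < ε) (hε1 : ε ≤ 1 / 100) {t τ : ℝ} (hτ : 1 ≤ τ) (ht : |t| ≤ 4 * τ) (y : ℝ) :
    ‖W (1 - (1 + ε : ℝ) + y * Complex.I)‖ ≤
      ‖(1 - (1 + ε : ℝ) + y * Complex.I) - (2 * (1 + ε) - 1 : ℝ)‖ *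
      rexp (∑' i, w i * rexp (-((1 + ε) * ℓ i)) * Real.cos (y * ℓ i)) *
      rexp ((Real.log (absDiscr K) + Module.finrank ℚ K * Real.log τ) / 2 * (2 * (1 + ε) - 1) +
        0.08 * Module.finrank ℚ K * Real.sin (2 * (1 + ε) - 1) * Real.cosh (y - t)) := by
  have ha : 1 < 1 + ε := by linarith
  set s : ℂ := (1 + ε : ℝ) + (-y : ℝ) * Complex.I with hs
  have hsre : s.re = 1 + ε := by simp [hs]
  have e0 : (1 - (1 + ε : ℝ) + y * Complex.I : ℂ) = 1 - s := by rw [hs]; push_cast; ring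
  have e1 : ‖s‖ ≤ ‖(1 - (1 + ε : ℝ) + y * Complex.I : ℂ) - (2 * (1 + ε) - 1 : ℝ)‖ := by
    rw [show (1 - (1 + ε : ℝ) + y * Complex.I - (2 * (1 + ε) - 1 : ℝ) : ℂ) =
      ((-(1 + 3 * ε) : ℝ) : ℂ) + y * Complex.I by push_cast; ring, hs, Complex.norm_add_mul_I,
      Complex.norm_add_mul_I]
    refine Real.sqrt_le_sqrt ?_
    nlinarith
  have e2 : ‖zetaSeries K s‖ = rexp (∑' i, w i * rexp (-((1 + ε) * ℓ i)) * Real.cos (y * ℓ i)) := by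
    rw [hE s (by rw [hsre]; exact ha), hs, norm_exp_tsum hw hsum ha]
    simp only [neg_mul, Real.cos_neg]
  have e3 : absDiscr K ^ (s.re - 1 / 2) = rexp (Real.log (absDiscr K) / 2 * (2 * (1 + ε) - 1)) := by
    rw [hsre, Real.rpow_def_of_pos (absDiscr_pos K)]
    congr 1
    ring
  have e4 : ‖gammaProd K s‖ * ‖gammaProdInv K (1 - s)‖ ≤
      rexp (Module.finrank ℚ K * ((1 / 2 * Real.log τ) * (1 + 2 * ε) +
        0.08 * Real.sin (1 + 2 * ε) * Real.cosh (y - t))) := by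
    refine le_of_sq_le_sq ?_ (Real.exp_pos _).le
    have h := norm_gammaProd_mul_gammaProdInv_sq_le K (y := -y) hε (by linarith)
    rw [show (1 + ε + (-y : ℝ) * Complex.I : ℂ) = s by rw [hs]; push_cast; ring, abs_neg, neg_sq] at h
    refine h.trans ((pow_le_pow_left₀ (by positivity) (gamma_factor_bound hε hε1 hτ ht y) _).trans_eq ?_)
    rw [← Real.exp_nat_mul, ← Real.exp_nat_mul]
    congr 1
    push_cast
    ring
  rw [e0, hWl s (by rw [hsre]; exact ha), e2, e3]
  rw [e0] at e1
  calc _ ≤ ‖1 - s - (2 * (1 + ε) - 1 : ℝ)‖ *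
        rexp (∑' i, w i * rexp (-((1 + ε) * ℓ i)) * Real.cos (y * ℓ i)) *
        rexp (Real.log (absDiscr K) / 2 * (2 * (1 + ε) - 1)) *
        rexp (Module.finrank ℚ K * ((1 / 2 * Real.log τ) * (1 + 2 * ε) +
          0.08 * Real.sin (1 + 2 * ε) * Real.cosh (y - t))) := by
        gcongr
    _ = _ := by
        rw [mul_assoc _ (rexp (Real.log (absDiscr K) / 2 * (2 * (1 + ε) - 1))), ← Real.exp_add,
          show 2 * (1 + ε) - 1 = 1 + 2 * ε by ring]
        congr 2
        ring

end

noncomputable section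

open Real Filter MeasureTheory Set Matrix NumberField
open scoped nonZeroDivisors

theorem trig_poly_nonneg (θ : ℝ) : 0 ≤ 11.18563264 + 19.07286528 * Real.cos θ +
    11.67598656 * Real.cos (2 * θ) + 4.7568 * Real.cos (3 * θ) + 1 * Real.cos (4 * θ) := by
  have h2 := Real.cos_two_mul θ
  have h3 := Real.cos_three_mul θ
  have h4 := Real.cos_two_mul (2 * θ)
  rw [show 2 * (2 * θ) = 4 * θ by ring, h2] at h4
  rw [h2, h3, h4]
  nlinarith [sq_nonneg (Real.cos θ ^ 2 + 1.1892 * Real.cos θ + 0.2524)]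

/-- An analytic continuation of the Dedekind zeta series to `ℂ ∖ {1}` is determined by the entire
function `(s - 1) ζ_K(s)`. -/
theorem eqOn_of_continuation {Z W F : ℂ → ℂ} (hZ : ∀ s : ℂ, s ≠ 1 → AnalyticAt ℂ Z s)
    (hZF : ∀ s : ℂ, 1 < s.re → Z s = F s) (hW : Differentiable ℂ W)
    (hWF : ∀ s : ℂ, 1 < s.re → W s = (s - 1) * F s) {s : ℂ} (hs : s ≠ 1) :
    W s = (s - 1) * Z s := by
  have h1 : AnalyticOnNhd ℂ W {(1 : ℂ)}ᶜ := fun z _ => hW.analyticAt z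
  have h2 : AnalyticOnNhd ℂ (fun s => (s - 1) * Z s) {(1 : ℂ)}ᶜ :=
    fun z hz => (analyticAt_id.sub analyticAt_const).mul (hZ z hz)
  have hc : IsPreconnected ({(1 : ℂ)}ᶜ) :=
    (isConnected_compl_singleton_of_one_lt_rank (by simp) 1).isPreconnected
  refine h1.eqOn_of_preconnected_of_eventuallyEq h2 hc (z₀ := 2) (by simp) ?_ hs
  have ho : {s : ℂ | 1 < s.re} ∈ nhds (2 : ℂ) :=
    (isOpen_lt continuous_const Complex.continuous_re).mem_nhds (by simp)
  filter_upwards [ho] with z hz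
  rw [hWF z hz, hZF z hz]

variable (K : Type) [Field K] [NumberField K]

set_option maxHeartbeats 400000 in
theorem no_zero_of_entire {W : ℂ → ℂ} (hWd : Differentiable ℂ W)
    (hWF : ∀ s : ℂ, 1 < s.re → W s = (s - 1) * zetaSeries K s)
    (hWl : ∀ s : ℂ, 1 < s.re → ‖W (1 - s)‖ = ‖s‖ * ‖zetaSeries K s‖ * absDiscr K ^ (s.re - 1/2) *
      (‖gammaProd K s‖ * ‖gammaProdInv K (1 - s)‖))
    (hg : ∃ C, ∀ s : ℂ, -1 ≤ s.re → s.re ≤ 2 → 1 ≤ |s.im| → ‖W s‖ ≤ C * rexp (C * |s.im|))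
    (hL : 30 ≤ Real.log (absDiscr K)) {β γ : ℝ} (hγ : 1 ≤ |γ|)
    (hβ : 1 - 1 / (12.55 * Real.log (absDiscr K) + 9.69 * (Module.finrank ℚ K : ℝ) * Real.log |γ| +
      3.03 * (Module.finrank ℚ K : ℝ) + 58.63) ≤ β) : W (β + γ * Complex.I) ≠ 0 := by
  intro h0
  obtain ⟨ι, w, ℓ, hw, hℓ, hsum, hE⟩ := exists_euler_family K
  have hW : ∀ s : ℂ, 1 < s.re → W s = (s - 1) *
      Complex.exp (∑' i, (w i : ℂ) * Complex.exp (-(s * ℓ i))) := fun s hs => by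
    rw [hWF s hs, hE s hs]
  have hβ1 : β ≤ 1 := by
    by_contra! h
    rw [hW _ (by simpa using h)] at h0
    rcases mul_eq_zero.1 h0 with h1 | h1
    · have := congrArg Complex.re h1
      simp at this
      linarith
    · exact Complex.exp_ne_zero _ h1
  set L := Real.log (absDiscr K)
  set N : ℝ := (Module.finrank ℚ K : ℝ)
  set l := Real.log |γ|
  have hN : 0 ≤ N := Nat.cast_nonneg _
  have hl : 0 ≤ l := Real.log_nonneg hγ
  set Λ := 12.55 * L + 9.69 * N * l + 3.03 * N + 58.63 with hΛ
  have hNl : 0 ≤ N * l := mul_nonneg hN hl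
  have hΛ0 : 376 ≤ Λ := by
    rw [hΛ]
    linarith
  have hΛp : 0 < Λ := by linarith
  set ε := 3.27 / Λ with hε
  have hε0 : 0 < ε := by positivity
  have hε1 : ε ≤ 1 / 100 := by
    rw [hε, div_le_iff₀ hΛp]
    linarith
  have hβε : 1 - β ≤ ε := by
    have : 1 / Λ ≤ ε := by
      rw [hε]
      gcongr
      norm_num
    linarith
  have hP : 0 ≤ 0.08 * N := by positivity
  have ha : 1 < 1 + ε := by linarith
  have bound : ∀ t τ : ℝ, 1 ≤ τ → |t| ≤ 4 * τ → smoothSum w ℓ (1 + ε) t ≤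
      2 * (ε / (ε ^ 2 + t ^ 2)) + (L + N * Real.log τ) / 2 + 0.08 * N := by
    intro t τ hτ ht
    have := smoothSum_le hw hℓ hsum hWd hg hW ha hP
      (norm_left_edge K hWl hw hsum hE hε0 hε1 hτ ht) (by linarith)
    rwa [add_sub_cancel_left] at this
  have bound' : ∀ t : ℝ, 1 ≤ |t| → |t| ≤ 4 * |γ| → smoothSum w ℓ (1 + ε) t ≤
      2 * ε + (L + N * l) / 2 + 0.08 * N := by
    intro t h1 h2
    refine (bound t |γ| hγ h2).trans ?_
    gcongr
    refine div_le_self hε0.le ?_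
    nlinarith [sq_abs t]
  have b0 := bound 0 1 le_rfl (by simp)
  have b1 := smoothSum_le_of_zero hw hℓ hsum hWd hg hW ha hP
    (norm_left_edge K hWl hw hsum hE hε0 hε1 (t := γ) (τ := |γ|) hγ (by linarith)) (by linarith)
    hβ1 (by linarith) h0
  have b2 := bound' (2 * γ) (by rw [abs_mul, abs_two]; linarith) (by rw [abs_mul, abs_two]; linarith)
  have b3 := bound' (3 * γ) (by rw [abs_mul, abs_of_pos three_pos]; linarith)
    (by rw [abs_mul, abs_of_pos three_pos]; linarith)
  have b4 := bound' (4 * γ) (by rw [abs_mul, abs_of_pos four_pos]; linarith)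
    (by rw [abs_mul, abs_of_pos four_pos])
  rw [add_sub_cancel_left] at b1
  have e1 : ε / (ε ^ 2 + γ ^ 2) ≤ ε := div_le_self hε0.le (by nlinarith [sq_abs γ])
  have e2 : ε / (ε ^ 2 + 0 ^ 2) = Λ / 3.27 := by
    rw [hε]
    field_simp
    norm_num
  have e3 : 2 * Λ / 4.27 ≤ 2 / (1 + ε - β) := by
    rw [div_le_div_iff₀ (by norm_num) (by linarith)]
    have : (1 + ε - β) * Λ ≤ 4.27 := by
      have i1 : ε * Λ = 3.27 := div_mul_cancel₀ _ hΛp.ne'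
      have i2 : (1 - β) * Λ ≤ 1 := by
        rw [← le_div_iff₀ hΛp]
        linarith
      linarith
    linarith
  have main := smoothSum_nonneg_comb hw hℓ hsum ha γ _ _ _ _ _ trig_poly_nonneg
  rw [e2, Real.log_one, mul_zero, add_zero] at b0
  change smoothSum w ℓ (1 + ε) γ ≤ _ - _ + ((L + N * l) / 2 + 4 * ε) + 0.08 * N at b1
  clear_value ε Λ L N l
  have e4 : 2 * (Λ / 3.27) ≤ 0.6116208 * Λ := by
    rw [← mul_div_assoc, div_le_iff₀ (by norm_num)]
    linarith
  have e5 : 0.4683840 * Λ ≤ 2 * Λ / 4.27 := by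
    rw [le_div_iff₀ (by norm_num)]
    linarith
  linarith

theorem log_absDiscr_ge {x : ℝ} (h : rexp x ≤ |(discr K : ℝ)|) : x ≤ Real.log (absDiscr K) :=
  (Real.le_log_iff_exp_le (absDiscr_pos K)).2 h

end

/-- If `d_K` is sufficiently large, then `ζ_K(s)` has no zeros in the region
`Re s ≥ 1 - 1/(12.55 log d_K + 9.69 n_K log|Im s| + 3.03 n_K + 58.63)`, `|Im s| ≥ 1`. -/
theorem dedekindZeta_zero_free_region_large_t :
    ∃ D0 : ℝ, 0 < D0 ∧
      ∀ (K : Type) [Field K] [NumberField K] (Z : ℂ → ℂ), IsDedekindZeta K Z →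
        D0 ≤ |(NumberField.discr K : ℝ)| →
        ∀ s : ℂ, 1 ≤ |s.im| →
          1 - 1 / (12.55 * Real.log |(NumberField.discr K : ℝ)|
              + 9.69 * (Module.finrank ℚ K : ℝ) * Real.log |s.im|
              + 3.03 * (Module.finrank ℚ K : ℝ) + 58.63) ≤ s.re →
          Z s ≠ 0 := by
  refine ⟨Real.exp 30, Real.exp_pos 30, fun K _ _ Z hZ hD s hs hre h0 => ?_⟩
  obtain ⟨W, hWd, hWF, hWl, hg⟩ := exists_entire K
  have hs1 : s ≠ 1 := by
    rintro rfl
    norm_num at hs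
  have h := no_zero_of_entire K hWd hWF hWl hg (log_absDiscr_ge K hD) hs hre
  rw [Complex.re_add_im] at h
  refine h ?_
  rw [eqOn_of_continuation hZ.1 hZ.2.2 hWd hWF hs1, h0, mul_zero]
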